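/- arXiv:1809.07711 — 2 statements merged into one kernel-verified Lean document; each statement's English description precedes it below -/
import Mathlib

section
/- Assume f satisfies (f1), (f2), (f3) and q satisfies (q1), (q2), (q3), and let α* ∈ 𝒢₁. Then there exists δ > 0 such that for all α₁, α₂ ∈ (α*−δ, α*+δ) with b < α₁ < α₂: (a) if α₁ ∈ 𝒢₁ ∪ 𝒩₁, then α₂ ∈ 𝒩₁, Z₁(α₁) > Z₁(α₂), and |u′(Z₁(α₁),α₁)| < |u′(Z₁(α₂),α₂)|; (b) if α₂ ∈ 𝒢₁, then α₁ ∈ 𝒫₁. -/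
open Set Filter MeasureTheory Topology

noncomputable section

/-- `F(s) = ∫₀ˢ f(t) dt`. -/
def Fint (f : ℝ → ℝ) (s : ℝ) : ℝ := ∫ t in (0:ℝ)..s, f t

/-- `s ∈ (−c, c)` where `c ∈ (0, ∞]` is viewed as an extended real. -/
def InCC (c : EReal) (s : ℝ) : Prop := -c < (s : EReal) ∧ (s : EReal) < c

/-- A solution of equation (E):  `u'' + (q'/q) u' + f(u) = 0` on `(0,∞)`,
`u` with values in `(−c,c)`, `C¹` on `[0,∞)`, twice differentiable on `(0,∞)`,
and `u'(0) = 0`. -/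
structure IsSolutionE (c : EReal) (f q u : ℝ → ℝ) : Prop where
  mem : ∀ r : ℝ, 0 ≤ r → InCC c (u r)
  c1 : ContDiffOn ℝ 1 u (Ici (0:ℝ))
  diff2 : ∀ r : ℝ, 0 < r → DifferentiableAt ℝ (deriv u) r
  ode : ∀ r : ℝ, 0 < r →
    deriv (deriv u) r + (deriv q r / q r) * deriv u r + f (u r) = 0
  d0 : deriv u 0 = 0

/-- Condition (f1). -/
def CondF1 (c : EReal) (f : ℝ → ℝ) (b β : ℝ) : Prop :=
  (∀ s : ℝ, f (-s) = - f s) ∧ f 0 = 0 ∧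
  0 < b ∧ b < β ∧ (β : EReal) < c ∧
  (∀ s : ℝ, b < s → (s : EReal) < c → 0 < f s) ∧
  (∀ s : ℝ, s ∈ Icc (0:ℝ) b → f s ≤ 0) ∧
  (∃ s ∈ Icc (0:ℝ) b, f s ≠ 0) ∧
  Fint f β = 0

/-- Condition (f2). -/
def CondF2 (c : EReal) (f : ℝ → ℝ) : Prop :=
  ContDiffOn ℝ 1 f {s : ℝ | 0 < s ∧ (s : EReal) < c} ∧
  IntegrableOn (deriv f) (Ioo (0:ℝ) 1)

/-- Condition (q1). -/
def CondQ1 (q : ℝ → ℝ) : Prop :=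
  ContDiffOn ℝ 1 q (Ioi (0:ℝ)) ∧
  (∀ r : ℝ, 0 < r → 0 < q r ∧ 0 < deriv q r) ∧
  q 0 = 0 ∧ ContinuousWithinAt q (Ici (0:ℝ)) 0

/-- Condition (q2). -/
def CondQ2 (q : ℝ → ℝ) : Prop :=
  StrictAntiOn (fun r => deriv q r / q r) (Ioi (0:ℝ))

/-- `Q(r) = ∫₀ʳ q(s) ds`. -/
def Qint (q : ℝ → ℝ) (r : ℝ) : ℝ := ∫ s in (0:ℝ)..r, q s

/-- `H = (Q/q)'`. -/
def Hfun (q : ℝ → ℝ) (r : ℝ) : ℝ := deriv (fun t => Qint q t / q t) r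

/-- Condition (q3), with `Hinf = H∞`. -/
def CondQ3 (q : ℝ → ℝ) (Hinf : ℝ) : Prop :=
  AntitoneOn (Hfun q) (Ioi (0:ℝ)) ∧
  (∃ H0 : ℝ, Tendsto (Hfun q) (nhdsWithin 0 (Ioi 0)) (nhds H0) ∧ H0 < 1/2) ∧
  Tendsto (Hfun q) atTop (nhds Hinf) ∧ 0 < Hinf ∧
  MonotoneOn (fun r => q r * (Hfun q r - Hinf)) (Ioi (0:ℝ))

/-- Condition (f3). -/
def CondF3 (c : EReal) (f : ℝ → ℝ) (β Hinf : ℝ) : Prop :=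
  ∀ s : ℝ, β < s → (s : EReal) < c →
    (1 - 2 * Hinf) / 2 ≤ deriv (fun t => Fint f t / f t) s

/-- `h(r) = q(r) ∫_r^∞ ds / q(s)`. -/
def hfun (q : ℝ → ℝ) (r : ℝ) : ℝ := q r * ∫ s in Ioi r, 1 / q s

/-- Condition (q4), with `linf = ℓ∞`. -/
def CondQ4 (q : ℝ → ℝ) (linf : ℝ) : Prop :=
  IntegrableOn (fun r => 1 / q r) (Ioi (1:ℝ)) ∧
  ¬ IntegrableOn (fun r => 1 / q r) (Ioo (0:ℝ) 1) ∧
  (∀ r : ℝ, 0 < r → 0 < deriv (hfun q) r) ∧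
  AntitoneOn (deriv (hfun q)) (Ioi (0:ℝ)) ∧
  Tendsto (deriv (hfun q)) atTop (nhds linf) ∧ 0 < linf

/-- Condition (f4): `s ↦ s f'(s)/f(s)` is decreasing for `s ≥ b`. -/
def CondF4 (c : EReal) (f : ℝ → ℝ) (b : ℝ) : Prop :=
  StrictAntiOn (fun s => s * deriv f s / f s) {s : ℝ | b ≤ s ∧ (s : EReal) < c}

/-- Condition (q5). -/
def CondQ5 (q : ℝ → ℝ) : Prop :=
  StrictMonoOn (fun r => deriv q r * q r) (Ioi (0:ℝ))

/-- Condition (f5). -/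
def CondF5 (c : EReal) (f : ℝ → ℝ) (b : ℝ) : Prop :=
  ∀ s : ℝ, b ≤ s → (s : EReal) < c → deriv f s * (s - b) ≤ f s

/-- Condition (f6). -/
def CondF6 (f : ℝ → ℝ) (β linf : ℝ) : Prop :=
  β * deriv f β / f β ≤ 1 + 2 * linf

/-- `G(r) = (q'/(q h)) ∫₀ʳ h − 1/2`. -/
def Gfun (q : ℝ → ℝ) (r : ℝ) : ℝ :=
  deriv q r / (q r * hfun q r) * (∫ s in (0:ℝ)..r, hfun q s) - 1/2

/-- Condition (q6), with `Gbar = sup_{r>0} G(r)`. -/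
def CondQ6 (q : ℝ → ℝ) (Gbar : ℝ) : Prop :=
  (∀ r : ℝ, 0 < r → 0 ≤ Gfun q r) ∧
  IsLUB (Gfun q '' Ioi (0:ℝ)) Gbar ∧
  MonotoneOn (fun r => Gfun q r * hfun q r / Real.sqrt (∫ s in (0:ℝ)..r, hfun q s))
    (Ioi (0:ℝ))

/-- Condition (q7), with constant `C`. -/
def CondQ7 (q : ℝ → ℝ) (Gbar C : ℝ) : Prop :=
  Gbar ≤ C ∧ C ≤ 1 ∧
  ∃ a : ℝ, a ∈ Ioo (0:ℝ) 1 ∧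
    MonotoneOn (fun r => hfun q r ^ (1 - a) * (C - Gfun q r)) (Ioi (0:ℝ))

/-- Condition (f7). -/
def CondF7 (c : EReal) (f : ℝ → ℝ) (β C : ℝ) : Prop :=
  ∀ s : ℝ, β < s → (s : EReal) < c → C ≤ deriv (fun t => Fint f t / f t) s

/-- `u` has exactly `k` sign changes on `(0,∞)`: there are
`0 = z₀ < z₁ < ⋯ < z_k` such that for `i = 0,…,k` the function `(−1)^i u`
is nonnegative and not identically zero on `[z_i, z_{i+1}]` (with `z_{k+1} = ∞`). -/
def ExactSignChanges (u : ℝ → ℝ) (k : ℕ) : Prop :=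
  ∃ z : ℕ → ℝ, z 0 = 0 ∧ (∀ i, i < k → z i < z (i + 1)) ∧
    ∀ i, i ≤ k →
      (∀ r ∈ (if i < k then Icc (z i) (z (i + 1)) else Ici (z i)),
        0 ≤ (-1 : ℝ) ^ i * u r) ∧
      ∃ r ∈ (if i < k then Icc (z i) (z (i + 1)) else Ici (z i)),
        (-1 : ℝ) ^ i * u r ≠ 0

/-- A first variation `φ` along a solution `u` of (E). -/
structure IsFirstVariation (c : EReal) (f q u φ : ℝ → ℝ) : Prop where
  c1 : ContDiffOn ℝ 1 φ (Ici (0:ℝ))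
  init : φ 0 = 1
  dinit : deriv φ 0 = 0
  diff2 : ∀ r : ℝ, 0 < r → u r ≠ 0 → DifferentiableAt ℝ (deriv φ) r
  ode : ∀ r : ℝ, 0 < r → u r ≠ 0 →
    deriv (deriv φ) r + (deriv q r / q r) * deriv φ r + deriv f (u r) * φ r = 0

/-- The filter of approach to `Z ∈ (0,∞]` from the left. -/
def leftFilter (Z : EReal) : Filter ℝ :=
  if Z = ⊤ then atTop else nhdsWithin Z.toReal (Iio Z.toReal)

/-- `Z₁` for a single solution `w`: the supremum of the radii `r > 0` such that
`w > 0` and `w' < 0 ` on `(0,r)`. -/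
def Z1 (w : ℝ → ℝ) : EReal :=
  sSup {z : EReal | ∃ r : ℝ, z = (r : EReal) ∧ 0 < r ∧
    ∀ s : ℝ, 0 < s → s < r → 0 < w s ∧ deriv w s < 0}

/-- `α ∈ 𝒩₁`: the limits of `u(·,α)` and `u'(·,α)` at `Z₁(α)⁻` exist,
`u(Z₁(α),α) = 0` and `u'(Z₁(α),α) < 0`. -/
def MemN1 (b : ℝ) (fam : ℝ → ℝ → ℝ) (α : ℝ) : Prop :=
  b < α ∧ ∃ L : ℝ, L < 0 ∧
    Tendsto (fam α) (leftFilter (Z1 (fam α))) (nhds 0) ∧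
    Tendsto (deriv (fam α)) (leftFilter (Z1 (fam α))) (nhds L)

/-- `α ∈ 𝒢₁`: `u(Z₁(α),α) = 0` and `u'(Z₁(α),α) = 0`. -/
def MemG1 (b : ℝ) (fam : ℝ → ℝ → ℝ) (α : ℝ) : Prop :=
  b < α ∧
    Tendsto (fam α) (leftFilter (Z1 (fam α))) (nhds 0) ∧
    Tendsto (deriv (fam α)) (leftFilter (Z1 (fam α))) (nhds 0)

/-- `α ∈ 𝒫₁`: `u(Z₁(α),α) > 0`. -/
def MemP1 (b : ℝ) (fam : ℝ → ℝ → ℝ) (α : ℝ) : Prop :=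
  b < α ∧ ∃ L : ℝ, 0 < L ∧
    Tendsto (fam α) (leftFilter (Z1 (fam α))) (nhds L)

/-! ### Monotonicity and limits -/

theorem monotoneOn_of_hasDerivAt_nonneg {D : Set ℝ} (hD : Convex ℝ D) {g g' : ℝ → ℝ}
    (h : ∀ x ∈ D, HasDerivAt g (g' x) x) (h0 : ∀ x ∈ D, 0 ≤ g' x) : MonotoneOn g D :=
  monotoneOn_of_deriv_nonneg hD (fun x hx => (h x hx).continuousAt.continuousWithinAt)
    (fun x hx => (h x (interior_subset hx)).differentiableAt.differentiableWithinAt)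
    (fun x hx => by rw [(h x (interior_subset hx)).deriv]; exact h0 x (interior_subset hx))

theorem antitoneOn_of_hasDerivAt_nonpos {D : Set ℝ} (hD : Convex ℝ D) {g g' : ℝ → ℝ}
    (h : ∀ x ∈ D, HasDerivAt g (g' x) x) (h0 : ∀ x ∈ D, g' x ≤ 0) : AntitoneOn g D :=
  antitoneOn_of_deriv_nonpos hD (fun x hx => (h x hx).continuousAt.continuousWithinAt)
    (fun x hx => (h x (interior_subset hx)).differentiableAt.differentiableWithinAt)
    (fun x hx => by rw [(h x (interior_subset hx)).deriv]; exact h0 x (interior_subset hx))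

theorem strictMonoOn_of_hasDerivAt_pos {D : Set ℝ} (hD : Convex ℝ D) {g g' : ℝ → ℝ}
    (h : ∀ x ∈ D, HasDerivAt g (g' x) x) (h0 : ∀ x ∈ D, 0 < g' x) : StrictMonoOn g D :=
  strictMonoOn_of_deriv_pos hD (fun x hx => (h x hx).continuousAt.continuousWithinAt)
    (fun x hx => by rw [(h x (interior_subset hx)).deriv]; exact h0 x (interior_subset hx))

theorem strictAntiOn_of_hasDerivAt_neg {D : Set ℝ} (hD : Convex ℝ D) {g g' : ℝ → ℝ}
    (h : ∀ x ∈ D, HasDerivAt g (g' x) x) (h0 : ∀ x ∈ D, g' x < 0) : StrictAntiOn g D :=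
  strictAntiOn_of_deriv_neg hD (fun x hx => (h x hx).continuousAt.continuousWithinAt)
    (fun x hx => by rw [(h x (interior_subset hx)).deriv]; exact h0 x (interior_subset hx))

theorem MonotoneOn.le_of_tendsto_left {a b x L : ℝ} {g : ℝ → ℝ} (hg : MonotoneOn g (Ico a b))
    (hx : x ∈ Ico a b) (hL : Tendsto g (𝓝[<] b) (𝓝 L)) : g x ≤ L := by
  refine ge_of_tendsto hL ?_
  filter_upwards [Ioo_mem_nhdsLT hx.2] with t ht
  exact hg hx ⟨hx.1.trans ht.1.le, ht.2⟩ ht.1.le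

theorem MonotoneOn.ge_of_tendsto_right {a b x L : ℝ} {g : ℝ → ℝ} (hg : MonotoneOn g (Ioc a b))
    (hx : x ∈ Ioc a b) (hL : Tendsto g (𝓝[>] a) (𝓝 L)) : L ≤ g x := by
  refine le_of_tendsto hL ?_
  filter_upwards [Ioo_mem_nhdsGT hx.1] with t ht
  exact hg ⟨ht.1, ht.2.le.trans hx.2⟩ hx ht.2.le

theorem AntitoneOn.ge_of_tendsto_left {a b x L : ℝ} {g : ℝ → ℝ} (hg : AntitoneOn g (Ico a b))
    (hx : x ∈ Ico a b) (hL : Tendsto g (𝓝[<] b) (𝓝 L)) : L ≤ g x := by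
  refine le_of_tendsto hL ?_
  filter_upwards [Ioo_mem_nhdsLT hx.2] with t ht
  exact hg hx ⟨hx.1.trans ht.1.le, ht.2⟩ ht.1.le

theorem AntitoneOn.le_of_tendsto_right {a b x L : ℝ} {g : ℝ → ℝ} (hg : AntitoneOn g (Ioc a b))
    (hx : x ∈ Ioc a b) (hL : Tendsto g (𝓝[>] a) (𝓝 L)) : g x ≤ L := by
  refine ge_of_tendsto hL ?_
  filter_upwards [Ioo_mem_nhdsGT hx.1] with t ht
  exact hg ⟨ht.1, ht.2.le.trans hx.2⟩ hx ht.2.le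

/-- The last point at which a function positive near `a` is nonpositive. -/
theorem exists_last_nonpos {g : ℝ → ℝ} {s a : ℝ} (hs : s < a) (hc : ContinuousOn g (Ico s a))
    (hnear : ∀ᶠ t in 𝓝[<] a, 0 < g t) (h : g s ≤ 0) :
    ∃ x ∈ Ico s a, g x = 0 ∧ ∀ t ∈ Ioo x a, 0 < g t := by
  obtain ⟨x0, hx0, hx0'⟩ := (mem_nhdsLT_iff_exists_Ioo_subset' (a := a) hs).1 hnear
  have hx0a : x0 < a := hx0
  set y := max s x0 with hy
  have hya : y < a := max_lt hs hx0a
  set K := Icc s y ∩ g ⁻¹' Iic 0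
  have hcy : ContinuousOn g (Icc s y) := hc.mono fun t ht => ⟨ht.1, ht.2.trans_lt hya⟩
  have hK : IsCompact K :=
    isCompact_Icc.of_isClosed_subset (hcy.preimage_isClosed_of_isClosed isClosed_Icc isClosed_Iic)
      inter_subset_left
  obtain ⟨x, hxK, hx⟩ := hK.exists_isGreatest ⟨s, ⟨le_rfl, le_max_left _ _⟩, h⟩
  have hxI : x ∈ Ico s a := ⟨hxK.1.1, hxK.1.2.trans_lt hya⟩
  have hpos : ∀ t ∈ Ioo x a, 0 < g t := by
    intro t ht
    by_cases hty : t ≤ y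
    · by_contra hcon
      exact absurd (hx ⟨⟨hxK.1.1.trans ht.1.le, hty⟩, not_lt.1 hcon⟩) (not_le.2 ht.1)
    · exact hx0' ⟨(le_max_right _ _).trans_lt (not_le.1 hty), ht.2⟩
  refine ⟨x, hxI, le_antisymm hxK.2 ?_, hpos⟩
  have hcx : Tendsto g (𝓝[>] x) (𝓝 (g x)) :=
    ((hc x hxI).mono (fun t ht => ⟨hxI.1.trans ht.1.le, ht.2⟩ :
      Ioo x a ⊆ Ico s a)).tendsto.mono_left (nhdsWithin_Ioo_eq_nhdsGT hxI.2).ge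
  refine ge_of_tendsto hcx ?_
  filter_upwards [Ioo_mem_nhdsGT hxI.2] with t ht using (hpos t ht).le

theorem pos_of_backward_propagation {g : ℝ → ℝ} {s a : ℝ} (hc : ContinuousOn g (Ico s a))
    (hnear : ∀ᶠ t in 𝓝[<] a, 0 < g t)
    (hprop : ∀ x ∈ Ico s a, (∀ t ∈ Ioo x a, 0 < g t) → g x ≠ 0) : ∀ t ∈ Ico s a, 0 < g t := by
  intro t ht
  by_contra hcon
  obtain ⟨x, hx, hx0, hxp⟩ := exists_last_nonpos ht.2
    (hc.mono fun y hy => ⟨ht.1.trans hy.1, hy.2⟩) hnear (not_lt.1 hcon)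
  exact hprop x ⟨ht.1.trans hx.1, hx.2⟩ hxp hx0

theorem pos_of_forward_propagation {g : ℝ → ℝ} {s a : ℝ} (hc : ContinuousOn g (Ioc a s))
    (hnear : ∀ᶠ t in 𝓝[>] a, 0 < g t)
    (hprop : ∀ x ∈ Ioc a s, (∀ t ∈ Ioo a x, 0 < g t) → g x ≠ 0) : ∀ t ∈ Ioc a s, 0 < g t := by
  have key := pos_of_backward_propagation (g := fun t => g (-t)) (s := -s) (a := -a)
    (hc.comp continuous_neg.continuousOn fun t ht => ⟨by linarith [ht.2], by linarith [ht.1]⟩)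
    ?_ ?_
  · intro t ht
    simpa using key (-t) ⟨by linarith [ht.2], by linarith [ht.1]⟩
  · have : Tendsto (fun t : ℝ => -t) (𝓝[<] (-a)) (𝓝[>] a) := by
      simpa using tendsto_neg_nhdsLT (a := -a)
    exact this.eventually hnear
  · intro x hx hpos
    refine hprop (-x) ⟨by linarith [hx.2], by linarith [hx.1]⟩ fun t ht => ?_
    simpa using hpos (-t) ⟨by linarith [ht.2], by linarith [ht.1]⟩

/-! ### The weight -/

/-- The consequences of (q1), (q2), (q3) used below. -/
structure IsWeight (q : ℝ → ℝ) (Hinf : ℝ) : Prop where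
  pos : ∀ r, 0 < r → 0 < q r
  dpos : ∀ r, 0 < r → 0 < deriv q r
  hd : ∀ r, 0 < r → HasDerivAt q (deriv q r) r
  anti : StrictAntiOn (fun r => deriv q r / q r) (Ioi 0)
  lim0 : Tendsto q (𝓝[>] 0) (𝓝 0)
  Qpos : ∀ r, 0 < r → 0 < Qint q r
  Qle : ∀ r, 0 < r → Qint q r ≤ q r * r
  Qd : ∀ r, 0 < r → HasDerivAt (Qint q) (q r) r
  Hd : ∀ r, 0 < r → HasDerivAt (fun t => Qint q t / q t) (Hfun q r) r
  Heq : ∀ r, 0 < r → Hfun q r = 1 - Qint q r * deriv q r / q r ^ 2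
  Hanti : AntitoneOn (Hfun q) (Ioi 0)
  Hinf_pos : 0 < Hinf
  Hinf_le : ∀ r, 0 < r → Hinf ≤ Hfun q r
  Hlt : ∃ H0 < 1 / 2, ∀ r, 0 < r → Hfun q r ≤ H0
  Hmono : MonotoneOn (fun r => q r * (Hfun q r - Hinf)) (Ioi 0)

theorem isWeight_of_cond {q : ℝ → ℝ} {Hinf : ℝ} (h1 : CondQ1 q) (h2 : CondQ2 q)
    (h3 : CondQ3 q Hinf) : IsWeight q Hinf := by
  obtain ⟨hC, hpos, hq0, hcont⟩ := h1
  obtain ⟨hHa, ⟨H0, hH0, hH0'⟩, hHt, hHp, hHm⟩ := h3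
  have hd : ∀ r, 0 < r → HasDerivAt q (deriv q r) r := fun r hr =>
    ((hC.differentiableOn (by norm_num)).differentiableAt (Ioi_mem_nhds hr)).hasDerivAt
  have hmono : MonotoneOn q (Ici 0) := by
    have hm : MonotoneOn q (Ioi 0) := monotoneOn_of_hasDerivAt_nonneg (convex_Ioi 0)
      (fun x hx => hd x hx) (fun x hx => (hpos x hx).2.le)
    intro x hx y hy hxy
    rcases (mem_Ici.1 hx).eq_or_lt with rfl | hx'
    · rcases (mem_Ici.1 hy).eq_or_lt with rfl | hy'
      · exact le_rfl
      · rw [hq0]; exact (hpos y hy').1.le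
    · exact hm hx' (hx'.trans_le hxy) hxy
  have hint : ∀ r, 0 < r → IntervalIntegrable q volume 0 r := fun r hr =>
    (hmono.mono (by rw [uIcc_of_le hr.le]; exact Icc_subset_Ici_self)).intervalIntegrable
  have hQd : ∀ r, 0 < r → HasDerivAt (Qint q) (q r) r := by
    intro r hr
    refine intervalIntegral.integral_hasDerivAt_right (hint r hr) ?_ (hd r hr).continuousAt
    exact hC.continuousOn.stronglyMeasurableAtFilter isOpen_Ioi r hr
  have hQpos : ∀ r, 0 < r → 0 < Qint q r := fun r hr =>
    intervalIntegral.intervalIntegral_pos_of_pos_on (hint r hr) (fun x hx => (hpos x hx.1).1) hr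
  have hQle : ∀ r, 0 < r → Qint q r ≤ q r * r := by
    intro r hr
    have : ∫ s in (0:ℝ)..r, q s ≤ ∫ _ in (0:ℝ)..r, q r :=
      intervalIntegral.integral_mono_on hr.le (hint r hr) (by simp)
        (fun x hx => hmono hx.1 hr.le hx.2)
    simp only [intervalIntegral.integral_const, smul_eq_mul, sub_zero] at this
    unfold Qint; linarith
  have hHd : ∀ r, 0 < r → HasDerivAt (fun t => Qint q t / q t)
      ((q r * q r - Qint q r * deriv q r) / q r ^ 2) r := fun r hr =>
    (hQd r hr).div (hd r hr) (hpos r hr).1.ne'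
  have hHeq : ∀ r, 0 < r → Hfun q r = (q r * q r - Qint q r * deriv q r) / q r ^ 2 :=
    fun r hr => (hHd r hr).deriv
  refine ⟨fun r hr => (hpos r hr).1, fun r hr => (hpos r hr).2, hd, h2, ?_, hQpos, hQle, hQd,
    fun r hr => by rw [hHeq r hr]; exact hHd r hr, ?_, hHa, hHp, ?_, ⟨H0, hH0', ?_⟩, hHm⟩
  · have := hcont.tendsto
    rw [hq0] at this
    exact this.mono_left (nhdsWithin_mono _ Ioi_subset_Ici_self)
  · intro r hr
    have := (hpos r hr).1
    rw [hHeq r hr]; field_simp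
  · intro r hr
    refine le_of_tendsto hHt ?_
    filter_upwards [eventually_ge_atTop r] with t ht
    exact hHa hr (hr.trans_le ht) ht
  · intro r hr
    refine ge_of_tendsto hH0 ?_
    filter_upwards [Ioo_mem_nhdsGT hr] with t ht
    exact hHa ht.1 hr ht.2.le

namespace IsWeight
variable {q : ℝ → ℝ} {Hinf : ℝ}

theorem strictMono (h : IsWeight q Hinf) : StrictMonoOn q (Ioi 0) :=
  strictMonoOn_of_hasDerivAt_pos (convex_Ioi 0) (fun r hr => h.hd r hr) (fun r hr => h.dpos r hr)

theorem H_pos (h : IsWeight q Hinf) {r : ℝ} (hr : 0 < r) : 0 < Hfun q r :=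
  h.Hinf_pos.trans_le (h.Hinf_le r hr)

theorem H_lt_half (h : IsWeight q Hinf) {r : ℝ} (hr : 0 < r) : Hfun q r < 1 / 2 := by
  obtain ⟨H0, hH0, hle⟩ := h.Hlt
  exact (hle r hr).trans_lt hH0

theorem Q_div_strictMono (h : IsWeight q Hinf) :
    StrictMonoOn (fun t => Qint q t / q t) (Ioi 0) :=
  strictMonoOn_of_hasDerivAt_pos (convex_Ioi 0) (fun r hr => h.Hd r hr) (fun _ hr => h.H_pos hr)

theorem hasDerivAt_Q_div_sq (h : IsWeight q Hinf) {r : ℝ} (hr : 0 < r) :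
    HasDerivAt (fun t => Qint q t / q t ^ 2) ((2 * Hfun q r - 1) / q r) r := by
  have hq := h.pos r hr
  have hd := (h.Qd r hr).fun_div ((h.hd r hr).fun_pow 2) (pow_pos hq 2).ne'
  refine hd.congr_deriv ?_
  rw [h.Heq r hr]
  simp only [Nat.cast_ofNat, Nat.add_one_sub_one, pow_one]
  field_simp
  ring

theorem Q_div_sq_antitone (h : IsWeight q Hinf) :
    AntitoneOn (fun t => Qint q t / q t ^ 2) (Ioi 0) :=
  antitoneOn_of_hasDerivAt_nonpos (convex_Ioi 0) (fun r hr => h.hasDerivAt_Q_div_sq hr)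
    (fun r hr => div_nonpos_of_nonpos_of_nonneg (by linarith [h.H_lt_half hr]) (h.pos r hr).le)

theorem exists_Q_div_sq_lt (h : IsWeight q Hinf) {η : ℝ} (hη : 0 < η) :
    ∃ R, 0 < R ∧ ∀ r, R ≤ r → Qint q r / q r ^ 2 < η := by
  suffices hR : ∃ R, 0 < R ∧ Qint q R / q R ^ 2 < η by
    obtain ⟨R, hR0, hR⟩ := hR
    exact ⟨R, hR0, fun r hr => (h.Q_div_sq_antitone hR0 (hR0.trans_le hr) hr).trans_lt hR⟩
  by_contra! hcon
  obtain ⟨H0, hH0, hle⟩ := h.Hlt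
  set k := (1 - 2 * H0) * η with hk
  have hkp : 0 < k := mul_pos (by linarith) hη
  have hanti : AntitoneOn (fun t => Qint q t / q t ^ 2 + k * Real.log t) (Ioi 0) := by
    refine antitoneOn_of_hasDerivAt_nonpos (convex_Ioi 0) (fun r hr =>
      (h.hasDerivAt_Q_div_sq hr).add ((Real.hasDerivAt_log (ne_of_gt hr)).const_mul k)) ?_
    intro r hr
    have hr' : (0:ℝ) < r := hr
    have hq := h.pos r hr
    have h1 : η * q r ^ 2 ≤ q r * r := by
      have := hcon r hr
      rw [le_div_iff₀ (by positivity)] at this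
      exact this.trans (h.Qle r hr)
    have h2 : η * q r ≤ r := by nlinarith
    have h3 : (2 * Hfun q r - 1) / q r ≤ -(1 - 2 * H0) / q r := by
      gcongr; linarith [hle r hr]
    have h4 : k * r⁻¹ ≤ (1 - 2 * H0) / q r := by
      rw [← div_eq_mul_inv, div_le_div_iff₀ hr' hq, hk, mul_assoc]
      exact mul_le_mul_of_nonneg_left h2 (by linarith)
    rw [neg_div] at h3
    linarith
  set A := Qint q 1 / q 1 ^ 2 with hA
  have hAp : 0 < A := div_pos (h.Qpos 1 one_pos) (pow_pos (h.pos 1 one_pos) 2)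
  have hx : (1:ℝ) ≤ Real.exp (A / k) := Real.one_le_exp (by positivity)
  have := hanti (mem_Ioi.2 one_pos) (mem_Ioi.2 (Real.exp_pos (A / k))) hx
  simp only [Real.log_exp, Real.log_one, mul_zero, add_zero] at this
  have h5 := hcon _ (Real.exp_pos (A / k))
  rw [mul_div_cancel₀ _ hkp.ne', ← hA] at this
  linarith

theorem tendsto_Qint (hq : IsWeight q Hinf) : Tendsto (Qint q) (𝓝[>] 0) (𝓝 0) := by
  have hid : Tendsto (fun r : ℝ => r) (𝓝[>] 0) (𝓝 0) := nhdsWithin_le_nhds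
  refine squeeze_zero' ?_ ?_ (by simpa using hq.lim0.mul hid)
  · filter_upwards [self_mem_nhdsWithin] with r hr using (hq.Qpos r hr).le
  · filter_upwards [self_mem_nhdsWithin] with r hr using hq.Qle r hr

end IsWeight

/-! ### The nonlinearity -/

/-- The consequences of (f1), (f2) and (f3) with `c = ∞` used below. -/
structure IsNonlinearity (f : ℝ → ℝ) (b β Hinf : ℝ) : Prop where
  b_pos : 0 < b
  b_lt : b < β
  pos : ∀ s, b < s → 0 < f s
  nonpos : ∀ s, 0 < s → s ≤ b → f s ≤ 0
  hd : ∀ s, 0 < s → HasDerivAt f (deriv f s) s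
  dcont : ContinuousOn (deriv f) (Ioi 0)
  bdd : ∃ C, 0 < C ∧ ∀ s, 0 < s → s ≤ b → -C ≤ f s
  Fd : ∀ s, 0 < s → HasDerivAt (Fint f) (f s) s
  F0 : Tendsto (Fint f) (𝓝[>] 0) (𝓝 0)
  Fβ : Fint f β = 0
  F3 : ∀ s, β < s → (1 - 2 * Hinf) / 2 ≤ deriv (fun t => Fint f t / f t) s

theorem isNonlinearity_of_cond {f : ℝ → ℝ} {b β Hinf : ℝ} (h1 : CondF1 ⊤ f b β)
    (h2 : CondF2 ⊤ f) (h3 : CondF3 ⊤ f β Hinf) : IsNonlinearity f b β Hinf := by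
  obtain ⟨-, -, hb, hbβ, -, hpos, hneg, -, hFβ⟩ := h1
  obtain ⟨hC, hint⟩ := h2
  have hset : {s : ℝ | 0 < s ∧ (s : EReal) < ⊤} = Ioi 0 := by
    ext s; simp [EReal.coe_lt_top]
  rw [hset] at hC
  have hd : ∀ s, 0 < s → HasDerivAt f (deriv f s) s := fun r hr =>
    ((hC.differentiableOn (by norm_num)).differentiableAt (Ioi_mem_nhds hr)).hasDerivAt
  have hdc : ContinuousOn (deriv f) (Ioi 0) :=
    hC.continuousOn_deriv_of_isOpen isOpen_Ioi (by norm_num)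
  have hbdd : ∀ s₀, 0 < s₀ → ∃ C, 0 < C ∧ ∀ s ∈ Ioc 0 s₀, |f s| ≤ C := by
    intro s₀ hs₀
    have hcomp : ContinuousOn f (Icc (1 / 2) (max s₀ 1)) :=
      hC.continuousOn.mono fun t ht => lt_of_lt_of_le (by norm_num) ht.1
    obtain ⟨C1, hC1⟩ := isCompact_Icc.exists_bound_of_continuousOn hcomp
    set C2 := ∫ t in Ioo (0:ℝ) 1, |deriv f t|
    have hC2 : 0 ≤ C2 := integral_nonneg fun _ => abs_nonneg _
    have hC1' : 0 ≤ C1 := (norm_nonneg _).trans (hC1 (1 / 2) ⟨le_rfl, le_max_of_le_right (by norm_num)⟩)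
    refine ⟨C1 + C2 + 1, by linarith, fun s hs => ?_⟩
    by_cases hs2 : 1 / 2 ≤ s
    · have := hC1 s ⟨hs2, hs.2.trans (le_max_left _ _)⟩
      rw [Real.norm_eq_abs] at this
      linarith
    · push Not at hs2
      have hsub : Ioc s (1 / 2) ⊆ Ioo (0:ℝ) 1 := fun t ht => ⟨hs.1.trans ht.1, by linarith [ht.2]⟩
      have hii : IntervalIntegrable (deriv f) volume s (1 / 2) := by
        rw [intervalIntegrable_iff_integrableOn_Ioc_of_le hs2.le]
        exact hint.mono_set hsub
      have heq := intervalIntegral.integral_eq_sub_of_hasDerivAt (f := f) (f' := deriv f)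
        (a := s) (b := 1 / 2) (fun x hx => hd x (by
          rw [uIcc_of_le hs2.le] at hx; exact hs.1.trans_le hx.1)) hii
      have hle : |∫ t in s..(1 / 2), deriv f t| ≤ C2 := by
        rw [intervalIntegral.integral_of_le hs2.le]
        refine (abs_integral_le_integral_abs).trans ?_
        exact setIntegral_mono_set hint.abs (ae_of_all _ fun _ => abs_nonneg _)
          (LE.le.eventuallyLE hsub)
      have h12 := hC1 (1 / 2) ⟨le_rfl, le_max_of_le_right (by norm_num)⟩
      rw [Real.norm_eq_abs] at h12
      rw [heq] at hle
      rw [abs_le] at *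
      constructor <;> linarith [hle.1, hle.2, h12.1, h12.2]
  have hii : ∀ s, 0 < s → IntervalIntegrable f volume 0 s := by
    intro s hs
    obtain ⟨C, -, hC'⟩ := hbdd s hs
    rw [intervalIntegrable_iff_integrableOn_Ioc_of_le hs.le]
    refine Integrable.of_bound (C := C) ?_ ?_
    · exact ((hC.continuousOn.mono fun t ht => ht.1).aestronglyMeasurable measurableSet_Ioc)
    · filter_upwards [ae_restrict_mem measurableSet_Ioc] with t ht using hC' t ht
  refine ⟨hb, hbβ, fun s hs => hpos s hs (EReal.coe_lt_top s), fun s h0 h1 => hneg s ⟨h0.le, h1⟩,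
    hd, hdc, ?_, ?_, ?_, hFβ, fun s hs => h3 s hs (EReal.coe_lt_top s)⟩
  · obtain ⟨C, hC0, hC'⟩ := hbdd b hb
    exact ⟨C, hC0, fun s h0 h1 => (abs_le.1 (hC' s ⟨h0, h1⟩)).1⟩
  · intro s hs
    refine intervalIntegral.integral_hasDerivAt_right (hii s hs) ?_ (hd s hs).continuousAt
    exact hC.continuousOn.stronglyMeasurableAtFilter isOpen_Ioi s hs
  · obtain ⟨C, hC0, hC'⟩ := hbdd 1 one_pos
    have hlim : Tendsto (fun s : ℝ => C * s) (𝓝[>] 0) (𝓝 0) := by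
      have : Tendsto (fun s : ℝ => C * s) (𝓝 0) (𝓝 (C * 0)) := tendsto_id.const_mul C
      rw [mul_zero] at this
      exact this.mono_left nhdsWithin_le_nhds
    refine squeeze_zero_norm' ?_ hlim
    filter_upwards [Ioo_mem_nhdsGT (one_pos (α := ℝ))] with s hs
    have := intervalIntegral.norm_integral_le_of_norm_le_const (a := 0) (b := s) (f := f) (C := C)
      (fun x hx => by
        rw [uIoc_of_le hs.1.le] at hx
        exact hC' x ⟨hx.1, hx.2.trans hs.2.le⟩)
    rwa [sub_zero, abs_of_pos hs.1] at this

namespace IsNonlinearity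
variable {f : ℝ → ℝ} {b β Hinf : ℝ}

theorem β_pos (h : IsNonlinearity f b β Hinf) : 0 < β := h.b_pos.trans h.b_lt

theorem F_strictMono (h : IsNonlinearity f b β Hinf) : StrictMonoOn (Fint f) (Ioi b) :=
  strictMonoOn_of_hasDerivAt_pos (convex_Ioi b) (fun s hs => h.Fd s (h.b_pos.trans hs))
    (fun s hs => h.pos s hs)

theorem F_neg (h : IsNonlinearity f b β Hinf) {s : ℝ} (hs : b < s) (hsβ : s < β) :
    Fint f s < 0 := h.Fβ ▸ h.F_strictMono hs h.b_lt hsβ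

theorem F_nonpos (h : IsNonlinearity f b β Hinf) {s : ℝ} (hs : 0 < s) (hsβ : s ≤ β) :
    Fint f s ≤ 0 := by
  rcases le_or_gt s b with hsb | hsb
  · have : AntitoneOn (Fint f) (Ioc 0 b) := antitoneOn_of_hasDerivAt_nonpos (convex_Ioc 0 b)
      (fun t ht => h.Fd t ht.1) (fun t ht => h.nonpos t ht.1 ht.2)
    exact this.le_of_tendsto_right ⟨hs, hsb⟩ h.F0
  · rcases hsβ.eq_or_lt with rfl | hlt
    · exact h.Fβ.le
    · exact (h.F_neg hsb hlt).le

theorem hasDerivAt_F_div (h : IsNonlinearity f b β Hinf) {s : ℝ} (hs : b < s) :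
    HasDerivAt (fun t => Fint f t / f t) (deriv (fun t => Fint f t / f t) s) s :=
  (((h.Fd s (h.b_pos.trans hs)).div (h.hd s (h.b_pos.trans hs))
    (h.pos s hs).ne').differentiableAt).hasDerivAt

end IsNonlinearity

/-! ### Radial solutions in first order form -/

theorem IsWeight.le_mul_of_damped {q : ℝ → ℝ} {Hinf : ℝ} (hq : IsWeight q Hinf)
    {w h : ℝ → ℝ} {M R : ℝ} (hM : 0 ≤ M)
    (hw : ∀ r ∈ Ioc 0 R, HasDerivAt w (h r - deriv q r / q r * w r) r)
    (hh : ∀ r ∈ Ioc 0 R, h r ≤ M) (h0 : Tendsto (fun r => q r * w r) (𝓝[>] 0) (𝓝 0)) :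
    ∀ r ∈ Ioc 0 R, w r ≤ M * r := by
  have hanti : AntitoneOn (fun r => q r * w r - M * (q r * r)) (Ioc 0 R) := by
    refine antitoneOn_of_hasDerivAt_nonpos (convex_Ioc 0 R) (fun r hr =>
      ((hq.hd r hr.1).mul (hw r hr)).sub
        (((hq.hd r hr.1).mul (hasDerivAt_id r)).const_mul M)) fun r hr => ?_
    have hqr := hq.pos r hr.1
    have hdr := hq.dpos r hr.1
    have h1 : deriv q r * w r + q r * (h r - deriv q r / q r * w r) = q r * h r := by
      field_simp; ring
    rw [h1]
    have h2 := mul_le_mul_of_nonneg_left (hh r hr) hqr.le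
    have h3 : 0 ≤ M * (deriv q r * r) := mul_nonneg hM (mul_pos hdr hr.1).le
    simp only [id_eq]
    nlinarith
  have hid : Tendsto (fun r : ℝ => r) (𝓝[>] 0) (𝓝 0) := nhdsWithin_le_nhds
  have hlim : Tendsto (fun r => q r * w r - M * (q r * r)) (𝓝[>] 0) (𝓝 0) := by
    simpa using h0.sub ((hq.lim0.mul hid).const_mul M)
  intro r hr
  have h1 := hanti.le_of_tendsto_right hr hlim
  have hqr := hq.pos r hr.1
  have h2 : q r * (w r) ≤ q r * (M * r) := by nlinarith
  exact le_of_mul_le_mul_left h2 hqr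

theorem IsWeight.abs_le_mul_of_damped {q : ℝ → ℝ} {Hinf : ℝ} (hq : IsWeight q Hinf)
    {w h : ℝ → ℝ} {M R : ℝ} (hM : 0 ≤ M)
    (hw : ∀ r ∈ Ioc 0 R, HasDerivAt w (h r - deriv q r / q r * w r) r)
    (hh : ∀ r ∈ Ioc 0 R, |h r| ≤ M) (h0 : Tendsto (fun r => q r * w r) (𝓝[>] 0) (𝓝 0)) :
    ∀ r ∈ Ioc 0 R, |w r| ≤ M * r := by
  intro r hr
  refine abs_le'.2 ⟨hq.le_mul_of_damped hM hw (fun r hr => (abs_le'.1 (hh r hr)).1) h0 r hr, ?_⟩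
  refine hq.le_mul_of_damped (w := fun r => -w r) (h := fun r => -h r) hM
    (fun r hr => ((hw r hr).neg).congr_deriv (by ring)) (fun r hr => (abs_le'.1 (hh r hr)).2) ?_ r hr
  simpa using h0.neg

/-- A solution `u` with initial value `α`, together with `v = -u'`. -/
structure IsRadial (f q u v : ℝ → ℝ) (α : ℝ) : Prop where
  hu : ∀ r, 0 < r → HasDerivAt u (-v r) r
  hv : ∀ r, 0 < r → HasDerivAt v (f (u r) - deriv q r / q r * v r) r
  u0 : Tendsto u (𝓝[>] 0) (𝓝 α)
  v0 : Tendsto v (𝓝[>] 0) (𝓝 0)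

theorem IsSolutionE.isRadial {f q u : ℝ → ℝ} {b β Hinf α : ℝ} {c : EReal} (hq : IsWeight q Hinf)
    (hf : IsNonlinearity f b β Hinf) (h : IsSolutionE c f q u) (hα : u 0 = α) (hb : b < α) :
    IsRadial f q u (fun r => -deriv u r) α := by
  have hd : ∀ r, 0 < r → HasDerivAt u (deriv u r) r := fun r hr =>
    ((h.c1.differentiableOn (by norm_num)).differentiableAt (Ici_mem_nhds hr)).hasDerivAt
  have hv : ∀ r, 0 < r → HasDerivAt (fun r => -deriv u r)
      (f (u r) - deriv q r / q r * (-deriv u r)) r := by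
    intro r hr
    refine (h.diff2 r hr).hasDerivAt.neg.congr_deriv ?_
    linarith [h.ode r hr]
  have hu0 : Tendsto u (𝓝[>] 0) (𝓝 α) := by
    have := (h.c1.continuousOn 0 self_mem_Ici).tendsto
    rw [hα] at this
    exact this.mono_left (nhdsWithin_mono _ Ioi_subset_Ici_self)
  refine ⟨fun r hr => by simpa using hd r hr, hv, hu0, ?_⟩
  have hαp : 0 < α := hf.b_pos.trans hb
  obtain ⟨L, hL⟩ : ∃ L, Tendsto (fun r => -deriv u r) (𝓝[>] 0) (𝓝 L) := by
    have hc := (h.c1.continuousOn_derivWithin (uniqueDiffOn_Ici 0) le_rfl) 0 self_mem_Ici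
    refine ⟨-derivWithin u (Ici 0) 0, Tendsto.neg ?_⟩
    refine (hc.tendsto.mono_left (nhdsWithin_mono _ Ioi_subset_Ici_self)).congr' ?_
    filter_upwards [self_mem_nhdsWithin] with r hr
    exact derivWithin_of_mem_nhds (Ici_mem_nhds hr)
  have hfu : Tendsto (fun r => f (u r)) (𝓝[>] 0) (𝓝 (f α)) :=
    (hf.hd α hαp).continuousAt.tendsto.comp hu0
  have hev : ∀ᶠ r in 𝓝[>] 0, |f (u r)| ≤ |f α| + 1 := by
    have : ∀ᶠ r in 𝓝[>] 0, |f (u r)| < |f α| + 1 := hfu.abs.eventually_lt_const (by linarith)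
    exact this.mono fun r hr => hr.le
  obtain ⟨R, hR, hR'⟩ := (mem_nhdsGT_iff_exists_Ioc_subset).1 hev
  have hbd := hq.abs_le_mul_of_damped (M := |f α| + 1) (by positivity) (fun r hr => hv r hr.1)
    (fun r hr => hR' hr) (by simpa using hq.lim0.mul hL)
  refine squeeze_zero_norm' (a := fun r => (|f α| + 1) * r) ?_ ?_
  · filter_upwards [Ioc_mem_nhdsGT hR] with r hr using hbd r hr
  · have : Tendsto (fun r : ℝ => (|f α| + 1) * r) (𝓝 0) (𝓝 ((|f α| + 1) * 0)) :=
      tendsto_id.const_mul _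
    rw [mul_zero] at this
    exact this.mono_left nhdsWithin_le_nhds

/-! ### The first descent -/

theorem eventually_leftFilter {Z : EReal} {r₀ : ℝ} (h : (r₀ : EReal) < Z) :
    ∀ᶠ r in leftFilter Z, r₀ < r ∧ (r : EReal) < Z := by
  unfold leftFilter
  split_ifs with hZ
  · subst hZ
    filter_upwards [eventually_gt_atTop r₀] with r hr using ⟨hr, EReal.coe_lt_top r⟩
  · lift Z to ℝ using ⟨hZ, (bot_le.trans_lt h).ne'⟩
    rw [EReal.toReal_coe]
    filter_upwards [Ioo_mem_nhdsLT (EReal.coe_lt_coe_iff.1 h)] with r hr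
    exact ⟨hr.1, EReal.coe_lt_coe_iff.2 hr.2⟩

theorem tendsto_leftFilter {Z : EReal} (hZ0 : 0 < Z) {ι : Type*} {l : Filter ι} {g : ι → ℝ}
    (h : ∀ r₀ : ℝ, (r₀ : EReal) < Z → ∀ᶠ x in l, r₀ < g x) (h' : ∀ᶠ x in l, (g x : EReal) < Z) :
    Tendsto g l (leftFilter Z) := by
  unfold leftFilter
  split_ifs with hZ
  · subst hZ
    exact tendsto_atTop.2 fun a => (h a (EReal.coe_lt_top a)).mono fun _ hx => hx.le
  · lift Z to ℝ using ⟨hZ, (bot_le.trans_lt hZ0).ne'⟩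
    rw [EReal.toReal_coe]
    simp only [EReal.coe_lt_coe_iff] at h h'
    refine tendsto_nhdsWithin_iff.2 ⟨?_, h'⟩
    refine tendsto_order.2 ⟨fun a ha => h a ha, fun a ha => ?_⟩
    filter_upwards [h'] with x hx using hx.trans ha

instance leftFilter_neBot (Z : EReal) : (leftFilter Z).NeBot := by
  unfold leftFilter
  split_ifs <;> infer_instance

theorem pos_of_lt_Z1 {u : ℝ → ℝ} {r : ℝ} (hr : 0 < r) (h : (r : EReal) < Z1 u) :
    0 < u r ∧ deriv u r < 0 := by
  obtain ⟨z, ⟨t, rfl, -, ht⟩, hrt⟩ := lt_sSup_iff.1 h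
  exact ht r hr (EReal.coe_lt_coe_iff.1 hrt)

theorem le_Z1 {u : ℝ → ℝ} {r : ℝ} (hr : 0 < r)
    (h : ∀ s, 0 < s → s < r → 0 < u s ∧ deriv u s < 0) : (r : EReal) ≤ Z1 u :=
  le_sSup ⟨r, rfl, hr, h⟩

namespace IsRadial
variable {f q u v : ℝ → ℝ} {b β Hinf α : ℝ}

theorem deriv_eq (h : IsRadial f q u v α) {r : ℝ} (hr : 0 < r) : deriv u r = -v r :=
  (h.hu r hr).deriv

theorem pos (h : IsRadial f q u v α) {r : ℝ} (hr : 0 < r) (hZ : (r : EReal) < Z1 u) :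
    0 < u r ∧ 0 < v r := by
  have := pos_of_lt_Z1 hr hZ
  rw [h.deriv_eq hr] at this
  exact ⟨this.1, by linarith [this.2]⟩

theorem le_Z1 (h : IsRadial f q u v α) {r : ℝ} (hr : 0 < r)
    (hp : ∀ s, 0 < s → s < r → 0 < u s ∧ 0 < v s) : (r : EReal) ≤ Z1 u :=
  _root_.le_Z1 hr fun s hs hsr => ⟨(hp s hs hsr).1, by
    rw [h.deriv_eq hs]; linarith [(hp s hs hsr).2]⟩

theorem Z1_pos (hq : IsWeight q Hinf) (hf : IsNonlinearity f b β Hinf) (h : IsRadial f q u v α)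
    (hα : b < α) : 0 < Z1 u := by
  have hαp := hf.b_pos.trans hα
  have hev : ∀ᶠ r in 𝓝[>] 0, b < u r := h.u0.eventually_const_lt hα
  obtain ⟨R, hR, hR'⟩ := (mem_nhdsGT_iff_exists_Ioc_subset).1 hev
  have hR0 : 0 < R := hR
  have hmono : StrictMonoOn (fun r => q r * v r) (Ioc 0 R) := by
    refine strictMonoOn_of_hasDerivAt_pos (convex_Ioc 0 R) (fun r hr =>
      (hq.hd r hr.1).mul (h.hv r hr.1)) fun r hr => ?_
    have hqr := hq.pos r hr.1
    have h1 : deriv q r * v r + q r * (f (u r) - deriv q r / q r * v r) = q r * f (u r) := by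
      field_simp; ring
    rw [h1]
    exact mul_pos hqr (hf.pos _ (hR' hr))
  have hlim : Tendsto (fun r => q r * v r) (𝓝[>] 0) (𝓝 0) := by simpa using hq.lim0.mul h.v0
  have : (R : EReal) ≤ Z1 u := by
    refine h.le_Z1 hR0 fun s hs hsR => ⟨hf.b_pos.trans (hR' ⟨hs, hsR.le⟩), ?_⟩
    have h1 := hmono.monotoneOn.ge_of_tendsto_right (x := s / 2)
      ⟨half_pos hs, by linarith⟩ hlim
    have h2 := hmono (a := s / 2) (b := s) ⟨half_pos hs, by linarith⟩ ⟨hs, hsR.le⟩ (by linarith)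
    exact (pos_iff_pos_of_mul_pos (h1.trans_lt h2)).1 (hq.pos s hs)
  exact lt_of_lt_of_le (by exact_mod_cast hR0) this

theorem not_both_pos_at_Z1 (h : IsRadial f q u v α) {z : ℝ} (hz : 0 < z) (hZ : Z1 u = z) :
    ¬ (0 < u z ∧ 0 < v z) := by
  rintro ⟨h1, h2⟩
  have hev : ∀ᶠ r in 𝓝 z, 0 < u r ∧ 0 < v r :=
    ((h.hu z hz).continuousAt.eventually_const_lt h1).and
      ((h.hv z hz).continuousAt.eventually_const_lt h2)
  obtain ⟨e, he, hball⟩ := Metric.eventually_nhds_iff.1 hev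
  have : ((z + e : ℝ) : EReal) ≤ Z1 u := by
    refine h.le_Z1 (by linarith) fun s hs hse => ?_
    rcases lt_or_ge s z with hsz | hsz
    · exact h.pos hs (by rw [hZ]; exact_mod_cast hsz)
    · refine hball ?_
      rw [Real.dist_eq, abs_of_nonneg (by linarith)]; linarith
  rw [hZ, EReal.coe_le_coe_iff] at this
  linarith

theorem lt_Z1 (h : IsRadial f q u v α) {r : ℝ} (hr : 0 < r)
    (hp : ∀ s, 0 < s → s ≤ r → 0 < u s ∧ 0 < v s) : (r : EReal) < Z1 u := by
  refine lt_of_le_of_ne (h.le_Z1 hr fun s hs hsr => hp s hs hsr.le) fun heq => ?_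
  exact h.not_both_pos_at_Z1 hr heq.symm (hp r hr le_rfl)

end IsRadial

/-- The radius `ρ` and the slope `p` of a decreasing solution as functions of its value. -/
structure IsProfile (f q : ℝ → ℝ) (σ α : ℝ) (ρ p : ℝ → ℝ) : Prop where
  nonneg : 0 ≤ σ
  lt : σ < α
  rpos : ∀ s ∈ Ioo σ α, 0 < ρ s
  ppos : ∀ s ∈ Ioo σ α, 0 < p s
  hr : ∀ s ∈ Ioo σ α, HasDerivAt ρ (-1 / p s) s
  hp : ∀ s ∈ Ioo σ α, HasDerivAt p (deriv q (ρ s) / q (ρ s) - f s / p s) s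
  r0 : Tendsto ρ (𝓝[<] α) (𝓝[>] 0)
  p0 : Tendsto p (𝓝[<] α) (𝓝 0)

/-- `ρ` inverts `u` on its first interval of decrease, on which `u` falls from `α` to `σ`. -/
structure IsDescent (u : ℝ → ℝ) (σ α : ℝ) (ρ : ℝ → ℝ) : Prop where
  tend : Tendsto u (leftFilter (Z1 u)) (𝓝[>] σ)
  left : ∀ r : ℝ, 0 < r → (r : EReal) < Z1 u → u r ∈ Ioo σ α ∧ ρ (u r) = r
  right : ∀ s ∈ Ioo σ α, 0 < ρ s ∧ (ρ s : EReal) < Z1 u ∧ u (ρ s) = s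
  rtend : Tendsto ρ (𝓝[>] σ) (leftFilter (Z1 u))

theorem IsRadial.exists_profile {f q u v : ℝ → ℝ} {b β Hinf α : ℝ} (hq : IsWeight q Hinf)
    (hf : IsNonlinearity f b β Hinf) (h : IsRadial f q u v α) (hα : b < α) :
    ∃ σ ρ, IsDescent u σ α ρ ∧ IsProfile f q σ α ρ (fun s => v (ρ s)) := by
  have hZ0 := h.Z1_pos hq hf hα
  set J : Set ℝ := {r | 0 < r ∧ (r : EReal) < Z1 u} with hJ
  have hJdown : ∀ {r t}, t ∈ J → 0 < r → r ≤ t → r ∈ J := fun ht hr hrt =>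
    ⟨hr, lt_of_le_of_lt (by exact_mod_cast hrt) ht.2⟩
  have hJconv : Convex ℝ J := by
    refine OrdConnected.convex ⟨fun x hx y hy z hz => ?_⟩
    exact hJdown hy (hx.1.trans_le hz.1) hz.2
  have hJex : ∃ r, r ∈ J := by
    obtain ⟨r, h1, h2⟩ := EReal.lt_iff_exists_real_btwn.1 hZ0
    exact ⟨r, by exact_mod_cast h1, h2⟩
  have hJup : ∀ r ∈ J, ∃ t ∈ J, r < t := by
    intro r hr
    obtain ⟨t, h1, h2⟩ := EReal.lt_iff_exists_real_btwn.1 hr.2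
    have : r < t := by exact_mod_cast h1
    exact ⟨t, ⟨hr.1.trans this, h2⟩, this⟩
  have hanti : StrictAntiOn u J := strictAntiOn_of_hasDerivAt_neg hJconv (fun r hr => h.hu r hr.1)
    (fun r hr => by linarith [(h.pos hr.1 hr.2).2])
  have hbdd : BddBelow (u '' J) := ⟨0, by
    rintro _ ⟨r, hr, rfl⟩; exact (h.pos hr.1 hr.2).1.le⟩
  have hne : (u '' J).Nonempty := by
    obtain ⟨r, hr⟩ := hJex
    exact ⟨u r, mem_image_of_mem u hr⟩
  set σ := sInf (u '' J) with hσ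
  have hσ0 : 0 ≤ σ := le_csInf hne (by rintro _ ⟨r, hr, rfl⟩; exact (h.pos hr.1 hr.2).1.le)
  have hmem : ∀ r ∈ J, u r ∈ Ioo σ α := by
    intro r hr
    constructor
    · obtain ⟨t, ht, hrt⟩ := hJup r hr
      exact (csInf_le hbdd (mem_image_of_mem u ht)).trans_lt (hanti hr ht hrt)
    · have h1 := (hanti.antitoneOn.mono
        (fun t ht => hJdown hr ht.1 ht.2 : Ioc 0 r ⊆ J)).le_of_tendsto_right (x := r / 2) ⟨half_pos hr.1, by linarith [hr.1]⟩ h.u0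
      exact (hanti (hJdown hr (half_pos hr.1) (by linarith [hr.1])) hr
        (by linarith [hr.1])).trans_le h1
  have hlow : ∀ s, σ < s → ∃ r ∈ J, u r < s := by
    intro s hs
    obtain ⟨_, ⟨r, hr, rfl⟩, hlt⟩ := exists_lt_of_csInf_lt hne hs
    exact ⟨r, hr, hlt⟩
  have hsurj : ∀ s ∈ Ioo σ α, ∃ r ∈ J, u r = s := by
    intro s hs
    obtain ⟨r, hr, hrs⟩ := hlow s hs.1
    have hev : ∀ᶠ t in 𝓝[>] 0, s < u t := h.u0.eventually_const_lt hs.2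
    obtain ⟨t, ht, ht'⟩ := (hev.and (Ioo_mem_nhdsGT hr.1)).exists
    have hIcc : ∀ x ∈ Icc t r, x ∈ J := fun x hx => hJdown hr (ht'.1.trans_le hx.1) hx.2
    obtain ⟨x, hx, hxs⟩ := intermediate_value_Icc' ht'.2.le
      (fun x hx => (h.hu x (hIcc x hx).1).continuousAt.continuousWithinAt) ⟨hrs.le, ht.le⟩
    exact ⟨x, hIcc x hx, hxs⟩
  have hlt : σ < α := by
    obtain ⟨r, hr⟩ := hJex
    exact (hmem r hr).1.trans (hmem r hr).2
  set ρ := Function.invFunOn u J with hρ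
  have hright : ∀ s ∈ Ioo σ α, ρ s ∈ J ∧ u (ρ s) = s := fun s hs =>
    Function.invFunOn_pos (hsurj s hs)
  have hleft : ∀ r ∈ J, ρ (u r) = r := fun r hr =>
    hanti.injOn (hright _ (hmem r hr)).1 hr (hright _ (hmem r hr)).2
  have hρlt : ∀ s ∈ Ioo σ α, ∀ r ∈ J, u r < s → ρ s < r := by
    intro s hs r hr hlt
    rw [← (hright s hs).2] at hlt
    exact (hanti.lt_iff_gt hr (hright s hs).1).1 hlt
  have hρgt : ∀ s ∈ Ioo σ α, ∀ r ∈ J, s < u r → r < ρ s := by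
    intro s hs r hr hlt
    rw [← (hright s hs).2] at hlt
    exact (hanti.lt_iff_gt (hright s hs).1 hr).1 hlt
  have hρanti : StrictAntiOn ρ (Ioo σ α) := by
    intro s hs t ht hst
    refine hρlt t ht _ (hright s hs).1 ?_
    rwa [(hright s hs).2]
  have hJnhds : ∀ r ∈ J, J ∈ 𝓝 r := by
    intro r hr
    obtain ⟨t, ht, hrt⟩ := hJup r hr
    exact mem_of_superset (Ioo_mem_nhds hr.1 hrt) fun x hx => hJdown ht hx.1 hx.2.le
  have hcont : ∀ s ∈ Ioo σ α, ContinuousAt ρ s := by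
    intro s hs
    refine continuousAt_of_monotoneOn_of_image_mem_nhds (β := ℝᵒᵈ) (s := Ioo σ α)
      hρanti.antitoneOn (Ioo_mem_nhds hs.1 hs.2) ?_
    refine mem_of_superset (hJnhds _ (hright s hs).1) ?_
    intro r hr
    exact ⟨u r, hmem r hr, hleft r hr⟩
  have hvpos : ∀ s ∈ Ioo σ α, 0 < v (ρ s) := fun s hs =>
    (h.pos (hright s hs).1.1 (hright s hs).1.2).2
  have hder : ∀ s ∈ Ioo σ α, HasDerivAt ρ (-1 / v (ρ s)) s := by
    intro s hs
    have := HasDerivAt.of_local_left_inverse (hcont s hs) (h.hu _ (hright s hs).1.1)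
      (by linarith [hvpos s hs] : -v (ρ s) < 0).ne
      (by filter_upwards [Ioo_mem_nhds hs.1 hs.2] with t ht using (hright t ht).2)
    refine this.congr_deriv ?_
    rw [inv_neg, neg_div, one_div]
  have hr0 : Tendsto ρ (𝓝[<] α) (𝓝[>] 0) := by
    refine tendsto_nhdsWithin_iff.2 ⟨tendsto_order.2 ⟨fun a ha => ?_, fun a ha => ?_⟩, ?_⟩
    · filter_upwards [Ioo_mem_nhdsLT hlt] with s hs using ha.trans (hright s hs).1.1
    · obtain ⟨r, hr⟩ := hJex
      have hm : min a r ∈ J := hJdown hr (lt_min ha hr.1) (min_le_right _ _)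
      filter_upwards [Ioo_mem_nhdsLT (hmem _ hm).2] with s hs
      exact (hρlt s ⟨(hmem _ hm).1.trans hs.1, hs.2⟩ _ hm hs.1).trans_le (min_le_left _ _)
    · filter_upwards [Ioo_mem_nhdsLT hlt] with s hs using (hright s hs).1.1
  refine ⟨σ, ρ, ⟨?_, fun r hr hrZ => ⟨hmem r ⟨hr, hrZ⟩, hleft r ⟨hr, hrZ⟩⟩,
    fun s hs => ⟨(hright s hs).1.1, (hright s hs).1.2, (hright s hs).2⟩, ?_⟩,
    hσ0, hlt, fun s hs => (hright s hs).1.1, hvpos, hder, ?_, hr0, h.v0.comp hr0⟩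
  · obtain ⟨r₁, hr₁⟩ := hJex
    refine tendsto_nhdsWithin_iff.2 ⟨tendsto_order.2 ⟨fun a ha => ?_, fun a ha => ?_⟩, ?_⟩
    · filter_upwards [eventually_leftFilter hr₁.2] with r hr
      exact ha.trans (hmem r ⟨hr₁.1.trans hr.1, hr.2⟩).1
    · obtain ⟨r, hr, hra⟩ := hlow a ha
      filter_upwards [eventually_leftFilter hr.2] with t ht
      exact (hanti hr ⟨hr.1.trans ht.1, ht.2⟩ ht.1).trans hra
    · filter_upwards [eventually_leftFilter hr₁.2] with r hr
      exact (hmem r ⟨hr₁.1.trans hr.1, hr.2⟩).1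
  · refine tendsto_leftFilter hZ0 (fun r₀ hr₀ => ?_) ?_
    · rcases le_or_gt r₀ 0 with hneg | hp
      · filter_upwards [Ioo_mem_nhdsGT hlt] with s hs using hneg.trans_lt (hright s hs).1.1
      · have hm := hmem r₀ ⟨hp, hr₀⟩
        filter_upwards [Ioo_mem_nhdsGT hm.1] with s hs
        exact hρgt s ⟨hs.1, hs.2.trans hm.2⟩ r₀ ⟨hp, hr₀⟩ hs.2
    · filter_upwards [Ioo_mem_nhdsGT hlt] with s hs using (hright s hs).1.2
  · intro s hs
    have hvp := hvpos s hs
    have := (h.hv _ (hright s hs).1.1).comp s (hder s hs)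
    refine this.congr_deriv ?_
    rw [(hright s hs).2]
    field_simp
    ring

/-! ### Functionals along a profile -/

/-- Twice the energy along a profile. -/
def energy (f p : ℝ → ℝ) (s : ℝ) : ℝ := p s ^ 2 + 2 * Fint f s

/-- The Pohozaev type functional along a profile. -/
def pohozaev (f q ρ p : ℝ → ℝ) (s : ℝ) : ℝ :=
  Qint q (ρ s) * energy f p s - 2 * (Fint f s / f s) * (q (ρ s) * p s)

/-- The energy velocity, weighted by `Q / q`. -/
def weightedSpeed (f q ρ p : ℝ → ℝ) (s : ℝ) : ℝ :=
  Qint q (ρ s) / q (ρ s) * √(energy f p s)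

theorem IsNonlinearity.le_deriv_F_div {f : ℝ → ℝ} {b β Hinf : ℝ} (hf : IsNonlinearity f b β Hinf)
    (hH : 0 < Hinf) {s : ℝ} (hs : β ≤ s) :
    0 ≤ deriv (fun t => Fint f t / f t) s - 1 / 2 + Hinf := by
  rcases hs.eq_or_lt with rfl | hlt
  · have hfp := hf.pos _ hf.b_lt
    have hd := ((hf.Fd β hf.β_pos).div (hf.hd β hf.β_pos) hfp.ne').deriv
    have : deriv (fun t => Fint f t / f t) β = 1 := by
      refine hd.trans ?_
      rw [hf.Fβ]; field_simp; ring
    rw [this]; linarith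
  · linarith [hf.F3 s hlt]

namespace IsProfile
variable {f q ρ p : ℝ → ℝ} {b β Hinf σ α s : ℝ}

theorem s_pos (h : IsProfile f q σ α ρ p) (hs : s ∈ Ioo σ α) : 0 < s := h.nonneg.trans_lt hs.1

theorem hasDerivAt_energy (hf : IsNonlinearity f b β Hinf) (h : IsProfile f q σ α ρ p)
    (hs : s ∈ Ioo σ α) :
    HasDerivAt (energy f p) (2 * p s * (deriv q (ρ s) / q (ρ s))) s := by
  have hp := h.ppos s hs
  refine (((h.hp s hs).fun_pow 2).add ((hf.Fd s (h.s_pos hs)).const_mul 2)).congr_deriv ?_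
  simp only [Nat.cast_ofNat, Nat.add_one_sub_one, pow_one]
  field_simp
  ring

theorem energy_strictMono (hq : IsWeight q Hinf) (hf : IsNonlinearity f b β Hinf)
    (h : IsProfile f q σ α ρ p) : StrictMonoOn (energy f p) (Ioo σ α) :=
  strictMonoOn_of_hasDerivAt_pos (convex_Ioo _ _) (fun _ hs => h.hasDerivAt_energy hf hs)
    fun s hs => mul_pos (mul_pos two_pos (h.ppos s hs))
      (div_pos (hq.dpos _ (h.rpos s hs)) (hq.pos _ (h.rpos s hs)))

theorem energy_pos (hq : IsWeight q Hinf) (hf : IsNonlinearity f b β Hinf)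
    (h : IsProfile f q 0 α ρ p) (hs : s ∈ Ioo 0 α) : 0 < energy f p s := by
  have hm := h.energy_strictMono hq hf
  have key : ∀ t ∈ Ioo 0 α, 0 ≤ energy f p t := by
    intro t ht
    have hlim : Tendsto (fun x => 2 * Fint f x) (𝓝[>] 0) (𝓝 (2 * 0)) := hf.F0.const_mul 2
    rw [mul_zero] at hlim
    refine le_of_tendsto hlim ?_
    filter_upwards [Ioo_mem_nhdsGT ht.1] with x hx
    have := hm.monotoneOn (a := x) ⟨hx.1, hx.2.trans ht.2⟩ ht hx.2.le
    refine le_trans ?_ this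
    unfold energy
    nlinarith [sq_nonneg (p x)]
  have h2 : s / 2 ∈ Ioo 0 α := ⟨half_pos hs.1, by linarith [hs.1, hs.2]⟩
  exact (key _ h2).trans_lt (hm h2 hs (by linarith [hs.1]))

theorem hasDerivAt_comp (h : IsProfile f q σ α ρ p) (hs : s ∈ Ioo σ α) {g : ℝ → ℝ} {g' : ℝ}
    (hg : HasDerivAt g g' (ρ s)) : HasDerivAt (fun t => g (ρ t)) (g' * (-1 / p s)) s :=
  hg.comp s (h.hr s hs)

theorem hasDerivAt_mul (hq : IsWeight q Hinf) (h : IsProfile f q σ α ρ p) (hs : s ∈ Ioo σ α) :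
    HasDerivAt (fun t => q (ρ t) * p t) (-q (ρ s) * f s / p s) s := by
  have hp := h.ppos s hs
  have hqp := hq.pos _ (h.rpos s hs)
  refine ((h.hasDerivAt_comp hs (hq.hd _ (h.rpos s hs))).mul (h.hp s hs)).congr_deriv ?_
  field_simp
  ring

theorem hasDerivAt_pohozaev (hq : IsWeight q Hinf) (hf : IsNonlinearity f b β Hinf)
    (h : IsProfile f q σ α ρ p) (hs : s ∈ Ioo σ α) (hb : b < s) :
    HasDerivAt (pohozaev f q ρ p) (-2 * (q (ρ s) * p s) *
      (deriv (fun t => Fint f t / f t) s - 1 / 2 + Hfun q (ρ s))) s := by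
  have hp := h.ppos s hs
  have hr := h.rpos s hs
  have hqp := hq.pos _ hr
  have hfp := hf.pos s hb
  refine (((h.hasDerivAt_comp hs (hq.Qd _ hr)).mul (h.hasDerivAt_energy hf hs)).sub
    (((hf.hasDerivAt_F_div hb).const_mul 2).mul (h.hasDerivAt_mul hq hs))).congr_deriv ?_
  rw [hq.Heq _ hr]
  unfold energy
  field_simp
  ring

theorem hasDerivAt_weightedSpeed (hq : IsWeight q Hinf) (hf : IsNonlinearity f b β Hinf)
    (h : IsProfile f q σ α ρ p) (hs : s ∈ Ioo σ α) (hE : 0 < energy f p s) :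
    HasDerivAt (weightedSpeed f q ρ p) ((1 - Hfun q (ρ s)) * (p s / √(energy f p s)) -
      Hfun q (ρ s) * (p s / √(energy f p s))⁻¹) s := by
  have hp := h.ppos s hs
  have hr := h.rpos s hs
  have hqp := hq.pos _ hr
  have hE' := Real.sqrt_pos.2 hE
  refine ((h.hasDerivAt_comp hs (hq.Hd _ hr)).mul
    ((h.hasDerivAt_energy hf hs).sqrt hE.ne')).congr_deriv ?_
  rw [hq.Heq _ hr]
  field_simp
  ring

theorem continuousAt_ρ (h : IsProfile f q σ α ρ p) (hs : s ∈ Ioo σ α) : ContinuousAt ρ s :=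
  (h.hr s hs).continuousAt

theorem continuousAt_p (h : IsProfile f q σ α ρ p) (hs : s ∈ Ioo σ α) : ContinuousAt p s :=
  (h.hp s hs).continuousAt

theorem tendsto_pohozaev (hq : IsWeight q Hinf) (hf : IsNonlinearity f b β Hinf)
    (h : IsProfile f q σ α ρ p) (hb : b < α) :
    Tendsto (pohozaev f q ρ p) (𝓝[<] α) (𝓝 0) := by
  have hα : 0 < α := hf.b_pos.trans hb
  have hF : Tendsto (Fint f) (𝓝[<] α) (𝓝 (Fint f α)) :=
    (hf.Fd α hα).continuousAt.tendsto.mono_left nhdsWithin_le_nhds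
  have hff : Tendsto f (𝓝[<] α) (𝓝 (f α)) :=
    (hf.hd α hα).continuousAt.tendsto.mono_left nhdsWithin_le_nhds
  have hE : Tendsto (energy f p) (𝓝[<] α) (𝓝 (0 ^ 2 + 2 * Fint f α)) :=
    (h.p0.pow 2).add (hF.const_mul 2)
  have := ((hq.tendsto_Qint.comp h.r0).mul hE).sub (((hF.div hff (hf.pos α hb).ne').const_mul 2).mul
    ((hq.lim0.comp h.r0).mul h.p0))
  simp only [zero_mul, mul_zero, sub_zero] at this
  exact this

theorem pohozaev_nonneg (hq : IsWeight q Hinf) (hf : IsNonlinearity f b β Hinf)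
    (h : IsProfile f q σ α ρ p) (hs : s ∈ Ioo σ α) (hβ : β ≤ s) : 0 ≤ pohozaev f q ρ p s := by
  have hI : ∀ t ∈ Ico s α, t ∈ Ioo σ α := fun t ht => ⟨hs.1.trans_le ht.1, ht.2⟩
  have hanti : AntitoneOn (pohozaev f q ρ p) (Ico s α) := by
    refine antitoneOn_of_hasDerivAt_nonpos (convex_Ico _ _) (fun t ht =>
      h.hasDerivAt_pohozaev hq hf (hI t ht) (hf.b_lt.trans_le (hβ.trans ht.1))) fun t ht => ?_
    have h1 := mul_pos (hq.pos _ (h.rpos t (hI t ht))) (h.ppos t (hI t ht))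
    have h2 := hf.le_deriv_F_div hq.Hinf_pos (hβ.trans ht.1)
    have h3 := hq.Hinf_le _ (h.rpos t (hI t ht))
    nlinarith
  exact hanti.ge_of_tendsto_left ⟨le_rfl, hs.2⟩
    (h.tendsto_pohozaev hq hf (hf.b_lt.trans_le (hβ.trans hs.2.le)))

end IsProfile

/-! ### Comparison of two profiles -/

section Comparison
variable {f q ρ₁ p₁ ρ₂ p₂ : ℝ → ℝ} {b β Hinf σ₁ σ₂ α₁ α₂ s t : ℝ}

theorem gap_antitone (hq : IsWeight q Hinf)
    (h1 : IsProfile f q σ₁ α₁ ρ₁ p₁) (h2 : IsProfile f q σ₂ α₂ ρ₂ p₂) (hα : α₁ < α₂)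
    (hs1 : σ₁ < s) (hs2 : σ₂ < s) (hle : ∀ t ∈ Ico s α₁, ρ₁ t ≤ ρ₂ t) :
    AntitoneOn (fun t => (p₂ t ^ 2 - p₁ t ^ 2) * q (ρ₁ t)) (Ico s α₁) := by
  have hI1 : ∀ t ∈ Ico s α₁, t ∈ Ioo σ₁ α₁ := fun t ht => ⟨hs1.trans_le ht.1, ht.2⟩
  have hI2 : ∀ t ∈ Ico s α₁, t ∈ Ioo σ₂ α₂ := fun t ht => ⟨hs2.trans_le ht.1, ht.2.trans hα⟩
  refine antitoneOn_of_hasDerivAt_nonpos (convex_Ico _ _) (fun t ht =>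
    (((h2.hp t (hI2 t ht)).fun_pow 2).sub ((h1.hp t (hI1 t ht)).fun_pow 2)).mul
    (h1.hasDerivAt_comp (hI1 t ht) (hq.hd _ (h1.rpos t (hI1 t ht))))) fun t ht => ?_
  have hr1 := h1.rpos t (hI1 t ht)
  have hr2 := h2.rpos t (hI2 t ht)
  have hp1 := h1.ppos t (hI1 t ht)
  have hp2 := h2.ppos t (hI2 t ht)
  have hg : deriv q (ρ₂ t) / q (ρ₂ t) ≤ deriv q (ρ₁ t) / q (ρ₁ t) :=
    hq.anti.antitoneOn hr1 hr2 (hle t ht)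
  have hq1 := hq.pos _ hr1
  have hd1 := hq.dpos _ hr1
  set g₁ := deriv q (ρ₁ t) / q (ρ₁ t) with hg1
  set g₂ := deriv q (ρ₂ t) / q (ρ₂ t)
  have hdq : deriv q (ρ₁ t) = g₁ * q (ρ₁ t) := by rw [hg1]; field_simp
  have hg1p : 0 < g₁ := div_pos hd1 hq1
  rw [hdq]
  have e : (↑2 * p₂ t ^ (2 - 1) * (g₂ - f t / p₂ t) - ↑2 * p₁ t ^ (2 - 1) * (g₁ - f t / p₁ t)) *
      q (ρ₁ t) + (p₂ t ^ 2 - p₁ t ^ 2) * (g₁ * q (ρ₁ t) * (-1 / p₁ t)) =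
      -(q (ρ₁ t) * (2 * p₂ t * (g₁ - g₂) + g₁ * (p₂ t - p₁ t) ^ 2 / p₁ t)) := by
    simp only [Nat.add_one_sub_one, pow_one]
    field_simp
    ring
  push_cast
  refine e.trans_le ?_
  have : 0 ≤ q (ρ₁ t) * (2 * p₂ t * (g₁ - g₂) + g₁ * (p₂ t - p₁ t) ^ 2 / p₁ t) := by
    have := sub_nonneg.2 hg
    positivity
  linarith

theorem slope_lt_near (h1 : IsProfile f q σ₁ α₁ ρ₁ p₁) (h2 : IsProfile f q σ₂ α₂ ρ₂ p₂)
    (hα : α₁ < α₂) (hσ : σ₂ < α₁) : ∀ᶠ t in 𝓝[<] α₁, p₁ t < p₂ t :=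
  h1.p0.eventually_lt ((h2.continuousAt_p ⟨hσ, hα⟩).tendsto.mono_left nhdsWithin_le_nhds)
    (h2.ppos _ ⟨hσ, hα⟩)

theorem radius_lt_near (h1 : IsProfile f q σ₁ α₁ ρ₁ p₁) (h2 : IsProfile f q σ₂ α₂ ρ₂ p₂)
    (hα : α₁ < α₂) (hσ : σ₂ < α₁) : ∀ᶠ t in 𝓝[<] α₁, ρ₁ t < ρ₂ t :=
  (h1.r0.mono_right nhdsWithin_le_nhds).eventually_lt
    ((h2.continuousAt_ρ ⟨hσ, hα⟩).tendsto.mono_left nhdsWithin_le_nhds) (h2.rpos _ ⟨hσ, hα⟩)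

theorem slope_lt_of_radius_le (hq : IsWeight q Hinf)
    (h1 : IsProfile f q σ₁ α₁ ρ₁ p₁) (h2 : IsProfile f q σ₂ α₂ ρ₂ p₂) (hα : α₁ < α₂)
    (hs1 : σ₁ < s) (hs2 : σ₂ < s) (hle : ∀ t ∈ Ico s α₁, ρ₁ t ≤ ρ₂ t) :
    ∀ t ∈ Ico s α₁, p₁ t < p₂ t := by
  intro t ht
  have hanti := gap_antitone hq h1 h2 hα hs1 hs2 hle
  obtain ⟨x, hx, hx'⟩ := ((slope_lt_near h1 h2 hα (hs2.trans_le (ht.1.trans ht.2.le))).and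
    (Ioo_mem_nhdsLT ht.2)).exists
  have hxI : x ∈ Ico s α₁ := ⟨ht.1.trans hx'.1.le, hx'.2⟩
  have h3 := hanti ht hxI hx'.1.le
  have hq1 := hq.pos _ (h1.rpos t ⟨hs1.trans_le ht.1, ht.2⟩)
  have hqx := hq.pos _ (h1.rpos x ⟨hs1.trans_le hxI.1, hxI.2⟩)
  have hp1 := h1.ppos x ⟨hs1.trans_le hxI.1, hxI.2⟩
  have h4 : 0 < p₂ x ^ 2 - p₁ x ^ 2 := by nlinarith
  have h5 := (mul_pos h4 hqx).trans_le h3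
  have h6 := (pos_iff_pos_of_mul_pos h5).2 hq1
  exact lt_of_pow_lt_pow_left₀ 2 (h2.ppos t ⟨hs2.trans_le ht.1, ht.2.trans hα⟩).le (by linarith)

/-- Above `β`, the Pohozaev functionals compare the two profiles. -/
theorem pohozaev_compare (hq : IsWeight q Hinf) (hf : IsNonlinearity f b β Hinf)
    (h1 : IsProfile f q σ₁ α₁ ρ₁ p₁) (h2 : IsProfile f q σ₂ α₂ ρ₂ p₂) (hα : α₁ < α₂)
    (hs1 : σ₁ < s) (hs2 : σ₂ < s) (hsα : s < α₁) (hβ : β ≤ s)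
    (hlow : ∀ x ∈ Ico s t, ρ₂ x ≤ ρ₁ x) (hup : ∀ x ∈ Ico t α₁, ρ₁ x ≤ ρ₂ x)
    (hp : ∀ x ∈ Ico s α₁, p₁ x ≤ p₂ x) (hS : q (ρ₂ s) * p₂ s ≤ q (ρ₁ s) * p₁ s) :
    Qint q (ρ₁ s) * energy f p₁ s * (q (ρ₂ s) * p₂ s) ≤
      q (ρ₁ s) * p₁ s * (Qint q (ρ₂ s) * energy f p₂ s) := by
  have hI1 : ∀ t ∈ Ico s α₁, t ∈ Ioo σ₁ α₁ := fun t ht => ⟨hs1.trans_le ht.1, ht.2⟩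
  have hI2 : ∀ t ∈ Ico s α₁, t ∈ Ioo σ₂ α₂ := fun t ht => ⟨hs2.trans_le ht.1, ht.2.trans hα⟩
  have hb : ∀ t ∈ Ico s α₁, b < t := fun t ht => hf.b_lt.trans_le (hβ.trans ht.1)
  have hsI : s ∈ Ico s α₁ := ⟨le_rfl, hsα⟩
  have ha1 : ∀ t ∈ Ico s α₁, 0 < q (ρ₁ t) * p₁ t := fun t ht =>
    mul_pos (hq.pos _ (h1.rpos t (hI1 t ht))) (h1.ppos t (hI1 t ht))
  have ha2 : ∀ t ∈ Ico s α₁, 0 < q (ρ₂ t) * p₂ t := fun t ht =>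
    mul_pos (hq.pos _ (h2.rpos t (hI2 t ht))) (h2.ppos t (hI2 t ht))
  have hSanti : AntitoneOn (fun t => q (ρ₁ t) * p₁ t / (q (ρ₂ t) * p₂ t)) (Ico s α₁) := by
    refine antitoneOn_of_hasDerivAt_nonpos (convex_Ico _ _) (fun t ht =>
      (h1.hasDerivAt_mul hq (hI1 t ht)).fun_div (h2.hasDerivAt_mul hq (hI2 t ht))
        (ha2 t ht).ne') fun t ht => ?_
    refine div_nonpos_of_nonpos_of_nonneg ?_ (sq_nonneg _)
    have hq1 := hq.pos _ (h1.rpos t (hI1 t ht))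
    have hq2 := hq.pos _ (h2.rpos t (hI2 t ht))
    have hp1 := h1.ppos t (hI1 t ht)
    have hp2 := h2.ppos t (hI2 t ht)
    have hfp := hf.pos t (hb t ht)
    have e : -q (ρ₁ t) * f t / p₁ t * (q (ρ₂ t) * p₂ t) -
        q (ρ₁ t) * p₁ t * (-q (ρ₂ t) * f t / p₂ t) =
        -(q (ρ₁ t) * q (ρ₂ t) * f t * (p₂ t - p₁ t) * (p₂ t + p₁ t) / (p₁ t * p₂ t)) := by
      field_simp
      ring
    rw [e]
    have := sub_nonneg.2 (hp t ht)
    have : 0 ≤ q (ρ₁ t) * q (ρ₂ t) * f t * (p₂ t - p₁ t) * (p₂ t + p₁ t) / (p₁ t * p₂ t) := by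
      positivity
    linarith
  set S := q (ρ₁ s) * p₁ s / (q (ρ₂ s) * p₂ s) with hSdef
  have hS1 : 1 ≤ S := (one_le_div (ha2 s hsI)).2 hS
  have haS : ∀ t ∈ Ico s α₁, q (ρ₁ t) * p₁ t ≤ S * (q (ρ₂ t) * p₂ t) := fun t ht =>
    (div_le_iff₀ (ha2 t ht)).1 (hSanti hsI ht ht.1)
  have hN : MonotoneOn (fun t => pohozaev f q ρ₁ p₁ t - S * pohozaev f q ρ₂ p₂ t) (Ico s α₁) := by
    refine monotoneOn_of_hasDerivAt_nonneg (convex_Ico _ _) (fun t ht =>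
      (h1.hasDerivAt_pohozaev hq hf (hI1 t ht) (hb t ht)).sub
      ((h2.hasDerivAt_pohozaev hq hf (hI2 t ht) (hb t ht)).const_mul S)) fun x hx => ?_
    have hk := hf.le_deriv_F_div hq.Hinf_pos (hβ.trans hx.1)
    have hr1 := h1.rpos x (hI1 x hx)
    have hr2 := h2.rpos x (hI2 x hx)
    have hH1 := hq.Hinf_le _ hr1
    have hH2 := hq.Hinf_le _ hr2
    have hA := haS x hx
    have hA1 := ha1 x hx
    have hA2 := ha2 x hx
    have hh : q (ρ₁ x) * p₁ x * (Hfun q (ρ₁ x) - Hinf) ≤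
        S * (q (ρ₂ x) * p₂ x) * (Hfun q (ρ₂ x) - Hinf) := by
      rcases lt_or_ge x t with hxt | hxt
      · have h3 : Hfun q (ρ₁ x) ≤ Hfun q (ρ₂ x) := hq.Hanti hr2 hr1 (hlow x ⟨hx.1, hxt⟩)
        exact mul_le_mul hA (by linarith) (by linarith) (hA1.le.trans hA)
      · have h3 : q (ρ₁ x) * (Hfun q (ρ₁ x) - Hinf) ≤ q (ρ₂ x) * (Hfun q (ρ₂ x) - Hinf) :=
          hq.Hmono hr1 hr2 (hup x ⟨hxt, hx.2⟩)
        have h4 : 0 ≤ q (ρ₂ x) * (Hfun q (ρ₂ x) - Hinf) :=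
          mul_nonneg (hq.pos _ hr2).le (by linarith)
        have hp1 := h1.ppos x (hI1 x hx)
        have h5 := mul_le_mul h3 (hp x hx) hp1.le h4
        have h6 : 0 ≤ q (ρ₂ x) * (Hfun q (ρ₂ x) - Hinf) * p₂ x :=
          mul_nonneg h4 (h2.ppos x (hI2 x hx)).le
        nlinarith
    have h7 := mul_le_mul_of_nonneg_right hA hk
    nlinarith
  have hlim : Tendsto (fun t => pohozaev f q ρ₁ p₁ t - S * pohozaev f q ρ₂ p₂ t) (𝓝[<] α₁)
      (𝓝 (0 - S * pohozaev f q ρ₂ p₂ α₁)) := by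
    refine (h1.tendsto_pohozaev hq hf (hf.b_lt.trans_le (hβ.trans hsα.le))).sub
      (Tendsto.const_mul S ?_)
    exact (h2.hasDerivAt_pohozaev hq hf ⟨hs2.trans hsα, hα⟩
      (hf.b_lt.trans_le (hβ.trans hsα.le))).continuousAt.tendsto.mono_left nhdsWithin_le_nhds
  have h3 := hN.le_of_tendsto_left hsI hlim
  have h4 := h2.pohozaev_nonneg hq hf (s := α₁) ⟨hs2.trans hsα, hα⟩ (hβ.trans hsα.le)
  have h5 : 0 ≤ S * pohozaev f q ρ₂ p₂ α₁ := mul_nonneg (by linarith) h4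
  have h6 : q (ρ₁ s) * p₁ s = S * (q (ρ₂ s) * p₂ s) := (div_mul_cancel₀ _ (ha2 s hsI).ne').symm
  have h7 : Qint q (ρ₁ s) * energy f p₁ s ≤ S * (Qint q (ρ₂ s) * energy f p₂ s) := by
    simp only [pohozaev] at h3
    simp only [pohozaev] at h5
    rw [h6] at h3
    nlinarith
  calc Qint q (ρ₁ s) * energy f p₁ s * (q (ρ₂ s) * p₂ s)
      ≤ S * (Qint q (ρ₂ s) * energy f p₂ s) * (q (ρ₂ s) * p₂ s) :=
        mul_le_mul_of_nonneg_right h7 (ha2 s hsI).le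
    _ = q (ρ₁ s) * p₁ s * (Qint q (ρ₂ s) * energy f p₂ s) := by rw [h6]; ring

/-- The derivatives of the weighted speeds are ordered where `F ≤ 0`. -/
theorem weightedSpeed_deriv_le {E₁ E₂ P₁ P₂ H₁ H₂ F : ℝ} (hP1 : 0 < P₁) (hP : P₁ ≤ P₂)
    (hE1 : E₁ = P₁ ^ 2 + 2 * F) (hE2 : E₂ = P₂ ^ 2 + 2 * F) (hE : 0 < E₁) (hF : F ≤ 0)
    (hH1 : 0 < H₁) (hH : H₁ ≤ H₂) (hH2 : H₂ < 1 / 2) :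
    (1 - H₂) * (P₂ / √E₂) - H₂ * (P₂ / √E₂)⁻¹ ≤ (1 - H₁) * (P₁ / √E₁) - H₁ * (P₁ / √E₁)⁻¹ ∧
    (P₁ < P₂ → F < 0 →
    (1 - H₂) * (P₂ / √E₂) - H₂ * (P₂ / √E₂)⁻¹ < (1 - H₁) * (P₁ / √E₁) - H₁ * (P₁ / √E₁)⁻¹) := by
  have hP2 := hP1.trans_le hP
  have hEE : 0 < E₂ := by nlinarith
  have hs1 := Real.sqrt_pos.2 hE
  have hs2 := Real.sqrt_pos.2 hEE
  have hq1 := Real.sq_sqrt hE.le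
  have hq2 := Real.sq_sqrt hEE.le
  set k₁ := P₁ / √E₁ with hk1
  set k₂ := P₂ / √E₂ with hk2
  have hk2p : 0 < k₂ := div_pos hP2 hs2
  have hk : k₂ ≤ k₁ := by
    rw [hk1, hk2, div_le_div_iff₀ hs2 hs1]
    refine le_of_sq_le_sq ?_ (by positivity)
    rw [mul_pow, mul_pow, hq1, hq2, hE1, hE2]
    have := mul_le_mul_of_nonpos_left (pow_le_pow_left₀ hP1.le hP 2) hF
    nlinarith
  have hk1p := hk2p.trans_le hk
  have hi : k₁⁻¹ ≤ k₂⁻¹ := inv_anti₀ hk2p hk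
  have hip : 0 < k₁⁻¹ := inv_pos.2 hk1p
  refine ⟨?_, fun hlt hFn => ?_⟩
  · nlinarith
  · have hk' : k₂ < k₁ := by
      rw [hk1, hk2, div_lt_div_iff₀ hs2 hs1]
      refine lt_of_pow_lt_pow_left₀ 2 (by positivity) ?_
      rw [mul_pow, mul_pow, hq1, hq2, hE1, hE2]
      have := mul_lt_mul_of_neg_left (pow_lt_pow_left₀ hlt hP1.le two_ne_zero) hFn
      nlinarith
    nlinarith

end Comparison

section Comparison
variable {f q ρ₁ p₁ ρ₂ p₂ : ℝ → ℝ} {b β Hinf σ₂ α₁ α₂ s t x : ℝ}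

theorem weightedSpeed_sub_antitone (hq : IsWeight q Hinf) (hf : IsNonlinearity f b β Hinf)
    (h1 : IsProfile f q 0 α₁ ρ₁ p₁) (h2 : IsProfile f q σ₂ α₂ ρ₂ p₂) (hα : α₁ < α₂)
    (hs2 : σ₂ < s) (htα : t < α₁) (htβ : t ≤ β)
    (hρ : ∀ x ∈ Icc s t, ρ₂ x ≤ ρ₁ x) (hp : ∀ x ∈ Icc s t, p₁ x ≤ p₂ x) :
    AntitoneOn (fun x => weightedSpeed f q ρ₂ p₂ x - weightedSpeed f q ρ₁ p₁ x) (Icc s t) ∧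
    ((∀ x ∈ Icc s t, p₁ x < p₂ x) → b < s → t < β → StrictAntiOn
      (fun x => weightedSpeed f q ρ₂ p₂ x - weightedSpeed f q ρ₁ p₁ x) (Icc s t)) := by
  have hI2 : ∀ x ∈ Icc s t, x ∈ Ioo σ₂ α₂ := fun x hx =>
    ⟨hs2.trans_le hx.1, (hx.2.trans_lt htα).trans hα⟩
  have hI1 : ∀ x ∈ Icc s t, x ∈ Ioo 0 α₁ := fun x hx =>
    ⟨h2.s_pos (hI2 x hx), hx.2.trans_lt htα⟩
  have hE1 : ∀ x ∈ Icc s t, 0 < energy f p₁ x := fun x hx => h1.energy_pos hq hf (hI1 x hx)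
  have hE2 : ∀ x ∈ Icc s t, 0 < energy f p₂ x := fun x hx => by
    have := hE1 x hx
    have := pow_le_pow_left₀ (h1.ppos x (hI1 x hx)).le (hp x hx) 2
    unfold energy at *
    linarith
  have hd : ∀ x ∈ Icc s t, HasDerivAt
      (fun x => weightedSpeed f q ρ₂ p₂ x - weightedSpeed f q ρ₁ p₁ x) _ x := fun x hx =>
    (h2.hasDerivAt_weightedSpeed hq hf (hI2 x hx) (hE2 x hx)).sub
      (h1.hasDerivAt_weightedSpeed hq hf (hI1 x hx) (hE1 x hx))
  have key : ∀ x ∈ Icc s t, _ := fun x hx => weightedSpeed_deriv_le (h1.ppos x (hI1 x hx)) (hp x hx)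
    (E₁ := energy f p₁ x) (E₂ := energy f p₂ x) rfl rfl (hE1 x hx)
    (hf.F_nonpos (hI1 x hx).1 (hx.2.trans htβ)) (hq.H_pos (h1.rpos x (hI1 x hx)))
    (hq.Hanti (h2.rpos x (hI2 x hx)) (h1.rpos x (hI1 x hx)) (hρ x hx))
    (hq.H_lt_half (h2.rpos x (hI2 x hx)))
  refine ⟨antitoneOn_of_hasDerivAt_nonpos (convex_Icc _ _) hd fun x hx =>
    sub_nonpos.2 (key x hx).1, fun hlt hb hβ => ?_⟩
  exact strictAntiOn_of_hasDerivAt_neg (convex_Icc _ _) hd fun x hx =>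
    sub_neg.2 ((key x hx).2 (hlt x hx) (hf.F_neg (hb.trans_le hx.1) (hx.2.trans_lt hβ)))

theorem radius_lt_of_slope_lt {σ₁ : ℝ} (h1 : IsProfile f q σ₁ α₁ ρ₁ p₁)
    (h2 : IsProfile f q σ₂ α₂ ρ₂ p₂) (hα : α₁ < α₂) (hs1 : σ₁ < s) (hs2 : σ₂ < s) (htα : t < α₁)
    (hp : ∀ x ∈ Ioo s t, p₁ x < p₂ x) :
    StrictMonoOn (fun x => ρ₂ x - ρ₁ x) (Icc s t) := by
  have hI2 : ∀ x ∈ Icc s t, x ∈ Ioo σ₂ α₂ := fun x hx =>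
    ⟨hs2.trans_le hx.1, (hx.2.trans_lt htα).trans hα⟩
  have hI1 : ∀ x ∈ Icc s t, x ∈ Ioo σ₁ α₁ := fun x hx =>
    ⟨hs1.trans_le hx.1, hx.2.trans_lt htα⟩
  refine strictMonoOn_of_deriv_pos (convex_Icc _ _) (fun x hx =>
    ((h2.continuousAt_ρ (hI2 x hx)).sub (h1.continuousAt_ρ (hI1 x hx))).continuousWithinAt)
    fun x hx => ?_
  rw [interior_Icc] at hx
  have hx' := Ioo_subset_Icc_self hx
  rw [((h2.hr x (hI2 x hx')).fun_sub (h1.hr x (hI1 x hx'))).deriv, neg_div, neg_div]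
  have := one_div_lt_one_div_of_lt (h1.ppos x (hI1 x hx')) (hp x hx)
  linarith

theorem weightedSpeed_le_at_min (hq : IsWeight q Hinf) (hf : IsNonlinearity f b β Hinf)
    (h1 : IsProfile f q 0 α₁ ρ₁ p₁) (h2 : IsProfile f q σ₂ α₂ ρ₂ p₂) (hα : α₁ < α₂)
    (htα : t < α₁) (hσt : σ₂ < min t β) (heq : ρ₁ t = ρ₂ t)
    (hlow : ∀ x ∈ Ico (min t β) t, ρ₂ x ≤ ρ₁ x) (hup : ∀ x ∈ Ico t α₁, ρ₁ x ≤ ρ₂ x)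
    (hp : ∀ x ∈ Ico (min t β) α₁, p₁ x < p₂ x) :
    weightedSpeed f q ρ₁ p₁ (min t β) ≤ weightedSpeed f q ρ₂ p₂ (min t β) ∧
    (t ≤ β → weightedSpeed f q ρ₁ p₁ (min t β) < weightedSpeed f q ρ₂ p₂ (min t β)) := by
  rcases le_or_gt t β with htβ | htβ
  · rw [min_eq_left htβ] at *
    have hI1 : t ∈ Ioo 0 α₁ := ⟨h2.nonneg.trans_lt hσt, htα⟩
    have hlt : weightedSpeed f q ρ₁ p₁ t < weightedSpeed f q ρ₂ p₂ t := by
      unfold weightedSpeed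
      rw [heq]
      have hr := h2.rpos t ⟨hσt, htα.trans hα⟩
      refine mul_lt_mul_of_pos_left ?_ (div_pos (hq.Qpos _ hr) (hq.pos _ hr))
      refine Real.sqrt_lt_sqrt (h1.energy_pos hq hf hI1).le ?_
      have := pow_lt_pow_left₀ (hp t ⟨le_rfl, htα⟩) (h1.ppos t hI1).le two_ne_zero
      unfold energy
      linarith
    exact ⟨hlt.le, fun _ => hlt⟩
  · rw [min_eq_right htβ.le] at *
    refine ⟨?_, fun h => absurd h (not_le.2 htβ)⟩
    have hβα : β < α₁ := htβ.trans htα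
    have hI1 : β ∈ Ioo 0 α₁ := ⟨hf.β_pos, hβα⟩
    have hI2 : β ∈ Ioo σ₂ α₂ := ⟨hσt, hβα.trans hα⟩
    have hr1 := h1.rpos _ hI1
    have hr2 := h2.rpos _ hI2
    have hq1 := hq.pos _ hr1
    have hq2 := hq.pos _ hr2
    have hp1 := h1.ppos _ hI1
    have hp2 := h2.ppos _ hI2
    have hQ1 := hq.Qpos _ hr1
    have hQ2 := hq.Qpos _ hr2
    have hle : ρ₂ β ≤ ρ₁ β := hlow β ⟨le_rfl, htβ⟩
    have hE1 : energy f p₁ β = p₁ β ^ 2 := by simp [energy, hf.Fβ]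
    have hE2 : energy f p₂ β = p₂ β ^ 2 := by simp [energy, hf.Fβ]
    unfold weightedSpeed
    rw [hE1, hE2, Real.sqrt_sq hp1.le, Real.sqrt_sq hp2.le]
    rcases le_or_gt (q (ρ₁ β) * p₁ β) (q (ρ₂ β) * p₂ β) with hS | hS
    · have h3 : Qint q (ρ₁ β) / q (ρ₁ β) ^ 2 ≤ Qint q (ρ₂ β) / q (ρ₂ β) ^ 2 :=
        hq.Q_div_sq_antitone hr2 hr1 hle
      have h4 := mul_le_mul h3 hS (by positivity) (by positivity)
      have e1 : Qint q (ρ₁ β) / q (ρ₁ β) ^ 2 * (q (ρ₁ β) * p₁ β) =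
        Qint q (ρ₁ β) / q (ρ₁ β) * p₁ β := by field_simp
      have e2 : Qint q (ρ₂ β) / q (ρ₂ β) ^ 2 * (q (ρ₂ β) * p₂ β) =
        Qint q (ρ₂ β) / q (ρ₂ β) * p₂ β := by field_simp
      rwa [e1, e2] at h4
    · have h3 := pohozaev_compare hq hf h1 h2 hα hf.β_pos hσt hβα le_rfl hlow hup
        (fun x hx => (hp x hx).le) hS.le
      rw [hE1, hE2] at h3
      rw [div_mul_eq_mul_div, div_mul_eq_mul_div, div_le_div_iff₀ hq1 hq2]
      have h4 : p₁ β * p₂ β * (Qint q (ρ₁ β) * p₁ β * q (ρ₂ β)) ≤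
          p₁ β * p₂ β * (Qint q (ρ₂ β) * p₂ β * q (ρ₁ β)) := by linarith
      exact le_of_mul_le_mul_left h4 (mul_pos hp1 hp2)

/-- Once the profiles cross, the slopes stay ordered. -/
theorem slope_lt_of_crossing (hq : IsWeight q Hinf) (hf : IsNonlinearity f b β Hinf)
    (h1 : IsProfile f q 0 α₁ ρ₁ p₁) (h2 : IsProfile f q σ₂ α₂ ρ₂ p₂) (hα : α₁ < α₂)
    (htσ : σ₂ < t) (htα : t < α₁) (heq : ρ₁ t = ρ₂ t) (hup : ∀ x ∈ Ioo t α₁, ρ₁ x < ρ₂ x) :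
    ∀ s ∈ Ioo σ₂ α₁, p₁ s < p₂ s := by
  have hup' : ∀ x ∈ Ico t α₁, ρ₁ x ≤ ρ₂ x := by
    intro x hx
    rcases hx.1.eq_or_lt with rfl | hlt
    · exact heq.le
    · exact (hup x ⟨hlt, hx.2⟩).le
  have ht0 : 0 < t := h2.nonneg.trans_lt htσ
  have hpt := slope_lt_of_radius_le hq h1 h2 hα ht0 htσ hup'
  intro s hs
  have hI2 : ∀ x ∈ Ico s α₁, x ∈ Ioo σ₂ α₂ := fun x hx => ⟨hs.1.trans_le hx.1, hx.2.trans hα⟩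
  have hI1 : ∀ x ∈ Ico s α₁, x ∈ Ioo 0 α₁ := fun x hx => ⟨h2.s_pos (hI2 x hx), hx.2⟩
  refine sub_pos.1 (pos_of_backward_propagation (g := fun x => p₂ x - p₁ x) (s := s) (a := α₁)
    (fun x hx => ((h2.continuousAt_p (hI2 x hx)).sub
      (h1.continuousAt_p (hI1 x hx))).continuousWithinAt)
    ((slope_lt_near h1 h2 hα (htσ.trans htα)).mono fun x hx => sub_pos.2 hx) ?_ s ⟨le_rfl, hs.2⟩)
  intro x hx hpos h0
  have hx1 := hI1 x hx
  have hx2 := hI2 x hx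
  have hpx : p₁ x = p₂ x := (sub_eq_zero.1 h0).symm
  have hxt : x < t := by
    by_contra hcon
    exact (hpt x ⟨not_lt.1 hcon, hx.2⟩).ne hpx
  have hp : ∀ y ∈ Ioo x α₁, p₁ y < p₂ y := fun y hy => sub_pos.1 (hpos y hy)
  have hp' : ∀ y ∈ Ico x α₁, p₁ y ≤ p₂ y := by
    intro y hy
    rcases hy.1.eq_or_lt with rfl | hlt
    · exact hpx.le
    · exact (hp y ⟨hlt, hy.2⟩).le
  have hmono := radius_lt_of_slope_lt h1 h2 hα hx1.1 hx2.1 htα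
    (fun y hy => hp y ⟨hy.1, hy.2.trans htα⟩)
  have hlow : ∀ y ∈ Ico x t, ρ₂ y < ρ₁ y := by
    intro y hy
    have := hmono ⟨hy.1, hy.2.le⟩ ⟨hxt.le, le_rfl⟩ hy.2
    simp only [heq, sub_self] at this
    linarith
  have hr1 := h1.rpos x hx1
  have hr2 := h2.rpos x hx2
  have hρx := hlow x ⟨le_rfl, hxt⟩
  have hQQ : Qint q (ρ₂ x) / q (ρ₂ x) < Qint q (ρ₁ x) / q (ρ₁ x) :=
    hq.Q_div_strictMono hr2 hr1 hρx
  have hEpos := h1.energy_pos hq hf hx1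
  have hEE : energy f p₂ x = energy f p₁ x := by simp [energy, hpx]
  rcases le_or_gt β x with hβx | hβx
  · have hq1 := hq.pos _ hr1
    have hq2 := hq.pos _ hr2
    have hqq : q (ρ₂ x) < q (ρ₁ x) := hq.strictMono hr2 hr1 hρx
    have hpp := h2.ppos x hx2
    have h3 := pohozaev_compare hq hf h1 h2 hα hx1.1 hx2.1 hx.2 hβx
      (fun y hy => (hlow y hy).le) hup' hp' (by rw [hpx]; nlinarith)
    rw [hEE, hpx] at h3
    rw [div_lt_div_iff₀ hq2 hq1] at hQQ
    have h4 := mul_pos hEpos hpp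
    nlinarith
  · have hxm : x < min t β := lt_min hxt hβx
    have h3 := (weightedSpeed_le_at_min hq hf h1 h2 hα htα (hx2.1.trans hxm) heq
      (fun y hy => (hlow y ⟨hxm.le.trans hy.1, hy.2⟩).le) hup'
      (fun y hy => hp y ⟨hxm.trans_le hy.1, hy.2⟩)).1
    have h4 := (weightedSpeed_sub_antitone hq hf h1 h2 hα hx2.1 ((min_le_left t β).trans_lt htα)
      (min_le_right t β) (fun y hy => ?_) (fun y hy => hp' y
        ⟨hy.1, hy.2.trans_lt ((min_le_left t β).trans_lt htα)⟩)).1 ⟨le_rfl, hxm.le⟩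
        ⟨hxm.le, le_rfl⟩ hxm.le
    · have h5 : weightedSpeed f q ρ₁ p₁ x ≤ weightedSpeed f q ρ₂ p₂ x := by linarith
      unfold weightedSpeed at h5
      rw [hEE] at h5
      exact absurd (le_of_mul_le_mul_right h5 (Real.sqrt_pos.2 hEpos)) (not_le.2 hQQ)
    · rcases (hy.2.trans (min_le_left t β)).eq_or_lt with rfl | hlt
      · exact heq.ge
      · exact (hlow y ⟨hy.1, hlt⟩).le

/-- If the profiles are somewhere in reverse order, they cross and the slopes are ordered. -/
theorem exists_crossing (hq : IsWeight q Hinf) (hf : IsNonlinearity f b β Hinf)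
    (h1 : IsProfile f q 0 α₁ ρ₁ p₁) (h2 : IsProfile f q σ₂ α₂ ρ₂ p₂) (hα : α₁ < α₂)
    (hx : x ∈ Ioo σ₂ α₁) (hle : ρ₂ x ≤ ρ₁ x) :
    ∃ t ∈ Ioo σ₂ α₁, ρ₁ t = ρ₂ t ∧ (∀ y ∈ Ico t α₁, ρ₁ y ≤ ρ₂ y) ∧
      (∀ y ∈ Ioo σ₂ α₁, p₁ y < p₂ y) ∧ (∀ y ∈ Ioo σ₂ t, ρ₂ y < ρ₁ y) := by
  have hI2 : ∀ y ∈ Ioo σ₂ α₁, y ∈ Ioo σ₂ α₂ := fun y hy => ⟨hy.1, hy.2.trans hα⟩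
  have hI1 : ∀ y ∈ Ioo σ₂ α₁, y ∈ Ioo 0 α₁ := fun y hy => ⟨h2.s_pos (hI2 y hy), hy.2⟩
  obtain ⟨t, ht, ht0, htp⟩ := exists_last_nonpos (g := fun y => ρ₂ y - ρ₁ y) hx.2
    (fun y hy => ((h2.continuousAt_ρ (hI2 y ⟨hx.1.trans_le hy.1, hy.2⟩)).sub
      (h1.continuousAt_ρ (hI1 y ⟨hx.1.trans_le hy.1, hy.2⟩))).continuousWithinAt)
    ((radius_lt_near h1 h2 hα (hx.1.trans hx.2)).mono fun y hy => sub_pos.2 hy) (sub_nonpos.2 hle)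
  have heq : ρ₁ t = ρ₂ t := (sub_eq_zero.1 ht0).symm
  have htσ : σ₂ < t := hx.1.trans_le ht.1
  have hup : ∀ y ∈ Ioo t α₁, ρ₁ y < ρ₂ y := fun y hy => sub_pos.1 (htp y hy)
  have hp := slope_lt_of_crossing hq hf h1 h2 hα htσ ht.2 heq hup
  refine ⟨t, ⟨htσ, ht.2⟩, heq, fun y hy => ?_, hp, fun y hy => ?_⟩
  · rcases hy.1.eq_or_lt with rfl | hlt
    · exact heq.le
    · exact (hup y ⟨hlt, hy.2⟩).le
  · have hmono := radius_lt_of_slope_lt h1 h2 hα (hI1 y ⟨hy.1, hy.2.trans ht.2⟩).1 hy.1 ht.2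
      (fun z hz => hp z ⟨hy.1.trans hz.1, hz.2.trans ht.2⟩)
    have := hmono ⟨le_rfl, hy.2.le⟩ ⟨hy.2.le, le_rfl⟩ hy.2
    simp only [heq, sub_self] at this
    linarith

/-- Two crossing profiles that reach zero stay uniformly apart near zero. -/
theorem exists_uniform_gap (hq : IsWeight q Hinf) (hf : IsNonlinearity f b β Hinf)
    (h1 : IsProfile f q 0 α₁ ρ₁ p₁) (h2 : IsProfile f q 0 α₂ ρ₂ p₂) (hα : α₁ < α₂)
    (hx : x ∈ Ioo 0 α₁) (hle : ρ₂ x ≤ ρ₁ x) :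
    ∃ t ∈ Ioo 0 α₁, t ≤ β ∧ ∃ η > 0, ∃ c > 0, ∀ s ∈ Ioc 0 t, p₁ s < p₂ s ∧ ρ₂ s + η ≤ ρ₁ s ∧
      weightedSpeed f q ρ₁ p₁ s + c ≤ weightedSpeed f q ρ₂ p₂ s := by
  obtain ⟨t, ht, heq, hup, hp, hlow⟩ := exists_crossing hq hf h1 h2 hα hx hle
  set m := min t β with hm
  have hm0 : 0 < m := lt_min ht.1 hf.β_pos
  have hmα : m < α₁ := (min_le_left _ _).trans_lt ht.2
  have hlow' : ∀ y ∈ Ioc 0 m, ρ₂ y ≤ ρ₁ y := by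
    intro y hy
    rcases (hy.2.trans (min_le_left t β)).eq_or_lt with rfl | hlt
    · exact heq.ge
    · exact (hlow y ⟨hy.1, hlt⟩).le
  obtain ⟨hT, hT'⟩ := weightedSpeed_le_at_min hq hf h1 h2 hα ht.2 hm0 heq
    (fun y hy => (hlow y ⟨hm0.trans_le hy.1, hy.2⟩).le) hup
    (fun y hy => hp y ⟨hm0.trans_le hy.1, hy.2⟩)
  have hanti : ∀ s : ℝ, 0 < s → ∀ z, z ≤ m → _ := fun s hs z hz =>
    weightedSpeed_sub_antitone hq hf h1 h2 hα hs (hz.trans_lt hmα)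
    (hz.trans (min_le_right t β)) (fun y hy => hlow' y ⟨hs.trans_le hy.1, hy.2.trans hz⟩)
    (fun y hy => (hp y ⟨hs.trans_le hy.1, (hy.2.trans hz).trans_lt hmα⟩).le)
  obtain ⟨y, hy0, hym, hgap⟩ : ∃ y, 0 < y ∧ y < m ∧
      0 < weightedSpeed f q ρ₂ p₂ y - weightedSpeed f q ρ₁ p₁ y := by
    rcases le_or_gt t β with htβ | htβ
    · refine ⟨m / 2, half_pos hm0, by linarith, ?_⟩
      have := (hanti (m / 2) (half_pos hm0) m le_rfl).1 ⟨le_rfl, by linarith⟩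
        ⟨by linarith, le_rfl⟩ (by linarith)
      have := hT' htβ
      simp only at *
      linarith
    · have hmβ : m = β := min_eq_right htβ.le
      have hbm : b < m := hmβ ▸ hf.b_lt
      have hb0 := hf.b_pos
      obtain ⟨y, hby, hym⟩ := exists_between hbm
      obtain ⟨z, hyz, hzm⟩ := exists_between hym
      have hy0 := hb0.trans hby
      refine ⟨y, hy0, hym, ?_⟩
      have h3 := (hanti y hy0 z hzm.le).2
        (fun w hw => hp w ⟨hy0.trans_le hw.1, (hw.2.trans hzm.le).trans_lt hmα⟩) hby
        (hmβ ▸ hzm) ⟨le_rfl, hyz.le⟩ ⟨hyz.le, le_rfl⟩ hyz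
      have h4 := (hanti z (hy0.trans hyz) m le_rfl).1 ⟨le_rfl, hzm.le⟩ ⟨hzm.le, le_rfl⟩ hzm.le
      simp only at h3 h4
      linarith
  have hyt : y < t := hym.trans_le (min_le_left _ _)
  refine ⟨y, ⟨hy0, hym.trans hmα⟩, hym.le.trans (min_le_right _ _), ρ₁ y - ρ₂ y,
    sub_pos.2 (hlow y ⟨hy0, hyt⟩), _, hgap, fun s hs => ?_⟩
  have hsα : s < α₁ := hs.2.trans_lt (hym.trans hmα)
  refine ⟨hp s ⟨hs.1, hsα⟩, ?_, ?_⟩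
  · have hmono := (radius_lt_of_slope_lt h1 h2 hα hs.1 hs.1 (hym.trans hmα)
      (fun z hz => hp z ⟨hs.1.trans hz.1, hz.2.trans (hym.trans hmα)⟩)).monotoneOn
      ⟨le_rfl, hs.2⟩ ⟨hs.2, le_rfl⟩ hs.2
    linarith
  · have h3 := (hanti s hs.1 y hym.le).1 ⟨le_rfl, hs.2⟩ ⟨hs.2, le_rfl⟩ hs.2
    simp only at h3
    linarith

end Comparison

/-! ### Behaviour at the end of the descent -/

theorem IsProfile.exists_tendsto {f q ρ p : ℝ → ℝ} {b β Hinf α : ℝ} (hq : IsWeight q Hinf)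
    (hf : IsNonlinearity f b β Hinf) (h : IsProfile f q 0 α ρ p) :
    ∃ ℓ : ℝ, 0 ≤ ℓ ∧ Tendsto p (𝓝[>] 0) (𝓝 ℓ) ∧
      Tendsto (fun s => √(energy f p s)) (𝓝[>] 0) (𝓝 ℓ) := by
  have hE : ∀ x ∈ energy f p '' Ioo 0 α, 0 ≤ x := by
    rintro _ ⟨s, hs, rfl⟩
    exact (h.energy_pos hq hf hs).le
  have hlim := (h.energy_strictMono hq hf).monotoneOn.tendsto_nhdsWithin_Ioo_right
    (nonempty_Ioo.2 h.lt) ⟨0, hE⟩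
  set e := sInf (energy f p '' Ioo 0 α)
  refine ⟨√e, Real.sqrt_nonneg _, ?_, hlim.sqrt⟩
  have h2 : Tendsto (fun s => √(energy f p s - 2 * Fint f s)) (𝓝[>] 0) (𝓝 √(e - 2 * 0)) :=
    (hlim.sub (hf.F0.const_mul 2)).sqrt
  rw [mul_zero, sub_zero] at h2
  refine h2.congr' ?_
  filter_upwards [Ioo_mem_nhdsGT h.lt] with s hs
  rw [energy, add_sub_cancel_right, Real.sqrt_sq (h.ppos s hs).le]

/-- A solution together with its profile. -/
structure IsDescending (f q u v : ℝ → ℝ) (σ α : ℝ) (ρ : ℝ → ℝ) : Prop where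
  radial : IsRadial f q u v α
  descent : IsDescent u σ α ρ
  profile : IsProfile f q σ α ρ (fun s => v (ρ s))
  Z1_pos : 0 < Z1 u

namespace IsDescending
variable {f q u v ρ : ℝ → ℝ} {b β Hinf σ α : ℝ}

theorem eventually_pos (h : IsDescending f q u v σ α ρ) :
    ∀ᶠ r : ℝ in leftFilter (Z1 u), 0 < r ∧ (r : EReal) < Z1 u :=
  eventually_leftFilter (r₀ := 0) (by simpa using h.Z1_pos)

theorem tendsto_v (h : IsDescending f q u v σ α ρ) {ℓ : ℝ}
    (hℓ : Tendsto (fun s => v (ρ s)) (𝓝[>] σ) (𝓝 ℓ)) : Tendsto v (leftFilter (Z1 u)) (𝓝 ℓ) := by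
  refine (hℓ.comp h.descent.tend).congr' ?_
  filter_upwards [h.eventually_pos] with r hr
  simp only [Function.comp, (h.descent.left r hr.1 hr.2).2]

theorem tendsto_deriv (h : IsDescending f q u v σ α ρ) {ℓ : ℝ}
    (hℓ : Tendsto (fun s => v (ρ s)) (𝓝[>] σ) (𝓝 ℓ)) :
    Tendsto (deriv u) (leftFilter (Z1 u)) (𝓝 (-ℓ)) := by
  refine (h.tendsto_v hℓ).neg.congr' ?_
  filter_upwards [h.eventually_pos] with r hr
  rw [h.radial.deriv_eq hr.1]

theorem tendsto_u (h : IsDescending f q u v σ α ρ) : Tendsto u (leftFilter (Z1 u)) (𝓝 σ) :=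
  h.descent.tend.mono_right nhdsWithin_le_nhds

theorem eq_zero_of_tendsto (h : IsDescending f q u v σ α ρ)
    (h0 : Tendsto u (leftFilter (Z1 u)) (𝓝 0)) : σ = 0 := tendsto_nhds_unique h.tendsto_u h0

end IsDescending

theorem IsRadial.exists_descending {f q u v : ℝ → ℝ} {b β Hinf α : ℝ} (hq : IsWeight q Hinf)
    (hf : IsNonlinearity f b β Hinf) (h : IsRadial f q u v α) (hα : b < α) :
    ∃ σ ρ, IsDescending f q u v σ α ρ := by
  obtain ⟨σ, ρ, hd, hp⟩ := h.exists_profile hq hf hα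
  exact ⟨σ, ρ, h, hd, hp, h.Z1_pos hq hf hα⟩

section Comparison
variable {f q u₁ v₁ ρ₁ u₂ v₂ ρ₂ : ℝ → ℝ} {b β Hinf σ₂ α₁ α₂ x : ℝ}

theorem limit_eq_zero_of_crossing (hq : IsWeight q Hinf) (hf : IsNonlinearity f b β Hinf)
    (h1 : IsDescending f q u₁ v₁ 0 α₁ ρ₁) (h2 : IsDescending f q u₂ v₂ σ₂ α₂ ρ₂) (hα : α₁ < α₂)
    (hx : x ∈ Ioo σ₂ α₁) (hle : ρ₂ x ≤ ρ₁ x) : σ₂ = 0 := by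
  by_contra hne
  have hσ : 0 < σ₂ := lt_of_le_of_ne h2.profile.nonneg (Ne.symm hne)
  obtain ⟨t, ht, -, -, hp, hlow⟩ := exists_crossing hq hf h1.profile h2.profile hα hx hle
  have hσI : σ₂ ∈ Ioo 0 α₁ := ⟨hσ, hx.1.trans hx.2⟩
  have hev : ∀ᶠ s in 𝓝[>] σ₂, ρ₂ s < ρ₁ σ₂ + 1 := by
    have : ∀ᶠ s in 𝓝[>] σ₂, ρ₁ s < ρ₁ σ₂ + 1 :=
      ((h1.profile.continuousAt_ρ hσI).tendsto.mono_left nhdsWithin_le_nhds).eventually_lt_const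
        (lt_add_one _)
    filter_upwards [this, Ioo_mem_nhdsGT ht.1] with s hs hs' using (hlow s hs').trans hs
  have hrt := h2.descent.rtend
  have hZ : Z1 u₂ ≠ ⊤ := by
    intro hZ
    rw [hZ, leftFilter, if_pos rfl] at hrt
    obtain ⟨s, hs, hs'⟩ := (hev.and (hrt.eventually_ge_atTop (ρ₁ σ₂ + 1))).exists
    linarith
  obtain ⟨z, hz⟩ : ∃ z : ℝ, Z1 u₂ = z := by
    lift Z1 u₂ to ℝ using ⟨hZ, (bot_le.trans_lt h2.Z1_pos).ne'⟩ with z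
    exact ⟨z, rfl⟩
  have hz0 : 0 < z := by have := h2.Z1_pos; rw [hz] at this; exact_mod_cast this
  have hlf : leftFilter (Z1 u₂) = 𝓝[<] z := by
    rw [hz, leftFilter, if_neg (EReal.coe_ne_top z), EReal.toReal_coe]
  rw [hlf] at hrt
  have hu : u₂ z = σ₂ := by
    have h3 := h2.tendsto_u
    rw [hlf] at h3
    exact tendsto_nhds_unique
      ((h2.radial.hu z hz0).continuousAt.tendsto.mono_left nhdsWithin_le_nhds) h3
  have hv : 0 < v₂ z := by
    refine (h1.profile.ppos σ₂ hσI).trans_le ?_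
    refine le_of_tendsto_of_tendsto
      ((h1.profile.continuousAt_p hσI).tendsto.mono_left nhdsWithin_le_nhds : Tendsto _ (𝓝[>] σ₂) _)
      ((h2.radial.hv z hz0).continuousAt.tendsto.comp (hrt.mono_right nhdsWithin_le_nhds)) ?_
    filter_upwards [Ioo_mem_nhdsGT hσI.2] with s hs using (hp s hs).le
  exact h2.radial.not_both_pos_at_Z1 hz0 hz ⟨hu ▸ hσ, hv⟩

theorem IsProfile.exists_weightedSpeed_lt {f q ρ p : ℝ → ℝ} {b β Hinf α t c : ℝ}
    (hq : IsWeight q Hinf) (hf : IsNonlinearity f b β Hinf) (h : IsProfile f q 0 α ρ p)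
    (ht : t ∈ Ioo 0 α) (htβ : t ≤ β) (hc : 0 < c) (hρ : Tendsto ρ (𝓝[>] 0) atTop) :
    ∃ s ∈ Ioc 0 t, weightedSpeed f q ρ p s < c := by
  have hI : ∀ x ∈ Ioc 0 t, x ∈ Ioo 0 α := fun x hx => ⟨hx.1, hx.2.trans_lt ht.2⟩
  have hmono : MonotoneOn (fun s => q (ρ s) ^ 2 * energy f p s) (Ioc 0 t) := by
    refine monotoneOn_of_hasDerivAt_nonneg (convex_Ioc _ _) (fun x hx =>
      ((h.hasDerivAt_comp (hI x hx) (hq.hd _ (h.rpos x (hI x hx)))).fun_pow 2).mul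
        (h.hasDerivAt_energy hf (hI x hx))) fun x hx => ?_
    have hr := h.rpos x (hI x hx)
    have hqp := hq.pos _ hr
    have hdq := hq.dpos _ hr
    have hp := h.ppos x (hI x hx)
    have hF := hf.F_nonpos hx.1 (hx.2.trans htβ)
    have e : ↑2 * q (ρ x) ^ (2 - 1) * (deriv q (ρ x) * (-1 / p x)) * energy f p x +
        q (ρ x) ^ 2 * (2 * p x * (deriv q (ρ x) / q (ρ x))) =
        4 * q (ρ x) * deriv q (ρ x) * (-Fint f x) / p x := by
      unfold energy
      simp only [Nat.add_one_sub_one, pow_one]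
      field_simp
      ring
    push_cast
    refine le_trans ?_ e.ge
    have := neg_nonneg.2 hF
    positivity
  set W := q (ρ t) ^ 2 * energy f p t with hW
  obtain ⟨R, hR, hRlt⟩ := hq.exists_Q_div_sq_lt (η := c / (√W + 1)) (by positivity)
  obtain ⟨s, hsR, hs⟩ := ((hρ.eventually_ge_atTop R).and (Ioo_mem_nhdsGT ht.1)).exists
  refine ⟨s, ⟨hs.1, hs.2.le⟩, ?_⟩
  have hsI := hI s ⟨hs.1, hs.2.le⟩
  have hqp := hq.pos _ (h.rpos s hsI)
  have hle : √(q (ρ s) ^ 2 * energy f p s) ≤ √W :=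
    Real.sqrt_le_sqrt (hmono ⟨hs.1, hs.2.le⟩ ⟨ht.1, le_rfl⟩ hs.2.le)
  rw [Real.sqrt_mul (sq_nonneg _), Real.sqrt_sq hqp.le] at hle
  have h3 := hRlt _ hsR
  rw [lt_div_iff₀ (by positivity)] at h3
  have e : weightedSpeed f q ρ p s =
      Qint q (ρ s) / q (ρ s) ^ 2 * (q (ρ s) * √(energy f p s)) := by
    unfold weightedSpeed
    field_simp
  have hQ : 0 ≤ Qint q (ρ s) / q (ρ s) ^ 2 :=
    div_nonneg (hq.Qpos _ (h.rpos s hsI)).le (sq_nonneg _)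
  rw [e]
  refine lt_of_le_of_lt (mul_le_mul_of_nonneg_left (hle.trans ?_) hQ) h3
  linarith

theorem separation_of_crossing (hq : IsWeight q Hinf) (hf : IsNonlinearity f b β Hinf)
    (h1 : IsDescending f q u₁ v₁ 0 α₁ ρ₁) (h2 : IsDescending f q u₂ v₂ σ₂ α₂ ρ₂) (hα : α₁ < α₂)
    (hx : x ∈ Ioo σ₂ α₁) (hle : ρ₂ x ≤ ρ₁ x) :
    σ₂ = 0 ∧ Z1 u₂ < Z1 u₁ ∧ ∃ ℓ₁ ℓ₂ : ℝ, 0 ≤ ℓ₁ ∧ ℓ₁ < ℓ₂ ∧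
      Tendsto (deriv u₁) (leftFilter (Z1 u₁)) (𝓝 (-ℓ₁)) ∧
      Tendsto (deriv u₂) (leftFilter (Z1 u₂)) (𝓝 (-ℓ₂)) := by
  obtain rfl := limit_eq_zero_of_crossing hq hf h1 h2 hα hx hle
  refine ⟨rfl, ?_⟩
  obtain ⟨t, ht, htβ, η, hη, c, hc, hgap⟩ :=
    exists_uniform_gap hq hf h1.profile h2.profile hα hx hle
  have hI1 : ∀ s ∈ Ioc 0 t, s ∈ Ioo 0 α₁ := fun s hs => ⟨hs.1, hs.2.trans_lt ht.2⟩
  have hI2 : ∀ s ∈ Ioc 0 t, s ∈ Ioo 0 α₂ := fun s hs => ⟨hs.1, (hs.2.trans_lt ht.2).trans hα⟩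
  have hT1 : ∀ s ∈ Ioc 0 t, 0 ≤ weightedSpeed f q ρ₁ (fun s => v₁ (ρ₁ s)) s := fun s hs =>
    mul_nonneg (div_nonneg (hq.Qpos _ (h1.profile.rpos s (hI1 s hs))).le
      (hq.pos _ (h1.profile.rpos s (hI1 s hs))).le) (Real.sqrt_nonneg _)
  have hrt := h2.descent.rtend
  have hZ : Z1 u₂ ≠ ⊤ := by
    intro hZ
    rw [hZ, leftFilter, if_pos rfl] at hrt
    obtain ⟨s, hs, hsc⟩ := h2.profile.exists_weightedSpeed_lt hq hf ⟨ht.1, ht.2.trans hα⟩ htβ hc hrt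
    have := (hgap s hs).2.2
    have := hT1 s hs
    linarith
  obtain ⟨z, hz⟩ : ∃ z : ℝ, Z1 u₂ = z := by
    lift Z1 u₂ to ℝ using ⟨hZ, (bot_le.trans_lt h2.Z1_pos).ne'⟩ with z
    exact ⟨z, rfl⟩
  have hz0 : 0 < z := by have := h2.Z1_pos; rw [hz] at this; exact_mod_cast this
  have hlf : leftFilter (Z1 u₂) = 𝓝[<] z := by
    rw [hz, leftFilter, if_neg (EReal.coe_ne_top z), EReal.toReal_coe]
  rw [hlf] at hrt
  have hrt' : Tendsto ρ₂ (𝓝[>] 0) (𝓝 z) := hrt.mono_right nhdsWithin_le_nhds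
  refine ⟨?_, ?_⟩
  · have hev : ∀ᶠ s in 𝓝[>] 0, z - η < ρ₂ s := hrt'.eventually_const_lt (by linarith)
    obtain ⟨s, hs, hst⟩ := (hev.and (Ioo_mem_nhdsGT ht.1)).exists
    have hsI : s ∈ Ioc 0 t := ⟨hst.1, hst.2.le⟩
    have h3 := (hgap s hsI).2.1
    rw [hz]
    refine lt_trans ?_ (h1.descent.right s (hI1 s hsI)).2.1
    have : z < ρ₁ s := by linarith
    exact_mod_cast this
  · obtain ⟨ℓ₁, hℓ₁, hp1, hE1⟩ := h1.profile.exists_tendsto hq hf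
    obtain ⟨ℓ₂, hℓ₂, hp2, hE2⟩ := h2.profile.exists_tendsto hq hf
    refine ⟨ℓ₁, ℓ₂, hℓ₁, ?_, h1.tendsto_deriv hp1, h2.tendsto_deriv hp2⟩
    have hQ : Tendsto (fun s => Qint q (ρ₂ s) / q (ρ₂ s)) (𝓝[>] 0) (𝓝 (Qint q z / q z)) :=
      (hq.Hd z hz0).continuousAt.tendsto.comp hrt'
    have hlim : Qint q z / q z * ℓ₁ + c ≤ Qint q z / q z * ℓ₂ := by
      refine le_of_tendsto_of_tendsto ((hQ.mul hE1).add_const c) (hQ.mul hE2) ?_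
      filter_upwards [Ioo_mem_nhdsGT ht.1] with s hs
      have hsI : s ∈ Ioc 0 t := ⟨hs.1, hs.2.le⟩
      obtain ⟨-, h3, h4⟩ := hgap s hsI
      have h5 : Qint q (ρ₂ s) / q (ρ₂ s) ≤ Qint q (ρ₁ s) / q (ρ₁ s) :=
        hq.Q_div_strictMono.monotoneOn (h2.profile.rpos s (hI2 s hsI))
          (h1.profile.rpos s (hI1 s hsI)) (by linarith)
      refine le_trans ?_ h4
      exact add_le_add_left (mul_le_mul_of_nonneg_right h5 (Real.sqrt_nonneg _)) c
    have hQz : 0 < Qint q z / q z := div_pos (hq.Qpos z hz0) (hq.pos z hz0)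
    by_contra hcon
    have := mul_le_mul_of_nonneg_left (not_lt.1 hcon) hQz.le
    linarith

end Comparison

/-! ### Dependence on the initial value -/

namespace IsNonlinearity
variable {f : ℝ → ℝ} {b β Hinf : ℝ}

theorem exists_lipschitz (hf : IsNonlinearity f b β Hinf) {m M : ℝ} (hm : 0 < m) :
    ∃ L, 0 ≤ L ∧ ∀ x ∈ Icc m M, ∀ y ∈ Icc m M, |f x - f y| ≤ L * |x - y| := by
  obtain ⟨L, hL⟩ := isCompact_Icc.exists_bound_of_continuousOn
    (hf.dcont.mono fun x (hx : x ∈ Icc m M) => hm.trans_le hx.1)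
  refine ⟨max L 0, le_max_right _ _, fun x hx y hy => ?_⟩
  have := (convex_Icc m M).norm_image_sub_le_of_norm_hasDerivWithin_le
    (fun z hz => (hf.hd z (hm.trans_le hz.1)).hasDerivWithinAt)
    (fun z hz => (hL z hz).trans (le_max_left L 0)) hy hx
  simpa [Real.norm_eq_abs] using this

end IsNonlinearity

section Dependence
variable {f q u v u₁ v₁ u₂ v₂ : ℝ → ℝ} {b β Hinf α α₁ α₂ L R : ℝ} {I : Set ℝ}

theorem IsRadial.gronwall (hq : IsWeight q Hinf) (hL : 0 ≤ L)
    (hf : ∀ x ∈ I, ∀ y ∈ I, |f x - f y| ≤ L * |x - y|)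
    (h1 : IsRadial f q u₁ v₁ α₁) (h2 : IsRadial f q u₂ v₂ α₂)
    (hI1 : ∀ r ∈ Ioc 0 R, u₁ r ∈ I) (hI2 : ∀ r ∈ Ioc 0 R, u₂ r ∈ I) :
    ∀ r ∈ Ioc 0 R, |u₁ r - u₂ r| ≤ Real.exp ((L + 1) * R) * |α₁ - α₂| := by
  have hexp : ∀ r : ℝ, HasDerivAt (fun r => Real.exp (-((L + 1) * r)))
      (Real.exp (-((L + 1) * r)) * -((L + 1) * 1)) r := fun r =>
    ((hasDerivAt_id r).const_mul (L + 1)).fun_neg.exp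
  have hanti : AntitoneOn (fun r => ((u₁ r - u₂ r) ^ 2 + (v₁ r - v₂ r) ^ 2) *
      Real.exp (-((L + 1) * r))) (Ioc 0 R) := by
    refine antitoneOn_of_hasDerivAt_nonpos (convex_Ioc _ _) (fun r hr =>
      ((((h1.hu r hr.1).fun_sub (h2.hu r hr.1)).fun_pow 2).fun_add
      (((h1.hv r hr.1).fun_sub (h2.hv r hr.1)).fun_pow 2)).mul (hexp r)) fun r hr => ?_
    have hg : 0 < deriv q r / q r := div_pos (hq.dpos r hr.1) (hq.pos r hr.1)
    have hfl := hf _ (hI1 r hr) _ (hI2 r hr)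
    have he := Real.exp_pos (-((L + 1) * r))
    set g := deriv q r / q r
    set w := u₁ r - u₂ r
    set z := v₁ r - v₂ r with hz
    set φ := f (u₁ r) - f (u₂ r) with hφ
    set e := Real.exp (-((L + 1) * r))
    have h3 : 2 * (z * φ) ≤ L * (w ^ 2 + z ^ 2) := by
      have h5 : z * φ ≤ |z| * (L * |w|) := by
        refine (le_abs_self _).trans ?_
        rw [abs_mul]
        exact mul_le_mul_of_nonneg_left hfl (abs_nonneg _)
      have h6 := mul_nonneg hL (sq_nonneg (|z| - |w|))
      have h7 := sq_abs z
      have h8 := sq_abs w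
      nlinarith
    have h4 : -2 * (w * z) ≤ w ^ 2 + z ^ 2 := by nlinarith [sq_nonneg (w + z)]
    have key : 2 * w * (-z) + 2 * z * (φ - g * z) - (w ^ 2 + z ^ 2) * (L + 1) ≤ 0 := by
      have := mul_nonneg hg.le (sq_nonneg z)
      nlinarith
    have := mul_nonpos_of_nonpos_of_nonneg key he.le
    refine le_of_eq_of_le ?_ this
    simp only [Nat.add_one_sub_one, pow_one, hz, hφ]
    push_cast
    ring
  have hid : Tendsto (fun r : ℝ => Real.exp (-((L + 1) * r))) (𝓝[>] 0) (𝓝 1) := by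
    have := (hexp 0).continuousAt.tendsto
    simp only [mul_zero, neg_zero, Real.exp_zero] at this
    exact this.mono_left nhdsWithin_le_nhds
  have hlim : Tendsto (fun r => ((u₁ r - u₂ r) ^ 2 + (v₁ r - v₂ r) ^ 2) *
      Real.exp (-((L + 1) * r))) (𝓝[>] 0) (𝓝 ((α₁ - α₂) ^ 2)) := by
    simpa using (((h1.u0.sub h2.u0).pow 2).add ((h1.v0.sub h2.v0).pow 2)).mul hid
  intro r hr
  have h3 := hanti.le_of_tendsto_right hr hlim
  have hR : 0 < R := hr.1.trans_le hr.2
  rw [Real.exp_neg, ← div_eq_mul_inv, div_le_iff₀ (Real.exp_pos _)] at h3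
  set K := Real.exp ((L + 1) * R) with hK
  have hKr : Real.exp ((L + 1) * r) ≤ K :=
    Real.exp_le_exp.2 (mul_le_mul_of_nonneg_left hr.2 (by linarith))
  have hK1 : 1 ≤ K := Real.one_le_exp (by positivity)
  have h4 : |u₁ r - u₂ r| ^ 2 ≤ (K * |α₁ - α₂|) ^ 2 := by
    rw [sq_abs, mul_pow, sq_abs]
    have h5 := sq_nonneg (α₁ - α₂)
    have h6 := mul_le_mul_of_nonneg_left hKr h5
    have h7 : (α₁ - α₂) ^ 2 * K ≤ (α₁ - α₂) ^ 2 * K ^ 2 :=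
      mul_le_mul_of_nonneg_left (by nlinarith) h5
    nlinarith [sq_nonneg (v₁ r - v₂ r)]
  exact le_of_sq_le_sq h4 (by positivity)

/-- Lipschitz dependence on the initial value, on intervals where the solution is positive. -/
theorem IsRadial.exists_dependence (hq : IsWeight q Hinf) (hf : IsNonlinearity f b β Hinf)
    (h : IsRadial f q u v α) {m M : ℝ} (hR : 0 < R) (hm : 0 < m)
    (hu : ∀ r ∈ Ioc 0 R, u r ∈ Icc m M) :
    ∃ K ≥ 1, ∃ δ > 0, ∀ u₁ v₁ α₁ u₂ v₂ α₂, IsRadial f q u₁ v₁ α₁ → IsRadial f q u₂ v₂ α₂ →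
      |α₁ - α| < δ → |α₂ - α| < δ → ∀ r ∈ Ioc 0 R,
      |u₁ r - u₂ r| ≤ K * |α₁ - α₂| ∧ |v₁ r - v₂ r| ≤ K * |α₁ - α₂| * r := by
  obtain ⟨L, hL, hlip⟩ := hf.exists_lipschitz (m := m / 2) (M := M + m / 2) (half_pos hm)
  set K := Real.exp ((L + 1) * R) with hK
  have hK1 : 1 ≤ K := Real.one_le_exp (by positivity)
  have hmem : ∀ {x y : ℝ}, x ∈ Icc m M → |y - x| ≤ m / 2 → y ∈ Icc (m / 2) (M + m / 2) := by
    intro x y hx hy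
    have := abs_le.1 hy
    exact ⟨by linarith [hx.1, this.1], by linarith [hx.2, this.2]⟩
  have hclose : ∀ u₁ v₁ α₁, IsRadial f q u₁ v₁ α₁ → |α₁ - α| < m / (4 * K) →
      ∀ r ∈ Ioc 0 R, u₁ r ∈ Icc (m / 2) (M + m / 2) := by
    intro u₁ v₁ α₁ h1 hα
    have hα' : K * |α₁ - α| < m / 4 := by
      rw [lt_div_iff₀ (by positivity)] at hα
      linarith
    have hpos := pos_of_forward_propagation (g := fun r => m / 2 - |u₁ r - u r|) (a := 0) (s := R)
      (fun r hr => (continuousAt_const.sub ((h1.hu r hr.1).continuousAt.sub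
        (h.hu r hr.1).continuousAt).abs).continuousWithinAt) ?_ ?_
    · intro r hr
      exact hmem (hu r hr) (by linarith [hpos r hr])
    · have : Tendsto (fun r => m / 2 - |u₁ r - u r|) (𝓝[>] 0) (𝓝 (m / 2 - |α₁ - α|)) :=
        ((h1.u0.sub h.u0).abs).const_sub _
      refine this.eventually_const_lt ?_
      nlinarith [abs_nonneg (α₁ - α)]
    · intro x hx hpx
      have hxle : |u₁ x - u x| ≤ m / 2 := by
        have hlim : Tendsto (fun r => |u₁ r - u r|) (𝓝[<] x) (𝓝 |u₁ x - u x|) :=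
          (((h1.hu x hx.1).continuousAt.sub (h.hu x hx.1).continuousAt).abs.tendsto).mono_left
            nhdsWithin_le_nhds
        refine le_of_tendsto hlim ?_
        filter_upwards [Ioo_mem_nhdsLT hx.1] with r hr
        linarith [hpx r hr]
      have hIoc : ∀ r ∈ Ioc 0 x, u₁ r ∈ Icc (m / 2) (M + m / 2) := by
        intro r hr
        refine hmem (hu r ⟨hr.1, hr.2.trans hx.2⟩) ?_
        rcases hr.2.eq_or_lt with rfl | hlt
        · exact hxle
        · linarith [hpx r ⟨hr.1, hlt⟩]
      have h3 := IsRadial.gronwall hq hL hlip h1 h hIoc (fun r hr =>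
        hmem (hu r ⟨hr.1, hr.2.trans hx.2⟩) (by simpa using (half_pos hm).le)) x ⟨hx.1, le_rfl⟩
      have h4 : Real.exp ((L + 1) * x) ≤ K :=
        Real.exp_le_exp.2 (mul_le_mul_of_nonneg_left hx.2 (by linarith))
      have h5 := mul_le_mul_of_nonneg_right h4 (abs_nonneg (α₁ - α))
      have : 0 < m / 2 - |u₁ x - u x| := by linarith
      exact this.ne'
  refine ⟨(L + 1) * K, by nlinarith, m / (4 * K), by positivity, ?_⟩
  intro u₁ v₁ α₁ u₂ v₂ α₂ h1 h2 hα1 hα2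
  have hw := IsRadial.gronwall hq hL hlip h1 h2 (hclose _ _ _ h1 hα1) (hclose _ _ _ h2 hα2)
  have hd := abs_nonneg (α₁ - α₂)
  have hM : 0 ≤ L * (K * |α₁ - α₂|) := by positivity
  have hKd : 0 ≤ K * |α₁ - α₂| := by positivity
  have hv := hq.abs_le_mul_of_damped (R := R) (w := fun r => v₁ r - v₂ r)
    (h := fun r => f (u₁ r) - f (u₂ r)) hM
    (fun r hr => ((h1.hv r hr.1).sub (h2.hv r hr.1)).congr_deriv (by ring))
    (fun r hr => (hlip _ (hclose _ _ _ h1 hα1 r hr) _ (hclose _ _ _ h2 hα2 r hr)).trans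
      (mul_le_mul_of_nonneg_left (hw r hr) hL))
    (by simpa using hq.lim0.mul (h1.v0.sub h2.v0))
  intro r hr
  constructor
  · have := hw r hr
    nlinarith
  · have := hv r hr
    have h3 := mul_nonneg hKd hr.1.le
    nlinarith

end Dependence

/-! ### Comparison near the origin -/

section Origin
variable {f q u v : ℝ → ℝ} {b β Hinf α R κ : ℝ}

/-- Bounds for the slope and its derivative while `f ∘ u` is nearly constant. -/
theorem IsRadial.slope_bounds (hq : IsWeight q Hinf) (h : IsRadial f q u v α) (hκ : 0 < κ)
    (hfu : ∀ r ∈ Ioc 0 R, |f (u r) - κ| ≤ Hinf / 4 * κ) :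
    (∀ r ∈ Ioc 0 R, κ * Hinf / 2 ≤ f (u r) - deriv q r / q r * v r) ∧
    ∀ r ∈ Ioc 0 R, κ * Hinf / 2 * r ≤ v r ∧ v r ≤ 2 * κ * r := by
  have hHp := hq.Hinf_pos
  have hH1 : Hinf < 1 / 2 := (hq.Hinf_le 1 one_pos).trans_lt (hq.H_lt_half one_pos)
  set k := (1 + Hinf / 4) * κ with hk
  have hanti : AntitoneOn (fun r => q r * v r - k * Qint q r) (Ioc 0 R) := by
    refine antitoneOn_of_hasDerivAt_nonpos (convex_Ioc _ _) (fun r hr =>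
      ((hq.hd r hr.1).mul (h.hv r hr.1)).sub ((hq.Qd r hr.1).const_mul k)) fun r hr => ?_
    have hqr := hq.pos r hr.1
    have h1 : deriv q r * v r + q r * (f (u r) - deriv q r / q r * v r) = q r * f (u r) := by
      field_simp; ring
    rw [h1]
    have h2 := (abs_le.1 (hfu r hr)).2
    have : q r * f (u r) ≤ q r * k := mul_le_mul_of_nonneg_left (by rw [hk]; linarith) hqr.le
    linarith
  have hlim : Tendsto (fun r => q r * v r - k * Qint q r) (𝓝[>] 0) (𝓝 0) := by
    simpa using (hq.lim0.mul h.v0).sub (hq.tendsto_Qint.const_mul k)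
  have hqv : ∀ r ∈ Ioc 0 R, q r * v r ≤ k * Qint q r := fun r hr => by
    have := hanti.le_of_tendsto_right hr hlim
    linarith
  have hkp : 0 < k := by positivity
  have hd : ∀ r ∈ Ioc 0 R, κ * Hinf / 2 ≤ f (u r) - deriv q r / q r * v r := by
    intro r hr
    have hqr := hq.pos r hr.1
    have hdr := hq.dpos r hr.1
    have h1 : deriv q r / q r * v r ≤ k * (1 - Hfun q r) := by
      rw [hq.Heq r hr.1]
      have : deriv q r / q r * v r = deriv q r / q r ^ 2 * (q r * v r) := by field_simp
      rw [this]
      refine (mul_le_mul_of_nonneg_left (hqv r hr) (by positivity)).trans (le_of_eq ?_)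
      ring
    have h2 := (abs_le.1 (hfu r hr)).1
    have h3 := hq.Hinf_le r hr.1
    have h4 := mul_le_mul_of_nonneg_left h3 hkp.le
    have h5 : 0 < κ * Hinf * Hinf := by positivity
    rw [hk] at h1 h4
    nlinarith
  refine ⟨hd, fun r hr => ⟨?_, ?_⟩⟩
  · have hmono : MonotoneOn (fun r => v r - κ * Hinf / 2 * r) (Ioc 0 R) := by
      refine monotoneOn_of_hasDerivAt_nonneg (convex_Ioc _ _) (fun r hr =>
        (h.hv r hr.1).sub ((hasDerivAt_id r).const_mul (κ * Hinf / 2))) fun r hr => ?_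
      have := hd r hr
      linarith
    have hid : Tendsto (fun r : ℝ => r) (𝓝[>] 0) (𝓝 0) := nhdsWithin_le_nhds
    have hlim' : Tendsto (fun r => v r - κ * Hinf / 2 * r) (𝓝[>] 0) (𝓝 0) := by
      simpa using h.v0.sub (hid.const_mul (κ * Hinf / 2))
    have := hmono.ge_of_tendsto_right hr hlim'
    linarith
  · have h1 := hqv r hr
    have h2 := mul_le_mul_of_nonneg_left (hq.Qle r hr.1) hkp.le
    have h3 : q r * v r ≤ q r * (k * r) := by linarith
    have h4 := le_of_mul_le_mul_left h3 (hq.pos r hr.1)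
    have h5 : k * r ≤ 2 * κ * r := mul_le_mul_of_nonneg_right (by rw [hk]; nlinarith) hr.1.le
    exact h4.trans h5

theorem IsRadial.exists_bounds_near_origin (hq : IsWeight q Hinf) (hf : IsNonlinearity f b β Hinf)
    (h : IsRadial f q u v α) (hα : b < α) :
    ∃ R > 0, ∃ K ≥ 1, ∃ δ > 0, ∃ m > 0, ∃ A > 0,
      (∀ u₁ v₁ α₁, IsRadial f q u₁ v₁ α₁ → |α₁ - α| < δ → ∀ r ∈ Ioc 0 R, b < u₁ r ∧
        m ≤ f (u₁ r) - deriv q r / q r * v₁ r ∧ m * r ≤ v₁ r ∧ v₁ r ≤ A * r) ∧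
      ∀ u₁ v₁ α₁ u₂ v₂ α₂, IsRadial f q u₁ v₁ α₁ → IsRadial f q u₂ v₂ α₂ →
      |α₁ - α| < δ → |α₂ - α| < δ → ∀ r ∈ Ioc 0 R,
      |u₁ r - u₂ r| ≤ K * |α₁ - α₂| ∧ |v₁ r - v₂ r| ≤ K * |α₁ - α₂| * r := by
  have hfp := hf.pos α hα
  have hHp := hq.Hinf_pos
  have hα0 := hf.b_pos.trans hα
  have hev : ∀ᶠ x in 𝓝 α, b < x ∧ |f x - f α| < Hinf / 4 * f α := by
    refine (lt_mem_nhds hα).and ?_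
    have : Tendsto (fun x => |f x - f α|) (𝓝 α) (𝓝 |f α - f α|) :=
      ((hf.hd α hα0).continuousAt.tendsto.sub_const _).abs
    refine this.eventually_lt_const ?_
    simp only [sub_self, abs_zero]
    positivity
  obtain ⟨θ, hθ, hball⟩ := Metric.eventually_nhds_iff.1 hev
  simp only [Real.dist_eq] at hball
  have hθb : ∀ x, |x - α| ≤ θ / 2 → b < x := fun x hx => (hball (by linarith)).1
  have hev2 : ∀ᶠ r in 𝓝[>] 0, |u r - α| < θ / 2 := by
    have : Tendsto (fun r => |u r - α|) (𝓝[>] 0) (𝓝 |α - α|) := (h.u0.sub_const _).abs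
    refine this.eventually_lt_const ?_
    simpa using half_pos hθ
  obtain ⟨R, hR, hR'⟩ := (mem_nhdsGT_iff_exists_Ioc_subset).1 hev2
  have hR0 : 0 < R := hR
  obtain ⟨K, hK, δ, hδ, hdep⟩ := h.exists_dependence hq hf (m := b) (M := α + θ / 2) hR0 hf.b_pos
    fun r hr => ⟨(hθb _ (le_of_lt (hR' hr))).le, by
      have h3 : |u r - α| < θ / 2 := hR' hr
      linarith [(abs_lt.1 h3).2]⟩
  have hKp : 0 < K := by linarith
  refine ⟨R, hR0, K, hK, min δ (θ / (2 * K)), lt_min hδ (by positivity), f α * Hinf / 2,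
    by positivity, 2 * f α, by positivity, ?_, ?_⟩
  · intro u₁ v₁ α₁ h1 hα1
    have hu1 : ∀ r ∈ Ioc 0 R, |u₁ r - α| < θ := by
      intro r hr
      have h3 := (hdep u₁ v₁ α₁ u v α h1 h (hα1.trans_le (min_le_left _ _)) (by simpa using hδ) r hr).1
      have h4 := hα1.trans_le (min_le_right δ (θ / (2 * K)))
      rw [lt_div_iff₀ (by positivity)] at h4
      have h5 : |u r - α| < θ / 2 := hR' hr
      have h6 := abs_sub_le (u₁ r) (u r) α
      linarith
    obtain ⟨h3, h4⟩ := h1.slope_bounds hq (R := R) hfp fun r hr => (hball (hu1 r hr)).2.le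
    exact fun r hr => ⟨(hball (hu1 r hr)).1, h3 r hr, (h4 r hr).1, (h4 r hr).2⟩
  · intro u₁ v₁ α₁ u₂ v₂ α₂ h1 h2 hα1 hα2
    exact hdep u₁ v₁ α₁ u₂ v₂ α₂ h1 h2 (hα1.trans_le (min_le_left _ _))
      (hα2.trans_le (min_le_left _ _))

end Origin

section InitialGap
variable {f q u v : ℝ → ℝ} {b β Hinf α : ℝ}

/-- Of two nearby solutions, the one with the larger initial value arrives at a given level with
a larger slope, by an amount controlled by the difference of the arrival radii. -/
theorem IsRadial.exists_initial_gap (hq : IsWeight q Hinf) (hf : IsNonlinearity f b β Hinf)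
    (h : IsRadial f q u v α) (hα : b < α) :
    ∃ r₀ > 0, ∃ κ > 0, ∃ δ > 0,
      (∀ u₁ v₁ α₁, IsRadial f q u₁ v₁ α₁ → |α₁ - α| < δ →
        ∀ r ∈ Ioc 0 r₀, 0 < u₁ r ∧ 0 < v₁ r) ∧
      ∀ u₁ v₁ α₁ u₂ v₂ α₂, IsRadial f q u₁ v₁ α₁ → IsRadial f q u₂ v₂ α₂ →
        |α₁ - α| < δ → |α₂ - α| < δ → α₁ < α₂ → u₂ r₀ < α₁ ∧
        ∀ r ∈ Ioo 0 r₀, u₁ r = u₂ r₀ → κ * (r₀ - r) ≤ q r * (v₂ r₀ ^ 2 - v₁ r ^ 2) := by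
  obtain ⟨R, hR, K, hK, δ, hδ, m, hm, A, hA, hbd, hdep⟩ := h.exists_bounds_near_origin hq hf hα
  have hKp : 0 < K := by linarith
  set r₀ := min (min R 1) (min (1 / (2 * K)) (m / (4 * A * K))) with hr₀
  have hr : 0 < r₀ := by
    refine lt_min (lt_min hR one_pos) (lt_min ?_ ?_) <;> positivity
  have hrR : r₀ ≤ R := (min_le_left _ _).trans (min_le_left _ _)
  have hr1 : r₀ ≤ 1 := (min_le_left _ _).trans (min_le_right _ _)
  have hrK : K * r₀ ^ 2 ≤ 1 / 2 := by
    have h1 : r₀ ≤ 1 / (2 * K) := (min_le_right _ _).trans (min_le_left _ _)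
    rw [le_div_iff₀ (by positivity)] at h1
    nlinarith [mul_nonneg hKp.le (mul_nonneg hr.le (sub_nonneg.2 hr1))]
  have hrA : 4 * A * K * r₀ ^ 2 ≤ m := by
    have h1 : r₀ ≤ m / (4 * A * K) := (min_le_right _ _).trans (min_le_right _ _)
    rw [le_div_iff₀ (by positivity)] at h1
    have h2 : 0 < 4 * A * K := by positivity
    nlinarith [mul_nonneg h2.le (mul_nonneg hr.le (sub_nonneg.2 hr1))]
  set δ' := min δ (m * r₀ ^ 2 / (8 * K)) with hδ'
  have hIoc : ∀ r ∈ Ioc 0 r₀, r ∈ Ioc 0 R := fun r hr => ⟨hr.1, hr.2.trans hrR⟩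
  have hsq : ∀ u₁ v₁ α₁, IsRadial f q u₁ v₁ α₁ → |α₁ - α| < δ' →
      AntitoneOn (fun r => u₁ r + m / 2 * r ^ 2) (Ioc 0 r₀) := by
    intro u₁ v₁ α₁ h1 hα1
    refine antitoneOn_of_hasDerivAt_nonpos (convex_Ioc _ _) (fun r hr => (h1.hu r hr.1).fun_add
      (((hasDerivAt_id r).fun_pow 2).const_mul (m / 2))) fun r hr => ?_
    have := (hbd u₁ v₁ α₁ h1 (hα1.trans_le (min_le_left _ _)) r (hIoc r hr)).2.2.1
    simp only [id, Nat.add_one_sub_one, pow_one]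
    push_cast
    linarith
  refine ⟨r₀, hr, q (r₀ / 2) * (m / 2) * (m * r₀), ?_, δ', lt_min hδ (by positivity), ?_, ?_⟩
  · have := hq.pos (r₀ / 2) (half_pos hr)
    positivity
  · intro u₁ v₁ α₁ h1 hα1 r hrI
    obtain ⟨h2, -, h3, -⟩ := hbd u₁ v₁ α₁ h1 (hα1.trans_le (min_le_left _ _)) r (hIoc r hrI)
    exact ⟨hf.b_pos.trans h2, (mul_pos hm hrI.1).trans_le h3⟩
  intro u₁ v₁ α₁ u₂ v₂ α₂ h1 h2 hα1 hα2 hlt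
  have hr₀I : r₀ ∈ Ioc 0 r₀ := ⟨hr, le_rfl⟩
  have hb1 := hbd u₁ v₁ α₁ h1 (hα1.trans_le (min_le_left _ _))
  have hpair := hdep u₁ v₁ α₁ u₂ v₂ α₂ h1 h2 (hα1.trans_le (min_le_left _ _))
    (hα2.trans_le (min_le_left _ _))
  have habs : |α₁ - α₂| = α₂ - α₁ := by rw [abs_sub_comm, abs_of_pos (sub_pos.2 hlt)]
  rw [habs] at hpair
  have hd : K * (α₂ - α₁) < m * r₀ ^ 2 / 4 := by
    have h3 := hα1.trans_le (min_le_right δ (m * r₀ ^ 2 / (8 * K)))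
    have h4 := hα2.trans_le (min_le_right δ (m * r₀ ^ 2 / (8 * K)))
    rw [lt_div_iff₀ (by positivity)] at h3 h4
    have h6 : α₂ - α₁ ≤ |α₂ - α| + |α₁ - α| := by
      linarith [le_abs_self (α₂ - α), neg_abs_le (α₁ - α)]
    have h7 := mul_le_mul_of_nonneg_left h6 hKp.le
    linarith
  have hd0 : 0 < α₂ - α₁ := sub_pos.2 hlt
  constructor
  · have hlim : Tendsto (fun r => u₂ r + m / 2 * r ^ 2) (𝓝[>] 0) (𝓝 α₂) := by
      have hid : Tendsto (fun r : ℝ => r) (𝓝[>] 0) (𝓝 0) := nhdsWithin_le_nhds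
      simpa using h2.u0.add ((hid.pow 2).const_mul (m / 2))
    have h3 := (hsq u₂ v₂ α₂ h2 hα2).le_of_tendsto_right hr₀I hlim
    nlinarith
  intro r hrI hrr
  have hrI' : r ∈ Ioc 0 r₀ := ⟨hrI.1, hrI.2.le⟩
  have hw : (α₂ - α₁) / 2 ≤ u₂ r₀ - u₁ r₀ := by
    have hmono : MonotoneOn (fun r => u₂ r - u₁ r + K * (α₂ - α₁) * r₀ * r) (Ioc 0 r₀) := by
      refine monotoneOn_of_hasDerivAt_nonneg (convex_Ioc _ _) (fun r hr =>
        ((h2.hu r hr.1).fun_sub (h1.hu r hr.1)).fun_add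
          ((hasDerivAt_id r).const_mul (K * (α₂ - α₁) * r₀))) fun r hr => ?_
      have h3 := (abs_le.1 (hpair r (hIoc r hr)).2).1
      have h4 := mul_le_mul_of_nonneg_left hr.2 (mul_pos hKp hd0).le
      linarith
    have hlim : Tendsto (fun r => u₂ r - u₁ r + K * (α₂ - α₁) * r₀ * r) (𝓝[>] 0)
        (𝓝 (α₂ - α₁)) := by
      have hid : Tendsto (fun r : ℝ => r) (𝓝[>] 0) (𝓝 0) := nhdsWithin_le_nhds
      simpa using (h2.u0.sub h1.u0).add (hid.const_mul (K * (α₂ - α₁) * r₀))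
    have h3 := hmono.ge_of_tendsto_right hr₀I hlim
    nlinarith [mul_le_mul_of_nonneg_left hrK hd0.le]
  have hdrop : u₁ r - u₁ r₀ ≤ A * r₀ * (r₀ - r) := by
    have hmono : MonotoneOn (fun r => u₁ r + A * r₀ * r) (Ioc 0 r₀) := by
      refine monotoneOn_of_hasDerivAt_nonneg (convex_Ioc _ _) (fun r hr =>
        (h1.hu r hr.1).fun_add ((hasDerivAt_id r).const_mul (A * r₀))) fun r hr => ?_
      have h3 := (hb1 r (hIoc r hr)).2.2.2
      have h4 := mul_le_mul_of_nonneg_left hr.2 hA.le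
      linarith
    have := hmono hrI' hr₀I hrI.2.le
    simp only at this
    linarith
  have hv₁ : m * (r₀ - r) ≤ v₁ r₀ - v₁ r := by
    have hmono : MonotoneOn (fun r => v₁ r - m * r) (Ioc 0 r₀) := by
      refine monotoneOn_of_hasDerivAt_nonneg (convex_Ioc _ _) (fun r hr =>
        (h1.hv r hr.1).fun_sub ((hasDerivAt_id r).const_mul m)) fun r hr => ?_
      have h3 := (hb1 r (hIoc r hr)).2.1
      linarith
    have := hmono hrI' hr₀I hrI.2.le
    simp only at this
    linarith
  have hrhalf : r₀ / 2 ≤ r := by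
    by_contra hcon
    have h3 := hsq u₁ v₁ α₁ h1 hα1 hrI' hr₀I hrI.2.le
    simp only at h3
    have h4 := (abs_le.1 (hpair r₀ (hIoc r₀ hr₀I)).1).1
    have h5 : r ^ 2 ≤ (r₀ / 2) ^ 2 := pow_le_pow_left₀ hrI.1.le (not_le.1 hcon).le 2
    have h6 := mul_le_mul_of_nonneg_left h5 hm.le
    have h7 : 0 < m * r₀ ^ 2 := by positivity
    nlinarith
  have hpos : 0 < r₀ - r := sub_pos.2 hrI.2
  have hv₂ : v₁ r₀ - m / 2 * (r₀ - r) ≤ v₂ r₀ := by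
    have h3 := (abs_le.1 (hpair r₀ (hIoc r₀ hr₀I)).2).2
    have h4 : α₂ - α₁ ≤ 2 * (A * r₀ * (r₀ - r)) := by linarith
    have h5 := mul_le_mul_of_nonneg_left h4 (mul_pos hKp hr).le
    have h6 := mul_le_mul_of_nonneg_right hrA hpos.le
    nlinarith
  have hdiff : m / 2 * (r₀ - r) ≤ v₂ r₀ - v₁ r := by linarith
  have hsum : m * r₀ ≤ v₂ r₀ + v₁ r := by
    have h3 := (hb1 r₀ (hIoc r₀ hr₀I)).2.2.1
    have h4 := (hb1 r (hIoc r hrI')).2.2.1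
    nlinarith
  have hprod : m / 2 * (r₀ - r) * (m * r₀) ≤ v₂ r₀ ^ 2 - v₁ r ^ 2 := by
    have := mul_le_mul hdiff hsum (by positivity) (le_trans (by positivity) hdiff)
    linarith
  have hqle : q (r₀ / 2) ≤ q r := hq.strictMono.monotoneOn (half_pos hr) hrI.1 hrhalf
  have := mul_le_mul hqle hprod (by positivity) (hq.pos r hrI.1).le
  linarith

end InitialGap

section Blowup
variable {f q u v ρ : ℝ → ℝ} {b β Hinf α r₀ : ℝ}

/-- Along a ground state the integral of `1 / (q u' ^ 2)` diverges. -/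
theorem IsDescending.exists_large_increment (hq : IsWeight q Hinf)
    (hf : IsNonlinearity f b β Hinf) (h : IsDescending f q u v 0 α ρ)
    (hv : Tendsto v (leftFilter (Z1 u)) (𝓝 0)) (M : ℝ) (hr : 0 < r₀)
    (hrZ : (r₀ : EReal) < Z1 u) :
    ∃ r₁ r₂ : ℝ, ∃ A A' : ℝ → ℝ, r₀ ≤ r₁ ∧ r₁ < r₂ ∧ (r₂ : EReal) < Z1 u ∧
      (∀ r ∈ Icc r₁ r₂, HasDerivAt A (A' r) r ∧ A' r * (q r * v r ^ 2) ≤ 1) ∧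
      M < A r₂ - A r₁ := by
  have hpos : ∀ r : ℝ, 0 < r → (r : EReal) < Z1 u → 0 < u r ∧ 0 < v r := fun r hr hrz =>
    h.radial.pos hr hrz
  have hub : ∀ᶠ r in leftFilter (Z1 u), u r < b := h.tendsto_u.eventually_lt_const hf.b_pos
  by_cases hZ : Z1 u = ⊤
  · rw [hZ, leftFilter, if_pos rfl] at hub
    obtain ⟨x, hx⟩ := eventually_atTop.1 hub
    have hlt : ∀ r : ℝ, (r : EReal) < Z1 u := fun r => hZ ▸ EReal.coe_lt_top r
    set r₁ := max r₀ x with hr₁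
    have hr₁p : 0 < r₁ := hr.trans_le (le_max_left _ _)
    have hA : ∀ r : ℝ, 0 < r → 0 < q r * (u r * v r) := fun r hr' =>
      mul_pos (hq.pos r hr') (mul_pos (hpos r hr' (hlt r)).1 (hpos r hr' (hlt r)).2)
    have hB := hA r₁ hr₁p
    set B := q r₁ * (u r₁ * v r₁) with hBdef
    refine ⟨r₁, r₁ + (|M| + B + 1), fun r => 2 * r + q r * (u r * v r),
      fun r => 2 + q r * (u r * f (u r) - v r ^ 2), le_max_left _ _, ?_, hlt _, ?_, ?_⟩
    · have := abs_nonneg M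
      linarith
    · intro r hrI
      have hrp : 0 < r := hr₁p.trans_le hrI.1
      have hqr := hq.pos r hrp
      have hub' : u r ≤ b := (hx r ((le_max_right _ _).trans hrI.1)).le
      have hup := (hpos r hrp (hlt r)).1
      refine ⟨(((hasDerivAt_id r).const_mul 2).add ((hq.hd r hrp).mul
        ((h.radial.hu r hrp).mul (h.radial.hv r hrp)))).congr_deriv ?_, ?_⟩
      · simp only [Pi.mul_apply]
        field_simp
        ring
      · have h3 : q r * (u r * f (u r)) ≤ 0 :=
          mul_nonpos_of_nonneg_of_nonpos hqr.le
            (mul_nonpos_of_nonneg_of_nonpos hup.le (hf.nonpos _ hup hub'))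
        have hy : 0 ≤ q r * v r ^ 2 := mul_nonneg hqr.le (sq_nonneg _)
        nlinarith [mul_nonneg (neg_nonneg.2 h3) hy, sq_nonneg (q r * v r ^ 2 - 1)]
    · have := abs_nonneg M
      have h3 := hA (r₁ + (|M| + B + 1)) (by linarith)
      have := le_abs_self M
      simp only
      linarith
  · obtain ⟨z, hz⟩ : ∃ z : ℝ, Z1 u = z := by
      lift Z1 u to ℝ using ⟨hZ, (bot_le.trans_lt h.Z1_pos).ne'⟩ with z
      exact ⟨z, rfl⟩
    have hlf : leftFilter (Z1 u) = 𝓝[<] z := by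
      rw [hz, leftFilter, if_neg (EReal.coe_ne_top z), EReal.toReal_coe]
    have hrz : r₀ < z := by rw [hz] at hrZ; exact_mod_cast hrZ
    have hlt : ∀ r : ℝ, r < z → (r : EReal) < Z1 u := fun r hr => by rw [hz]; exact_mod_cast hr
    rw [hlf] at hub hv
    obtain ⟨C, hC, hfC⟩ := hf.bdd
    obtain ⟨x, hxz, hx⟩ := (mem_nhdsLT_iff_exists_Ioo_subset' hrz).1
      (hub.and (hv.eventually_lt_const one_pos))
    have hxz' : x < z := hxz
    obtain ⟨r₁, hr₁, hr₁z⟩ := exists_between (max_lt hrz hxz')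
    have hr₀₁ : r₀ < r₁ := (le_max_left _ _).trans_lt hr₁
    have hr₁p : 0 < r₁ := hr.trans hr₀₁
    have hg : 0 < deriv q r₀ / q r₀ := div_pos (hq.dpos r₀ hr) (hq.pos r₀ hr)
    set g := deriv q r₀ / q r₀ with hgdef
    have hqz := hq.pos z (hr.trans hrz)
    set k := 1 / (q z * (g + C)) with hk
    have hkp : 0 < k := by positivity
    have hv₁ := (hpos r₁ hr₁p (hlt r₁ hr₁z)).2
    have hkv : 0 < k / v r₁ := div_pos hkp hv₁
    have hη : 0 < |M| + k / v r₁ + 1 := by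
      have := abs_nonneg M
      linarith
    obtain ⟨r₂, hr₂v, hr₂⟩ := ((hv.eventually_lt_const (div_pos hkp hη)).and
      (Ioo_mem_nhdsLT hr₁z)).exists
    refine ⟨r₁, r₂, fun r => k / v r, fun r => k * (deriv q r / q r * v r - f (u r)) / v r ^ 2,
      hr₀₁.le, hr₂.1, hlt r₂ hr₂.2, ?_, ?_⟩
    · intro r hrI
      have hrp : 0 < r := hr₁p.trans_le hrI.1
      have hrz' : r < z := hrI.2.trans_lt hr₂.2
      obtain ⟨hup, hvp⟩ := hpos r hrp (hlt r hrz')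
      have hqr := hq.pos r hrp
      obtain ⟨hub', hv1⟩ := hx ⟨(le_max_right _ _).trans_lt (hr₁.trans_le hrI.1), hrz'⟩
      have hub'' : u r < b := hub'
      have hv1' : v r < 1 := hv1
      constructor
      · refine ((hasDerivAt_const r k).fun_div (h.radial.hv r hrp) hvp.ne').congr_deriv ?_
        ring
      · have e : k * (deriv q r / q r * v r - f (u r)) / v r ^ 2 * (q r * v r ^ 2) =
            k * (q r * (deriv q r / q r * v r - f (u r))) := by
          field_simp
        rw [e]
        have h3 : deriv q r / q r ≤ g :=
          hq.anti.antitoneOn hr hrp (hr₀₁.le.trans hrI.1)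
        have h4 : deriv q r / q r * v r ≤ g * 1 := mul_le_mul h3 hv1'.le hvp.le hg.le
        have h5 := hfC (u r) hup hub''.le
        have h6 : q r ≤ q z := hq.strictMono.monotoneOn hrp (hr.trans hrz) hrz'.le
        have h7 : q r * (deriv q r / q r * v r - f (u r)) ≤ q z * (g + C) :=
          (mul_le_mul_of_nonneg_left (by linarith) hqr.le).trans
            (mul_le_mul_of_nonneg_right h6 (by linarith))
        refine (mul_le_mul_of_nonneg_left h7 hkp.le).trans (le_of_eq ?_)
        rw [hk]
        field_simp
    · have hv₂ := (hpos r₂ (hr₁p.trans hr₂.1) (hlt r₂ hr₂.2)).2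
      rw [lt_div_iff₀ hη, mul_comm, ← lt_div_iff₀ hv₂] at hr₂v
      have := le_abs_self M
      simp only
      linarith

end Blowup

section Order
variable {f q ρ₁ p₁ ρ₂ p₂ A A' : ℝ → ℝ} {Hinf σ₁ σ₂ α₁ α₂ s s₁ s₀ κ : ℝ}

theorem not_radius_lt_of_large_increment (hq : IsWeight q Hinf) (h1 : IsProfile f q σ₁ α₁ ρ₁ p₁)
    (h2 : IsProfile f q σ₂ α₂ ρ₂ p₂) (hα : α₁ < α₂) (hs1 : σ₁ < s) (hs2 : σ₂ < s) (hss : s < s₁)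
    (hs₀ : s₁ ≤ s₀) (hs₀α : s₀ < α₁) (hκ : 0 < κ)
    (hgap : κ * (ρ₂ s₀ - ρ₁ s₀) ≤ q (ρ₁ s₀) * (p₂ s₀ ^ 2 - p₁ s₀ ^ 2))
    (hA : ∀ t ∈ Icc s s₁, HasDerivAt A (A' (ρ₂ t)) (ρ₂ t) ∧
      A' (ρ₂ t) * (q (ρ₂ t) * p₂ t ^ 2) ≤ 2)
    (hinc : 4 / κ < A (ρ₂ s) - A (ρ₂ s₁)) : ¬ ∀ t ∈ Ico s α₁, ρ₁ t < ρ₂ t := by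
  intro hlt
  have hp := slope_lt_of_radius_le hq h1 h2 hα hs1 hs2 fun t ht => (hlt t ht).le
  have hanti := gap_antitone hq h1 h2 hα hs1 hs2 fun t ht => (hlt t ht).le
  have hs₀I : s₀ ∈ Ico s α₁ := ⟨hss.le.trans hs₀, hs₀α⟩
  have hD := radius_lt_of_slope_lt h1 h2 hα hs1 hs2 hs₀α fun x hx =>
    hp x ⟨hx.1.le, hx.2.trans hs₀α⟩
  set C := κ * (ρ₂ s₀ - ρ₁ s₀) with hC
  have hCp : 0 < C := mul_pos hκ (sub_pos.2 (hlt s₀ hs₀I))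
  have hI : ∀ t ∈ Icc s s₁, t ∈ Ico s α₁ := fun t ht =>
    ⟨ht.1, ht.2.trans_lt (hs₀.trans_lt hs₀α)⟩
  have hI1 : ∀ t ∈ Icc s s₁, t ∈ Ioo σ₁ α₁ := fun t ht => ⟨hs1.trans_le ht.1, (hI t ht).2⟩
  have hI2 : ∀ t ∈ Icc s s₁, t ∈ Ioo σ₂ α₂ := fun t ht =>
    ⟨hs2.trans_le ht.1, (hI t ht).2.trans hα⟩
  have hmono : MonotoneOn (fun t => ρ₂ t - ρ₁ t + C / 4 * A (ρ₂ t)) (Icc s s₁) := by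
    refine monotoneOn_of_hasDerivAt_nonneg (convex_Icc _ _) (fun t ht =>
      ((h2.hr t (hI2 t ht)).fun_sub (h1.hr t (hI1 t ht))).fun_add
        ((h2.hasDerivAt_comp (hI2 t ht) (hA t ht).1).const_mul (C / 4))) fun t ht => ?_
    have hp1 := h1.ppos t (hI1 t ht)
    have hp2 := h2.ppos t (hI2 t ht)
    have hr1 := h1.rpos t (hI1 t ht)
    have hr2 := h2.rpos t (hI2 t ht)
    have hq1 := hq.pos _ hr1
    have hq2 := hq.pos _ hr2
    have hpt := hp t (hI t ht)
    have hqle : q (ρ₁ t) ≤ q (ρ₂ t) := hq.strictMono.monotoneOn hr1 hr2 (hlt t (hI t ht)).le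
    have hCle : C ≤ (p₂ t ^ 2 - p₁ t ^ 2) * q (ρ₁ t) := by
      have := hanti (hI t ht) hs₀I (ht.2.trans hs₀)
      simp only at this
      linarith
    have hAt := (hA t ht).2
    have hy : 0 < q (ρ₂ t) * p₂ t ^ 2 := by positivity
    have h3 : C / 4 * A' (ρ₂ t) ≤ C / (2 * (q (ρ₂ t) * p₂ t ^ 2)) := by
      rw [le_div_iff₀ (by positivity)]
      nlinarith [mul_le_mul_of_nonneg_left hAt hCp.le]
    have h4 : C / (2 * (q (ρ₂ t) * p₂ t ^ 2)) ≤ (p₂ t - p₁ t) / p₁ t := by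
      rw [div_le_div_iff₀ (by positivity) hp1]
      have h5 : 0 ≤ p₂ t - p₁ t := (sub_pos.2 hpt).le
      have h6 : C ≤ (p₂ t - p₁ t) * (2 * p₂ t) * q (ρ₂ t) := by
        refine hCle.trans ?_
        refine mul_le_mul ?_ hqle hq1.le (by positivity)
        nlinarith
      have h7 := mul_le_mul h6 hpt.le hp1.le (by positivity)
      linarith
    have h5 : -1 / p₂ t - -1 / p₁ t + C / 4 * (A' (ρ₂ t) * (-1 / p₂ t)) =
        ((p₂ t - p₁ t) / p₁ t - C / 4 * A' (ρ₂ t)) / p₂ t := by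
      field_simp
      ring
    rw [h5]
    exact div_nonneg (by linarith) hp2.le
  have h3 := hmono ⟨le_rfl, hss.le⟩ ⟨hss.le, le_rfl⟩ hss.le
  have h4 := hD.monotoneOn ⟨hss.le, hs₀⟩ ⟨hss.le.trans hs₀, le_rfl⟩ hs₀
  simp only at h3 h4
  have h5 := hlt s ⟨le_rfl, hss.trans_le hs₀ |>.trans hs₀α⟩
  have h6 : C / 4 * (4 / κ) < C / 4 * (A (ρ₂ s) - A (ρ₂ s₁)) :=
    mul_lt_mul_of_pos_left hinc (by positivity)
  have h7 : C / 4 * (4 / κ) = ρ₂ s₀ - ρ₁ s₀ := by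
    rw [hC]
    field_simp
  linarith

end Order

theorem IsProfile.ρ_strictAntiOn {f q ρ p : ℝ → ℝ} {σ α : ℝ} (h : IsProfile f q σ α ρ p) :
    StrictAntiOn ρ (Ioo σ α) :=
  strictAntiOn_of_hasDerivAt_neg (convex_Ioo _ _) h.hr fun s hs =>
    div_neg_of_neg_of_pos (by norm_num) (h.ppos s hs)

/-- Near the initial value of a ground state, solutions with different initial values cross before
the one starting lower reaches zero. -/
theorem IsDescending.exists_crossing_radius {f q u v ρ : ℝ → ℝ} {b β Hinf α : ℝ}
    (hq : IsWeight q Hinf) (hf : IsNonlinearity f b β Hinf) (h : IsDescending f q u v 0 α ρ)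
    (hα : b < α) (hv : Tendsto v (leftFilter (Z1 u)) (𝓝 0)) :
    ∃ δ > 0, ∀ u₁ v₁ ρ₁ α₁ u₂ v₂ ρ₂ σ₂ α₂, IsDescending f q u₁ v₁ 0 α₁ ρ₁ →
      IsDescending f q u₂ v₂ σ₂ α₂ ρ₂ → |α₁ - α| < δ → |α₂ - α| < δ → α₁ < α₂ →
      ∃ x ∈ Ioo σ₂ α₁, ρ₂ x ≤ ρ₁ x := by
  obtain ⟨r₀, hr₀, κ, hκ, δ₀, hδ₀, hpos, hgap⟩ := h.radial.exists_initial_gap hq hf hα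
  have hr₀Z : (r₀ : EReal) < Z1 u := h.radial.lt_Z1 hr₀ fun s hs hsr =>
    hpos u v α h.radial (by simpa using hδ₀) s ⟨hs, hsr⟩
  obtain ⟨r₁, r₂, A, A', hr₀₁, hr₁₂, hr₂Z, hA, hinc⟩ :=
    h.exists_large_increment hq hf hv (4 / κ) hr₀ hr₀Z
  have hr₁ : 0 < r₁ := hr₀.trans_le hr₀₁
  have hr₂ : 0 < r₂ := hr₁.trans hr₁₂
  have hZ : ∀ r ∈ Ioc 0 r₂, (r : EReal) < Z1 u := fun r hr =>
    lt_of_le_of_lt (by exact_mod_cast hr.2) hr₂Z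
  have hm : 0 < u r₂ := (h.radial.pos hr₂ hr₂Z).1
  have hanti : AntitoneOn u (Ioc 0 r₂) := antitoneOn_of_hasDerivAt_nonpos (convex_Ioc _ _)
    (fun r hr => h.radial.hu r hr.1) fun r hr =>
      neg_nonpos.2 (h.radial.pos hr.1 (hZ r hr)).2.le
  obtain ⟨K, hK, δ₁, hδ₁, hdep⟩ := h.radial.exists_dependence hq hf (M := α) hr₂ hm fun r hr =>
    ⟨hanti hr ⟨hr₂, le_rfl⟩ hr.2, (h.descent.left r hr.1 (hZ r hr)).1.2.le⟩
  have hKp : 0 < K := by linarith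
  have hsub : ∀ r ∈ Icc r₀ r₂, r ∈ Ioc 0 r₂ := fun r hr => ⟨hr₀.trans_le hr.1, hr.2⟩
  obtain ⟨y, hy, hymin⟩ := (isCompact_Icc (a := r₀) (b := r₂)).exists_isMinOn
    ⟨r₀, le_rfl, hr₀₁.trans hr₁₂.le⟩
    fun r hr => (h.radial.hv r (hsub r hr).1).continuousAt.continuousWithinAt
  have hμ : 0 < v y := (h.radial.pos (hsub y hy).1 (hZ y (hsub y hy))).2
  have hμle : ∀ r ∈ Icc r₀ r₂, v y ≤ v r := fun r hr => hymin hr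
  set δ := min (min δ₀ δ₁) (min (u r₂ / (2 * K)) (v y / (4 * K * r₂))) with hδ
  have hδpos : 0 < δ := lt_min (lt_min hδ₀ hδ₁) (lt_min (by positivity) (by positivity))
  have hclose : ∀ w z α', IsRadial f q w z α' → |α' - α| < δ →
      (r₂ : EReal) < Z1 w ∧ ∀ r ∈ Icc r₀ r₂, z r ^ 2 ≤ 2 * v r ^ 2 := by
    intro w z α' hw hα'
    have hd0 := hα'.trans_le ((min_le_left _ _).trans (min_le_left _ _))
    have hd1 := hα'.trans_le ((min_le_left _ _).trans (min_le_right _ _))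
    have hd2 := hα'.trans_le ((min_le_right _ _).trans (min_le_left _ _))
    have hd3 := hα'.trans_le ((min_le_right _ _).trans (min_le_right _ _))
    rw [lt_div_iff₀ (by positivity)] at hd2 hd3
    have hdw := hdep w z α' u v α hw h.radial hd1 (by simpa using hδ₁)
    have hz : ∀ r ∈ Icc r₀ r₂, |z r - v r| ≤ v r / 4 := by
      intro r hr
      have h3 := (hdw r (hsub r hr)).2
      have h4 := mul_le_mul_of_nonneg_left hr.2 (mul_nonneg hKp.le (abs_nonneg (α' - α)))
      have h5 := hμle r hr
      linarith
    have hvpos : ∀ r ∈ Icc r₀ r₂, 0 < v r := fun r hr => hμ.trans_le (hμle r hr)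
    constructor
    · refine hw.lt_Z1 hr₂ fun s hs hsr => ?_
      rcases le_total s r₀ with hs₀ | hs₀
      · exact hpos w z α' hw hd0 s ⟨hs, hs₀⟩
      · have h3 := (abs_le.1 (hdw s ⟨hs, hsr⟩).1).1
        have h4 := (abs_le.1 (hz s ⟨hs₀, hsr⟩)).1
        have h5 := hvpos s ⟨hs₀, hsr⟩
        have h6 := hanti ⟨hs, hsr⟩ ⟨hr₂, le_rfl⟩ hsr
        constructor <;> linarith
    · intro r hr
      have h3 := abs_le.1 (hz r hr)
      have h4 := hvpos r hr
      nlinarith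
  refine ⟨δ, hδpos, ?_⟩
  intro u₁ v₁ ρ₁ α₁ u₂ v₂ ρ₂ σ₂ α₂ h1 h2 hα1 hα2 hlt
  by_contra! hcon
  obtain ⟨hZ₂, hsq⟩ := hclose u₂ v₂ α₂ h2.radial hα2
  obtain ⟨hs₀α, hgap'⟩ := hgap u₁ v₁ α₁ u₂ v₂ α₂ h1.radial h2.radial
    (hα1.trans_le ((min_le_left _ _).trans (min_le_left _ _)))
    (hα2.trans_le ((min_le_left _ _).trans (min_le_left _ _))) hlt
  have hleft : ∀ r ∈ Ioc 0 r₂, u₂ r ∈ Ioo σ₂ α₂ ∧ ρ₂ (u₂ r) = r := fun r hr =>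
    h2.descent.left r hr.1 (lt_of_le_of_lt (by exact_mod_cast hr.2) hZ₂)
  obtain ⟨hI0, he0⟩ := hleft r₀ ⟨hr₀, hr₀₁.trans hr₁₂.le⟩
  obtain ⟨hI1, he1⟩ := hleft r₁ ⟨hr₁, hr₁₂.le⟩
  obtain ⟨hI2, he2⟩ := hleft r₂ ⟨hr₂, le_rfl⟩
  have hρ := h2.profile.ρ_strictAntiOn
  have hs21 : u₂ r₂ < u₂ r₁ := (hρ.lt_iff_gt hI1 hI2).1 (by rwa [he1, he2])
  have hs10 : u₂ r₁ ≤ u₂ r₀ := (hρ.le_iff_ge hI0 hI1).1 (by rwa [he0, he1])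
  have hσ₂ := h2.profile.nonneg
  have hs₀I : u₂ r₀ ∈ Ioo 0 α₁ := ⟨hσ₂.trans_lt hI0.1, hs₀α⟩
  obtain ⟨hR0, -, hR⟩ := h1.descent.right _ hs₀I
  have hRlt : ρ₁ (u₂ r₀) < r₀ := (hcon _ ⟨hI0.1, hs₀α⟩).trans_eq he0
  refine not_radius_lt_of_large_increment (A := A) (A' := A') hq h1.profile h2.profile hlt
    (hσ₂.trans_lt hI2.1) hI2.1 hs21 hs10 hs₀α hκ ?_ ?_ ?_
    fun t ht => hcon t ⟨hI2.1.trans_le ht.1, ht.2⟩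
  · simp only [he0]
    exact hgap' _ ⟨hR0, hRlt⟩ hR
  · intro t ht
    have htI : t ∈ Ioo σ₂ α₂ := ⟨hI2.1.trans_le ht.1, ht.2.trans_lt hI1.2⟩
    have hρt : ρ₂ t ∈ Icc r₁ r₂ := by
      have h3 := hρ.antitoneOn htI hI1 ht.2
      have h4 := hρ.antitoneOn hI2 htI ht.1
      rw [he1] at h3
      rw [he2] at h4
      exact ⟨h3, h4⟩
    obtain ⟨hd, hle⟩ := hA _ hρt
    refine ⟨hd, ?_⟩
    have hqp := hq.pos _ (hr₁.trans_le hρt.1)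
    have h3 := hsq _ ⟨hr₀₁.trans hρt.1, hρt.2⟩
    rcases le_total (A' (ρ₂ t)) 0 with hneg | hnn
    · have := mul_nonpos_of_nonpos_of_nonneg hneg (mul_nonneg hqp.le (sq_nonneg (v₂ (ρ₂ t))))
      linarith
    · have := mul_le_mul_of_nonneg_left h3 (mul_nonneg hnn hqp.le)
      linarith
  · rwa [he1, he2]

/-- the separation property near a ground state initial value. -/
theorem separation_near_ground_state
    (c : EReal) (f q : ℝ → ℝ) (b β Hinf : ℝ) (hc : 0 < c)
    (hf1 : CondF1 c f b β) (hf2 : CondF2 c f)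
    (hq1 : CondQ1 q) (hq2 : CondQ2 q) (hq3 : CondQ3 q Hinf)
    (hf3 : CondF3 c f β Hinf)
    (fam : ℝ → ℝ → ℝ)
    (hfam : ∀ α : ℝ, b < α → IsSolutionE c f q (fam α) ∧ fam α 0 = α ∧
      (∀ r₀ : ℝ, 0 < r₀ → fam α r₀ = 0 → deriv (fam α) r₀ = 0 →
        ∀ r : ℝ, r₀ ≤ r → fam α r = 0))
    (αstar : ℝ) (hstar : MemG1 b fam αstar) :
    ∃ δ : ℝ, 0 < δ ∧ ∀ α₁ α₂ : ℝ,
      α₁ ∈ Ioo (αstar - δ) (αstar + δ) → α₂ ∈ Ioo (αstar - δ) (αstar + δ) →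
      b < α₁ → α₁ < α₂ →
      ((MemG1 b fam α₁ ∨ MemN1 b fam α₁) →
        MemN1 b fam α₂ ∧ Z1 (fam α₂) < Z1 (fam α₁) ∧
        ∃ L₁ L₂ : ℝ,
          Tendsto (deriv (fam α₁)) (leftFilter (Z1 (fam α₁))) (nhds L₁) ∧
          Tendsto (deriv (fam α₂)) (leftFilter (Z1 (fam α₂))) (nhds L₂) ∧
          |L₁| < |L₂|) ∧
      (MemG1 b fam α₂ → MemP1 b fam α₁) := by
  obtain rfl : c = ⊤ := by
    by_contra hne
    lift c to ℝ using ⟨hne, (bot_le.trans_lt hc).ne'⟩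
    have hbc : b < c := by
      have h1 : β < c := by exact_mod_cast hf1.2.2.2.2.1
      exact hf1.2.2.2.1.trans h1
    obtain ⟨hsol, h0, -⟩ := hfam c hbc
    have h1 := (hsol.mem 0 le_rfl).2
    rw [h0] at h1
    exact lt_irrefl _ h1
  have hq := isWeight_of_cond hq1 hq2 hq3
  have hf := isNonlinearity_of_cond hf1 hf2 hf3
  have hrad : ∀ α, b < α → IsRadial f q (fam α) (fun r => -deriv (fam α) r) α := fun α hα =>
    (hfam α hα).1.isRadial hq hf (hfam α hα).2.1 hα
  obtain ⟨hαb, hu0, hv0⟩ := hstar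
  obtain ⟨σ, ρ, hdesc⟩ := (hrad αstar hαb).exists_descending hq hf hαb
  obtain rfl := hdesc.eq_zero_of_tendsto hu0
  obtain ⟨δ, hδ, hcross⟩ := hdesc.exists_crossing_radius hq hf hαb (by simpa using hv0.neg)
  have hsep : ∀ α₁ α₂ : ℝ, |α₁ - αstar| < δ → |α₂ - αstar| < δ → b < α₁ → α₁ < α₂ →
      (MemG1 b fam α₁ ∨ MemN1 b fam α₁) →
        MemN1 b fam α₂ ∧ Z1 (fam α₂) < Z1 (fam α₁) ∧
        ∃ L₁ L₂ : ℝ,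
          Tendsto (deriv (fam α₁)) (leftFilter (Z1 (fam α₁))) (nhds L₁) ∧
          Tendsto (deriv (fam α₂)) (leftFilter (Z1 (fam α₂))) (nhds L₂) ∧
          |L₁| < |L₂| := by
    intro α₁ α₂ hα1 hα2 hb1 hlt hmem
    have hb2 := hb1.trans hlt
    have hu1 : Tendsto (fam α₁) (leftFilter (Z1 (fam α₁))) (𝓝 0) := by
      rcases hmem with hG | hN
      · exact hG.2.1
      · obtain ⟨-, L, -, hL, -⟩ := hN
        exact hL
    obtain ⟨σ₁, ρ₁, h1⟩ := (hrad α₁ hb1).exists_descending hq hf hb1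
    obtain ⟨σ₂, ρ₂, h2⟩ := (hrad α₂ hb2).exists_descending hq hf hb2
    obtain rfl := h1.eq_zero_of_tendsto hu1
    obtain ⟨x, hx, hle⟩ := hcross _ _ _ _ _ _ _ _ _ h1 h2 hα1 hα2 hlt
    obtain ⟨rfl, hZ, ℓ₁, ℓ₂, hℓ₁, hℓ, ht1, ht2⟩ := separation_of_crossing hq hf h1 h2 hlt hx hle
    refine ⟨⟨hb2, -ℓ₂, by linarith, h2.tendsto_u, ht2⟩, hZ, -ℓ₁, -ℓ₂, ht1, ht2, ?_⟩
    rwa [abs_neg, abs_neg, abs_of_nonneg hℓ₁, abs_of_nonneg (hℓ₁.trans hℓ.le)]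
  refine ⟨δ, hδ, fun α₁ α₂ hα1 hα2 hb1 hlt => ?_⟩
  have hα1' : |α₁ - αstar| < δ := abs_lt.2 ⟨by linarith [hα1.1], by linarith [hα1.2]⟩
  have hα2' : |α₂ - αstar| < δ := abs_lt.2 ⟨by linarith [hα2.1], by linarith [hα2.2]⟩
  refine ⟨hsep α₁ α₂ hα1' hα2' hb1 hlt, fun hG => ?_⟩
  obtain ⟨σ₁, ρ₁, h1⟩ := (hrad α₁ hb1).exists_descending hq hf hb1
  rcases h1.profile.nonneg.eq_or_lt with rfl | hσ
  · exfalso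
    obtain ⟨ℓ, hℓ, hp, -⟩ := h1.profile.exists_tendsto hq hf
    have hd := h1.tendsto_deriv hp
    have hmem : MemG1 b fam α₁ ∨ MemN1 b fam α₁ := by
      rcases hℓ.eq_or_lt with rfl | hℓ
      · exact Or.inl ⟨hb1, h1.tendsto_u, by simpa using hd⟩
      · exact Or.inr ⟨hb1, -ℓ, neg_neg_of_pos hℓ, h1.tendsto_u, hd⟩
    obtain ⟨⟨-, L, hL, -, hLt⟩, -⟩ := hsep α₁ α₂ hα1' hα2' hb1 hlt hmem
    exact hL.ne (tendsto_nhds_unique hLt hG.2.2)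
  · exact ⟨hb1, σ₁, hσ, h1.tendsto_u⟩
end
end

section
/- Assume f satisfies (f1), (f2) and q satisfies (q1), (q2), (q4). Let u be a solution of (E) with u(0) = α > b such that u > 0 and u′ < 0 on (0,Z) for some Z ∈ (0,∞], and u(r) → 0 as r → Z⁻; let R_b ∈ (0,Z) be the point with u(R_b) = b. Then the function v(r) := h(r)·u′(r) + u(r) satisfies v′(r) = −h(r)·f(u(r)) for all r ∈ (0,Z), and v(R_b) = h(R_b)·u′(R_b) + u(R_b) < 0. -/
open Set Filter MeasureTheory Topology

noncomputable section

lemma CondQ1.differentiableAt {q : ℝ → ℝ} (hq : CondQ1 q) {r : ℝ} (hr : 0 < r) :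
    DifferentiableAt ℝ q r :=
  (hq.1.contDiffAt (Ioi_mem_nhds hr)).differentiableAt one_ne_zero

lemma CondQ1.continuousAt_one_div {q : ℝ → ℝ} (hq : CondQ1 q) {r : ℝ} (hr : 0 < r) :
    ContinuousAt (fun s => 1 / q s) r :=
  continuousAt_const.div (hq.differentiableAt hr).continuousAt (hq.2.1 r hr).1.ne'

lemma CondQ1.intervalIntegrable_one_div {q : ℝ → ℝ} (hq : CondQ1 q) {a r : ℝ}
    (ha : 0 < a) (hr : 0 < r) : IntervalIntegrable (fun s => 1 / q s) volume a r := by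
  refine ContinuousOn.intervalIntegrable fun x hx => ?_
  have hx0 : 0 < x := (lt_min ha hr).trans_le hx.1
  exact (hq.continuousAt_one_div hx0).continuousWithinAt

lemma hasDerivAt_integral_Ioi_one_div {q : ℝ → ℝ} (hq : CondQ1 q)
    (hint : IntegrableOn (fun r => 1 / q r) (Ioi (1:ℝ))) {r : ℝ} (hr : 0 < r) :
    HasDerivAt (fun t => ∫ s in Ioi t, 1 / q s) (-(1 / q r)) r := by
  have hmeas : StronglyMeasurableAtFilter (fun s => 1 / q s) (𝓝 r) :=
    ContinuousOn.stronglyMeasurableAtFilter isOpen_Ioi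
      (fun x hx => (hq.continuousAt_one_div hx).continuousWithinAt) r hr
  have h := (intervalIntegral.integral_hasDerivAt_left
    (hq.intervalIntegrable_one_div hr one_pos) hmeas (hq.continuousAt_one_div hr)).add_const
      (∫ s in Ioi (1:ℝ), 1 / q s)
  refine h.congr_of_eventuallyEq ?_
  filter_upwards [Ioi_mem_nhds hr] with t ht
  exact (intervalIntegral.integral_interval_add_Ioi'
    (hq.intervalIntegrable_one_div ht one_pos) hint).symm

/-- `h' = (q'/q) h - 1`. -/
lemma hasDerivAt_hfun {q : ℝ → ℝ} (hq : CondQ1 q)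
    (hint : IntegrableOn (fun r => 1 / q r) (Ioi (1:ℝ))) {r : ℝ} (hr : 0 < r) :
    HasDerivAt (hfun q) (deriv q r / q r * hfun q r - 1) r := by
  have h := (hq.differentiableAt hr).hasDerivAt.mul (hasDerivAt_integral_Ioi_one_div hq hint hr)
  have hne := (hq.2.1 r hr).1.ne'
  refine h.congr_deriv ?_
  unfold hfun
  field_simp
  ring

lemma hfun_pos {q : ℝ → ℝ} {linf : ℝ} (hq : CondQ1 q) (hq4 : CondQ4 q linf) {r : ℝ}
    (hr : 0 < r) : 0 < hfun q r := by
  have h := hq4.2.2.1 r hr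
  rw [(hasDerivAt_hfun hq hq4.1 hr).deriv] at h
  have hpos : 0 < deriv q r / q r := div_pos (hq.2.1 r hr).2 (hq.2.1 r hr).1
  exact pos_of_mul_pos_right (by linarith) hpos.le

lemma IsSolutionE.differentiableAt {c : EReal} {f q u : ℝ → ℝ} (hu : IsSolutionE c f q u)
    {r : ℝ} (hr : 0 < r) : DifferentiableAt ℝ u r :=
  (hu.c1.contDiffAt (Ici_mem_nhds hr)).differentiableAt one_ne_zero

/-- Along a solution, `v = h u' + u` satisfies `v' = -h f(u)`. -/
lemma IsSolutionE.hasDerivAt_hfun_mul_deriv_add {c : EReal} {f q u : ℝ → ℝ}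
    (hu : IsSolutionE c f q u) (hq : CondQ1 q)
    (hint : IntegrableOn (fun r => 1 / q r) (Ioi (1:ℝ))) {r : ℝ} (hr : 0 < r) :
    HasDerivAt (fun t => hfun q t * deriv u t + u t) (-(hfun q r * f (u r))) r := by
  have h := ((hasDerivAt_hfun hq hint hr).mul (hu.diff2 r hr).hasDerivAt).add
    (hu.differentiableAt hr).hasDerivAt
  refine h.congr_deriv ?_
  linear_combination hfun q r * hu.ode r hr

lemma leftFilter_neBot_s19 (Z : EReal) : (leftFilter Z).NeBot := by
  unfold leftFilter
  split_ifs <;> infer_instance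

lemma eventually_leftFilter_mem {Z : EReal} {a : ℝ} (ha : (a : EReal) < Z) :
    ∀ᶠ r : ℝ in leftFilter Z, a < r ∧ (r : EReal) < Z := by
  unfold leftFilter
  split_ifs with h
  · subst h
    filter_upwards [eventually_gt_atTop a] with r hr
    exact ⟨hr, EReal.coe_lt_top r⟩
  · lift Z to ℝ using ⟨h, (bot_le.trans_lt ha).ne'⟩
    rw [EReal.coe_lt_coe_iff] at ha
    filter_upwards [self_mem_nhdsWithin, mem_nhdsWithin_of_mem_nhds (Ioi_mem_nhds ha)] with r h1 h2
    exact ⟨h2, EReal.coe_lt_coe_iff.2 h1⟩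

/-- the function `v = h u' + u` satisfies `v' = −h f(u)` on
`(0,Z)` and `v(R_b) < 0`. -/
theorem v_derivative_and_negativity
    (c : EReal) (f q : ℝ → ℝ) (b β linf : ℝ) (hc : 0 < c)
    (hf1 : CondF1 c f b β) (hf2 : CondF2 c f)
    (hq1 : CondQ1 q) (hq2 : CondQ2 q) (hq4 : CondQ4 q linf)
    (u : ℝ → ℝ) (hu : IsSolutionE c f q u)
    (α : ℝ) (hα : b < α) (hu0 : u 0 = α)
    (Z : EReal) (hZ : 0 < Z)
    (hmono : ∀ r : ℝ, 0 < r → (r : EReal) < Z → 0 < u r ∧ deriv u r < 0)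
    (hlim : Tendsto u (leftFilter Z) (nhds 0))
    (Rb : ℝ) (hRb : 0 < Rb) (hRbZ : (Rb : EReal) < Z) (huRb : u Rb = b) :
    (∀ r : ℝ, 0 < r → (r : EReal) < Z →
      deriv (fun t => hfun q t * deriv u t + u t) r = - (hfun q r * f (u r))) ∧
    hfun q Rb * deriv u Rb + u Rb < 0 := by
  obtain ⟨-, hf0, hb, -, -, -, hfb, ⟨s, hs, hfs⟩, -⟩ := hf1
  set v : ℝ → ℝ := fun t => hfun q t * deriv u t + u t with hv
  have hderiv : ∀ r : ℝ, 0 < r → HasDerivAt v (-(hfun q r * f (u r))) r :=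
    fun r hr => hu.hasDerivAt_hfun_mul_deriv_add hq1 hq4.1 hr
  refine ⟨fun r hr _ => (hderiv r hr).deriv, ?_⟩
  change v Rb < 0
  set S : Set ℝ := {r : ℝ | Rb ≤ r ∧ (r : EReal) < Z}
  have hpos : ∀ r ∈ S, 0 < r := fun r hr => hRb.trans_le hr.1
  have hS : Convex ℝ S := OrdConnected.convex ⟨fun x hx y hy z hz =>
    ⟨hx.1.trans hz.1, (EReal.coe_le_coe_iff.2 hz.2).trans_lt hy.2⟩⟩
  have hRbS : Rb ∈ S := ⟨le_rfl, hRbZ⟩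
  have huanti : AntitoneOn u S := antitoneOn_of_deriv_nonpos hS
    (fun r hr => (hu.differentiableAt (hpos r hr)).continuousAt.continuousWithinAt)
    (fun r hr => (hu.differentiableAt (hpos r (interior_subset hr))).differentiableWithinAt)
    (fun r hr => (hmono r (hpos r (interior_subset hr)) (interior_subset hr).2).2.le)
  have humem : ∀ r ∈ S, u r ∈ Icc 0 b := fun r hr =>
    ⟨(hmono r (hpos r hr) hr.2).1.le, huRb ▸ huanti hRbS hr hr.1⟩
  have hvmono : MonotoneOn v S := by
    refine monotoneOn_of_deriv_nonneg hS
      (fun r hr => (hderiv r (hpos r hr)).continuousAt.continuousWithinAt)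
      (fun r hr => (hderiv r (hpos r (interior_subset hr))).differentiableAt.differentiableWithinAt)
      (fun r hr => ?_)
    have hrS := interior_subset hr
    rw [(hderiv r (hpos r hrS)).deriv, neg_nonneg]
    exact mul_nonpos_of_nonneg_of_nonpos (hfun_pos hq1 hq4 (hpos r hrS)).le
      (hfb _ (humem r hrS))
  have hvu : ∀ r ∈ S, v r ≤ u r := fun r hr => by
    have := mul_neg_of_pos_of_neg (hfun_pos hq1 hq4 (hpos r hr)) (hmono r (hpos r hr) hr.2).2
    simp only [hv]
    linarith
  have := leftFilter_neBot_s19 Z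
  have hvle : ∀ r ∈ S, v r ≤ 0 := fun r hr => by
    refine ge_of_tendsto hlim ?_
    filter_upwards [eventually_leftFilter_mem hr.2] with t ht
    have htS : t ∈ S := ⟨hr.1.trans ht.1.le, ht.2⟩
    exact (hvmono hr htS ht.1.le).trans (hvu t htS)
  refine (hvle Rb hRbS).lt_of_ne fun hvRb => hfs ?_
  have hv0 : ∀ r ∈ S, v r = 0 := fun r hr =>
    (hvle r hr).antisymm (hvRb ▸ hvmono hRbS hr hr.1)
  have hfu : ∀ r ∈ S, f (u r) = 0 := fun r hr => by
    obtain ⟨t, ht, htZ⟩ := (eventually_leftFilter_mem hr.2).exists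
    have hconst : HasDerivWithinAt v 0 (Icc r t) r :=
      (hasDerivWithinAt_const r (Icc r t) (0:ℝ)).congr
        (fun x hx => hv0 x ⟨hr.1.trans hx.1, (EReal.coe_le_coe_iff.2 hx.2).trans_lt htZ⟩)
        (hv0 r hr)
    have h := (uniqueDiffOn_Icc ht r (left_mem_Icc.2 ht.le)).eq_deriv _
      (hderiv r (hpos r hr)).hasDerivWithinAt hconst
    exact (mul_eq_zero.1 (neg_eq_zero.1 h)).resolve_left (hfun_pos hq1 hq4 (hpos r hr)).ne'
  rcases hs.1.eq_or_lt with rfl | hs0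
  · exact hf0
  obtain ⟨t, hts, ht, htZ⟩ :=
    ((hlim.eventually (Iio_mem_nhds hs0)).and (eventually_leftFilter_mem hRbZ)).exists
  have hIccS : Icc Rb t ⊆ S := fun x hx => ⟨hx.1, (EReal.coe_le_coe_iff.2 hx.2).trans_lt htZ⟩
  obtain ⟨r, hr, rfl⟩ := intermediate_value_Icc' ht.le
    (fun x hx => (hu.differentiableAt (hpos x (hIccS hx))).continuousAt.continuousWithinAt)
    (show s ∈ Icc (u t) (u Rb) from ⟨le_of_lt hts, huRb.symm ▸ hs.2⟩)
  exact hfu r (hIccS hr)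
end
end
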